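/- Let m = 2^s + 1 with s ≥ 1 an integer, let d ≥ 1, and suppose n ≥ d + ⌈3m/2⌉ + 1. If F is a family of nonempty subsets of [n+1] with χ(KG^4(F)) ≤ m, then for any continuous map f : Δ_n → ℝ^d there exist two Radon pairs (σ_1⁺, σ_1⁻) and (σ_2⁺, σ_2⁻) for f such that none of the four intersections σ_1⁺ ∩ σ_2⁺, σ_1⁺ ∩ σ_2⁻, σ_1⁻ ∩ σ_2⁺, σ_1⁻ ∩ σ_2⁻ contains a set from F. -/

import Mathlib

/-- The face `Δ_σ` of the standard simplex spanned by the vertices in `σ`. -/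
def simplexFace {n : ℕ} (σ : Finset (Fin n)) : Set (Fin n → ℝ) :=
  {x | x ∈ stdSimplex ℝ (Fin n) ∧ ∀ i, i ∉ σ → x i = 0}

/-- `(σp, σm)` is a Radon pair for `f`: the faces are disjoint and their images intersect. -/
def IsRadonPair {n d : ℕ} (f : (Fin n → ℝ) → EuclideanSpace ℝ (Fin d))
    (σp σm : Finset (Fin n)) : Prop :=
  Disjoint σp σm ∧ (f '' simplexFace σp ∩ f '' simplexFace σm).Nonempty

/-- `χ(KG^r(F)) ≤ m`: `F` can be colored with `m` colors so that no color class contains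
`r` pairwise disjoint members. -/
def KneserChromaticLe {n : ℕ} (F : Finset (Finset (Fin n))) (r m : ℕ) : Prop :=
  ∃ c : Finset (Fin n) → Fin m, ∀ G ⊆ F,
    (∀ A ∈ G, ∀ B ∈ G, A ≠ B → Disjoint A B) →
    (∀ A ∈ G, ∀ B ∈ G, c A = c B) → G.card < r


namespace TRP

set_option linter.unusedSimpArgs false

theorem exists_fix {G V : Type*} [Zero V] (dim : G → ℕ) (Φ : (G → V) → G → V)
    (hΦ : ∀ f g x, (∀ y, dim y < dim x → f y = g y) → Φ f x = Φ g x) : ∃ f, f = Φ f := by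
  classical
  let wf : WellFounded (fun a b : G => dim a < dim b) := InvImage.wf dim Nat.lt_wfRel.wf
  let F : ∀ x : G, (∀ y, dim y < dim x → V) → V :=
    fun x rec => Φ (fun y => if h : dim y < dim x then rec y h else 0) x
  refine ⟨wf.fix F, ?_⟩
  funext x
  rw [wf.fix_eq]
  apply hΦ
  intro y hy
  simp [hy]

/-- An additive action of the dihedral group of order 8. -/
structure D4 (V : Type*) [AddCommGroup V] where
  t1 : V →+ V
  t2 : V →+ V
  s : V →+ V
  t1t1 : ∀ x, t1 (t1 x) = x
  t2t2 : ∀ x, t2 (t2 x) = x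
  ss : ∀ x, s (s x) = x
  t2t1 : ∀ x, t2 (t1 x) = t1 (t2 x)
  st1 : ∀ x, s (t1 x) = t2 (s x)
  st2 : ∀ x, s (t2 x) = t1 (s x)

namespace D4

variable {V : Type*} [AddCommGroup V] (o : D4 V)

def bc (C : ℕ → ℕ → V) (i j : ℕ) : V :=
  (if i = 0 then 0 else C (i-1) j + (-1 : ℤ)^i • o.t1 (C (i-1) j)) +
  (-1 : ℤ)^i • (if j = 0 then 0 else C i (j-1) + (-1 : ℤ)^j • o.t2 (C i (j-1)))

def bd (C D : ℕ → ℕ → V) (E : ℕ → V) (i k : ℕ) : V :=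
  C k i + (-1 : ℤ)^(i*k) • o.t2 (C i k)
    - (if k = 0 then E i else D i (k-1) + (-1 : ℤ)^k • o.s (D i (k-1)))
    - (-1 : ℤ)^k • (D (i-1) k + (-1 : ℤ)^i • o.t1 (o.t2 (o.s (D (i-1) k))))

theorem bc_bc (C : ℕ → ℕ → V) (i j : ℕ) : o.bc (o.bc C) i j = 0 := by
  unfold bc
  rcases i with _ | _ | i <;> rcases j with _ | _ | j <;>
  simp [pow_succ, o.t1t1, o.t2t2, o.t2t1]
  · rcases neg_one_pow_eq_or ℤ j with h | h <;> simp [h]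
  · abel
  · rcases neg_one_pow_eq_or ℤ j with h | h <;> simp [h] <;> abel
  · rcases neg_one_pow_eq_or ℤ i with h | h <;> simp [h]
  · rcases neg_one_pow_eq_or ℤ i with h | h <;> simp [h] <;> abel
  · rcases neg_one_pow_eq_or ℤ i with h | h <;> rcases neg_one_pow_eq_or ℤ j with h' | h' <;>
     simp [h, h'] <;> abel

def be (E : ℕ → V) (i : ℕ) : V :=
  if i = 0 then 0 else E (i-1) + (-1 : ℤ)^i • o.t1 (o.t2 (E (i-1)))

/-- relations of a family -/
structure Rel (C D : ℕ → ℕ → V) (E : ℕ → V) : Prop where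
  S : ∀ i j, o.s (C i j) = (-1 : ℤ)^(i*j) • C j i
  T : ∀ i, C (i+1) (i+1) = D (i+1) i + (-1 : ℤ)^(i+1) • o.s (D (i+1) i)
  Z : C 0 0 = E 0
  F : ∀ i, o.s (E i) = E i
  G : ∀ i, D i i = 0

variable {o} {C D : ℕ → ℕ → V} {E : ℕ → V}

theorem Rel.bcS (h : o.Rel C D E) (i j : ℕ) :
    o.s (o.bc C i j) = (-1 : ℤ)^(i*j) • o.bc C j i := by
  have S := h.S
  unfold bc
  rcases i with _ | i <;> rcases j with _ | j <;>
  simp [pow_succ, pow_add, add_mul, mul_add, pow_mul, o.st1, o.st2, S]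
  · rcases neg_one_pow_eq_or ℤ i with h | h <;> rcases neg_one_pow_eq_or ℤ j with h' | h' <;>
     simp [h, h'] <;> abel

theorem Rel.bcT (h : o.Rel C D E) (i : ℕ) :
    o.bc C (i+1) (i+1) = o.bd C D E (i+1) i + (-1 : ℤ)^(i+1) • o.s (o.bd C D E (i+1) i) := by
  have S := h.S
  have T := h.T
  have Z := h.Z
  have F := h.F
  have G := h.G
  unfold bc bd
  rcases i with _ | i <;>
  simp [pow_succ, pow_add, add_mul, mul_add, pow_mul, o.st1, o.st2, o.ss, S, F, G]
  · abel
  · rcases neg_one_pow_eq_or ℤ i with h | h <;> simp [h, o.ss, o.st1, o.st2] <;> abel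

theorem Rel.beF (h : o.Rel C D E) (i : ℕ) : o.s (o.be E i) = o.be E i := by
  have F := h.F
  unfold be
  rcases i with _ | i <;> simp [o.st1, o.st2, F, o.t2t1]

theorem Rel.rel (h : o.Rel C D E) : o.Rel (o.bc C) (fun i k => if k < i then o.bd C D E i k else 0)
    (o.be E) where
  S := h.bcS
  T := by simpa using h.bcT
  Z := by simp [bc, be]
  F := h.beF
  G := by simp

theorem Rel.bd_bd (h : o.Rel C D E) (i k : ℕ) (hk : k < i) :
    o.bd (o.bc C) (fun i k => if k < i then o.bd C D E i k else 0) (o.be E) i k = 0 := by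
  have S := h.S
  have T := h.T
  have Z := h.Z
  have F := h.F
  have G := h.G
  obtain ⟨i, rfl⟩ : ∃ i', i = i' + 1 := ⟨i - 1, by omega⟩
  rcases Nat.lt_succ_iff_lt_or_eq.1 hk with hk' | rfl
  · rcases k with _ | k
    · rcases i with _ | i
      · omega
      · rcases i with _ | i
        · simp [bd, bc, be, pow_succ, pow_add, add_mul, mul_add, pow_mul, o.st1, o.st2, o.ss, o.t1t1, o.t2t2, o.t2t1, S, F, G, T, Z]
          abel
        · simp [bd, bc, be, pow_succ, pow_add, add_mul, mul_add, pow_mul, o.st1, o.st2, o.ss, o.t1t1, o.t2t2, o.t2t1, S, F, G, T, Z]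
          rcases neg_one_pow_eq_or ℤ i with h | h <;> simp [h, o.st1, o.st2, o.ss, o.t1t1, o.t2t2, o.t2t1] <;> abel
    · obtain ⟨i, rfl⟩ : ∃ i', i = i' + 1 := ⟨i - 1, by omega⟩
      have h1 : k < i + 1 + 1 := by omega
      have h2 : k < i := by omega
      have h3 : k < i + 1 := by omega
      have h4 : k ≤ i := by omega
      rcases k with _ | k
      · simp [bd, bc, be, pow_succ, pow_add, add_mul, mul_add, pow_mul, o.st1, o.st2, o.ss, o.t1t1,
          o.t2t2, o.t2t1, S, F, G, h1, h2, h3, h4]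
        rcases neg_one_pow_eq_or ℤ i with h | h <;>
          simp [h, o.st1, o.st2, o.ss, o.t1t1, o.t2t2, o.t2t1] <;> abel
      · simp [bd, bc, be, pow_succ, pow_add, add_mul, mul_add, pow_mul, o.st1, o.st2, o.ss, o.t1t1,
          o.t2t2, o.t2t1, S, F, G, h1, h2, h3, h4]
        rcases neg_one_pow_eq_or ℤ i with h | h <;> rcases neg_one_pow_eq_or ℤ k with h' | h' <;>
          simp [h, h', o.st1, o.st2, o.ss, o.t1t1, o.t2t2, o.t2t1] <;> abel
  · rcases k with _ | i
    · simp [bd, bc, be, pow_succ, pow_add, add_mul, mul_add, pow_mul, o.st1, o.st2, o.ss, o.t1t1,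
        o.t2t2, o.t2t1, S, F, G, T, Z]
    · have h1 : i < i + 1 + 1 := by omega
      rcases i with _ | i
      · simp [bd, bc, be, pow_succ, pow_add, add_mul, mul_add, pow_mul, o.st1, o.st2, o.ss, o.t1t1,
          o.t2t2, o.t2t1, S, F, G, T, h1]
        abel
      · simp [bd, bc, be, pow_succ, pow_add, add_mul, mul_add, pow_mul, o.st1, o.st2, o.ss, o.t1t1,
          o.t2t2, o.t2t1, S, F, G, T, h1]
        rcases neg_one_pow_eq_or ℤ i with h | h <;>
          simp [h, o.st1, o.st2, o.ss, o.t1t1, o.t2t2, o.t2t1] <;> abel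

/-! ### Linearity and naturality -/

theorem be_be (E : ℕ → V) (i : ℕ) : o.be (o.be E) i = 0 := by
  unfold be
  rcases i with _ | _ | i <;> simp [pow_succ, o.t1t1, o.t2t2, o.t2t1]
  rcases neg_one_pow_eq_or ℤ i with h | h <;> simp [h]

theorem bc_sub (C C' : ℕ → ℕ → V) (i j : ℕ) :
    o.bc (fun i j => C i j - C' i j) i j = o.bc C i j - o.bc C' i j := by
  unfold bc
  split_ifs <;> simp [smul_sub, smul_add, sub_eq_add_neg] <;> abel

theorem bd_sub (C C' D D' : ℕ → ℕ → V) (E E' : ℕ → V) (i j : ℕ) :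
    o.bd (fun i j => C i j - C' i j) (fun i j => D i j - D' i j) (fun i => E i - E' i) i j
      = o.bd C D E i j - o.bd C' D' E' i j := by
  unfold bd
  split_ifs <;> simp [smul_sub, smul_add, sub_eq_add_neg] <;> abel

section nat
variable {W : Type*} [AddCommGroup W] {o' : D4 W} (g : V →+ W)
  (h1 : ∀ x, g (o.t1 x) = o'.t1 (g x)) (h2 : ∀ x, g (o.t2 x) = o'.t2 (g x))
  (h3 : ∀ x, g (o.s x) = o'.s (g x))
set_option linter.unusedSectionVars false
include h1 h2

theorem bc_nat (C : ℕ → ℕ → V) (i j : ℕ) :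
    g (o.bc C i j) = o'.bc (fun i j => g (C i j)) i j := by
  unfold bc
  split_ifs <;> simp [h1, h2]

theorem be_nat (C : ℕ → V) (i : ℕ) :
    g (o.be C i) = o'.be (fun i => g (C i)) i := by
  unfold be
  split_ifs <;> simp [h1, h2]

include h3
theorem bd_nat (C D : ℕ → ℕ → V) (E : ℕ → V) (i j : ℕ) :
    g (o.bd C D E i j) = o'.bd (fun i j => g (C i j)) (fun i j => g (D i j)) (fun i => g (E i)) i j := by
  unfold bd
  split_ifs <;> simp [h1, h2, h3]

theorem Rel.map (h : o.Rel C D E) :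
    o'.Rel (fun i j => g (C i j)) (fun i j => g (D i j)) (fun i => g (E i)) where
  S i j := by rw [← h3, h.S, map_zsmul]
  T i := by rw [h.T]; simp [h3]
  Z := by rw [h.Z]
  F i := by rw [← h3, h.F]
  G i := by simp [h.G]

end nat

theorem Rel.sub {C' D' : ℕ → ℕ → V} {E' : ℕ → V} (h : o.Rel C D E) (h' : o.Rel C' D' E') :
    o.Rel (fun i j => C i j - C' i j) (fun i j => D i j - D' i j) (fun i => E i - E' i) where
  S i j := by simp [h.S, h'.S, smul_sub]
  T i := by simp only [h.T, h'.T, map_sub, smul_sub]; abel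
  Z := by simp [h.Z, h'.Z]
  F i := by simp [h.F, h'.F]
  G i := by simp [h.G, h'.G]

/-! ### Families generated by free data -/

inductive Gen
  | c (i j : ℕ)
  | d (i k : ℕ)
  | e (i : ℕ)

def Gen.dim : Gen → ℕ
  | .c i j => i + j
  | .d i k => i + k + 1
  | .e i => i

def CC (o : D4 V) (f : Gen → V) (i j : ℕ) : V :=
  if j < i then f (.c i j) else if i < j then (-1 : ℤ)^(i*j) • o.s (f (.c j i)) else
    if i = 0 then f (.e 0) else f (.d i (i-1)) + (-1 : ℤ)^i • o.s (f (.d i (i-1)))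

def DD (f : Gen → V) (i k : ℕ) : V := if k < i then f (.d i k) else 0

theorem rel_gen (f : Gen → V) (hf : ∀ i, o.s (f (.e i)) = f (.e i)) :
    o.Rel (CC o f) (DD f) (fun i => f (.e i)) where
  S i j := by
    unfold CC
    rcases lt_trichotomy i j with h | rfl | h
    · simp [h, h.not_gt, o.ss, mul_comm]
    · rcases i with _ | i
      · simp [hf]
      · simp [o.ss, pow_succ, mul_add, add_mul, pow_add, pow_mul]
        rcases neg_one_pow_eq_or ℤ i with h | h <;> simp [h]
        · abel
        · abel
    · simp [h, h.not_gt, smul_smul, mul_comm j i, ← mul_pow]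
  T i := by simp [CC, DD]
  Z := by simp [CC]
  F := hf
  G i := by simp [DD]

def BG (o : D4 V) (f : Gen → V) : Gen → V
  | .c i j => if j < i then o.bc (CC o f) i j else 0
  | .d i k => if k < i then o.bd (CC o f) (DD f) (fun i => f (.e i)) i k else 0
  | .e i => o.be (fun i => f (.e i)) i

theorem CC_BG (f : Gen → V) (hf : ∀ i, o.s (f (.e i)) = f (.e i)) (i j : ℕ) :
    CC o (BG o f) i j = o.bc (CC o f) i j := by
  have h := (rel_gen (o := o) f hf)
  have hS := h.bcS
  conv_lhs => unfold CC
  rcases lt_trichotomy i j with h' | rfl | h'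
  · simp [h', h'.not_gt, BG, hS, smul_smul, mul_comm j i, ← mul_pow]
  · rcases i with _ | i
    · simp [BG, be, bc]
    · simp [BG, h.bcT]
  · simp [h', BG]

theorem DD_BG (f : Gen → V) (i k : ℕ) :
    DD (BG o f) i k = if k < i then o.bd (CC o f) (DD f) (fun i => f (.e i)) i k else 0 := by
  conv_lhs => unfold DD
  split_ifs with h
  · simp [BG, h]
  · rfl

theorem BG_BG (f : Gen → V) (hf : ∀ i, o.s (f (.e i)) = f (.e i)) (x : Gen) :
    BG o (BG o f) x = 0 := by
  have h := (rel_gen (o := o) f hf)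
  have e1 : CC o (BG o f) = o.bc (CC o f) := by
    funext i j; exact CC_BG f hf i j
  have e2 : DD (BG o f) = (fun i k => if k < i then o.bd (CC o f) (DD f) (fun i => f (.e i)) i k else 0) := by
    funext i k; exact DD_BG f i k
  have e3 : (fun i => BG o f (.e i)) = o.be (fun i => f (.e i)) := by
    funext i; rfl
  cases x with
  | c i j =>
    simp only [BG.eq_1 o (BG o f), e1, bc_bc, ite_self]
  | d i k =>
    simp only [BG.eq_2 o (BG o f), e1, e2, e3]
    split_ifs with hk
    · exact h.bd_bd i k hk
    · rfl
  | e i =>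
    simp only [BG.eq_3 o (BG o f), e3]
    exact be_be _ _

theorem BG_s (f : Gen → V) (hf : ∀ i, o.s (f (.e i)) = f (.e i)) (i : ℕ) :
    o.s (BG o f (.e i)) = BG o f (.e i) := (rel_gen (o := o) f hf).beF i

theorem CC_nat {W : Type*} [AddCommGroup W] {o' : D4 W} (g : V →+ W)
    (h3 : ∀ x, g (o.s x) = o'.s (g x)) (f : Gen → V) (i j : ℕ) :
    g (CC o f i j) = CC o' (fun x => g (f x)) i j := by
  unfold CC
  split_ifs <;> simp [h3]

theorem DD_nat {W : Type*} [AddCommGroup W] (g : V →+ W) (f : Gen → V) (i j : ℕ) :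
    g (DD f i j) = DD (fun x => g (f x)) i j := by
  unfold DD
  split_ifs <;> simp

theorem BG_nat {W : Type*} [AddCommGroup W] {o' : D4 W} (g : V →+ W)
    (h1 : ∀ x, g (o.t1 x) = o'.t1 (g x)) (h2 : ∀ x, g (o.t2 x) = o'.t2 (g x))
    (h3 : ∀ x, g (o.s x) = o'.s (g x)) (f : Gen → V) (x : Gen) :
    g (BG o f x) = BG o' (fun x => g (f x)) x := by
  cases x with
  | c i j =>
    simp only [BG]
    split_ifs
    · rw [bc_nat g h1 h2]; simp only [CC_nat g h3]
    · simp
  | d i j =>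
    simp only [BG]
    split_ifs
    · rw [bd_nat g h1 h2 h3]; simp only [CC_nat g h3, DD_nat g]
    · simp
  | e i => exact be_nat g h1 h2 (fun i => f (.e i)) i

theorem CC_sub (f g : Gen → V) (i j : ℕ) :
    CC o (fun x => f x - g x) i j = CC o f i j - CC o g i j := by
  unfold CC
  split_ifs <;> simp [smul_sub]; abel

theorem DD_sub (f g : Gen → V) (i j : ℕ) :
    DD (fun x => f x - g x) i j = DD f i j - DD g i j := by
  unfold DD
  split_ifs <;> simp

theorem be_sub (f g : ℕ → V) (i : ℕ) :
    o.be (fun x => f x - g x) i = o.be f i - o.be g i := by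
  unfold be
  split_ifs <;> simp [smul_sub]; abel

theorem BG_sub (f g : Gen → V) (x : Gen) :
    BG o (fun x => f x - g x) x = BG o f x - BG o g x := by
  cases x with
  | c i j =>
    simp only [BG]
    split_ifs
    · rw [← bc_sub]; congr 1; funext i j; exact CC_sub f g i j
    · simp
  | d i j =>
    simp only [BG]
    split_ifs
    · rw [← bd_sub]; congr 1; funext i j; exact CC_sub f g i j
      funext i j; exact DD_sub f g i j
    · simp
  | e i => exact be_sub (fun i => f (.e i)) (fun i => g (.e i)) i

/-! ### Locality -/

def Gen.ok (m : ℕ) : Gen → Prop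
  | .c i j => j < i ∧ i ≤ m
  | .d i k => k < i ∧ i ≤ m
  | .e i => i ≤ m

def Gen.idx : Gen → ℕ
  | .c i _ => i
  | .d i _ => i
  | .e i => i

theorem Gen.ok_mono {m n : ℕ} (h : m ≤ n) {x : Gen} (hx : x.ok m) : x.ok n := by
  cases x <;> simp only [Gen.ok] at * <;> omega

theorem Gen.ok_idx {m : ℕ} {x : Gen} (hx : x.ok m) : x.idx ≤ m := by
  cases x <;> simp only [Gen.ok, Gen.idx] at * <;> omega

section mem
variable (S : AddSubgroup V) (h1 : ∀ x ∈ S, o.t1 x ∈ S) (h2 : ∀ x ∈ S, o.t2 x ∈ S)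
  (h3 : ∀ x ∈ S, o.s x ∈ S)

include h3 in
theorem CC_mem (f : Gen → V) (i j m : ℕ) (hi : i ≤ m) (hj : j ≤ m)
    (h : ∀ y : Gen, y.ok m → y.dim = i + j → f y ∈ S) : CC o f i j ∈ S := by
  unfold CC
  split_ifs with h4 h5 h6
  · exact h (.c i j) ⟨h4, hi⟩ rfl
  · exact S.zsmul_mem (h3 _ (h (.c j i) ⟨h5, hj⟩ (by simp [Gen.dim, add_comm]))) _
  · refine h (.e 0) (Nat.zero_le _) ?_
    simp [Gen.dim]; omega
  · have : f (.d i (i-1)) ∈ S := h (.d i (i-1)) ⟨by omega, hi⟩ (by simp only [Gen.dim]; omega)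
    exact add_mem this (S.zsmul_mem (h3 _ this) _)

theorem DD_mem (f : Gen → V) (i j m : ℕ) (hi : i ≤ m)
    (h : ∀ y : Gen, y.ok m → y.dim = i + j + 1 → f y ∈ S) : DD f i j ∈ S := by
  unfold DD
  split_ifs with h4
  · exact h _ ⟨h4, hi⟩ rfl
  · exact zero_mem _

include h1 h2 in
theorem bc_mem (C : ℕ → ℕ → V) (i j : ℕ) (h : i ≠ 0 → C (i-1) j ∈ S) (h' : j ≠ 0 → C i (j-1) ∈ S) :
    o.bc C i j ∈ S := by
  unfold bc
  refine add_mem ?_ (S.zsmul_mem ?_ _)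
  · split_ifs with h4
    · exact zero_mem _
    · exact add_mem (h h4) (S.zsmul_mem (h1 _ (h h4)) _)
  · split_ifs with h4
    · exact zero_mem _
    · exact add_mem (h' h4) (S.zsmul_mem (h2 _ (h' h4)) _)

include h1 h2 h3 in
theorem BG_mem (f : Gen → V) (x : Gen)
    (h : ∀ y : Gen, y.ok x.idx → y.dim + 1 = x.dim → f y ∈ S) : BG o f x ∈ S := by
  cases x with
  | c i j =>
    have hx : (Gen.c i j).dim = i + j := rfl
    rw [hx] at h
    simp only [BG]
    split_ifs with hj
    · apply bc_mem S h1 h2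
      · intro h0
        exact CC_mem S h3 f _ _ i (by omega) (by omega) fun y hy hd => h y hy (by omega)
      · intro h0
        exact CC_mem S h3 f _ _ i (by omega) (by omega) fun y hy hd => h y hy (by omega)
    · exact zero_mem _
  | d i k =>
    have hx : (Gen.d i k).dim = i + k + 1 := rfl
    rw [hx] at h
    simp only [BG]
    split_ifs with hk
    · unfold bd
      refine sub_mem (sub_mem (add_mem ?_ (S.zsmul_mem (h2 _ ?_) _)) ?_) (S.zsmul_mem ?_ _)
      · exact CC_mem S h3 f _ _ i (by omega) (by omega) fun y hy hd => h y hy (by omega)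
      · exact CC_mem S h3 f _ _ i (by omega) (by omega) fun y hy hd => h y hy (by omega)
      · split_ifs with h0
        · exact h (.e i) (le_refl i) (by simp only [Gen.dim]; omega)
        · have : DD f i (k-1) ∈ S :=
            DD_mem S f _ _ i (by omega) fun y hy hd => h y hy (by omega)
          exact add_mem this (S.zsmul_mem (h3 _ this) _)
      · have : DD f (i-1) k ∈ S :=
          DD_mem S f _ _ i (by omega) fun y hy hd => h y hy (by omega)
        exact add_mem this (S.zsmul_mem (h1 _ (h2 _ (h3 _ this))) _)
    · exact zero_mem _
  | e i =>
    simp only [BG, be]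
    split_ifs with h0
    · exact zero_mem _
    · have : f (.e (i-1)) ∈ S := h (.e (i-1)) (Nat.sub_le _ _) (by simp only [Gen.dim]; omega)
      exact add_mem this (S.zsmul_mem (h1 _ (h2 _ this)) _)

end mem

theorem CC_congr (f g : Gen → V) (i j m : ℕ) (hi : i ≤ m) (hj : j ≤ m)
    (h : ∀ y : Gen, y.ok m → y.dim = i + j → f y = g y) : CC o f i j = CC o g i j := by
  rw [← sub_eq_zero, ← CC_sub, ← AddSubgroup.mem_bot]
  apply CC_mem _ (by simp) _ _ _ m hi hj
  intro y hy hd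
  simp [h y hy hd]

theorem BG_congr (f g : Gen → V) (x : Gen)
    (h : ∀ y : Gen, y.ok x.idx → y.dim + 1 = x.dim → f y = g y) : BG o f x = BG o g x := by
  rw [← sub_eq_zero, ← BG_sub, ← AddSubgroup.mem_bot]
  apply BG_mem _ (by simp) (by simp) (by simp)
  intro y hy hd
  simp [h y hy hd]

theorem bc_congr (f g : ℕ → ℕ → V) (i j : ℕ) (h : i ≠ 0 → f (i-1) j = g (i-1) j)
    (h' : j ≠ 0 → f i (j-1) = g i (j-1)) : o.bc f i j = o.bc g i j := by
  unfold bc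
  split_ifs with h1 h2 h2
  · rfl
  · rw [h' h2]
  · rw [h h1]
  · rw [h h1, h' h2]

end D4
end TRP


namespace TRP

noncomputable section

set_option linter.unusedSectionVars false

variable {I : Type} [DecidableEq I]

abbrev Lam (I : Type) := ExteriorAlgebra ℤ ((I × Bool) →₀ ℤ)

def vv (a : I × Bool) : Lam I := ExteriorAlgebra.ι ℤ (Finsupp.single a 1)

def mono (l : List (I × Bool)) : Lam I := (l.map vv).prod

@[simp] theorem mono_nil : mono ([] : List (I × Bool)) = 1 := rfl
@[simp] theorem mono_cons (a : I × Bool) (l) : mono (a :: l) = vv a * mono l := by simp [mono]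

theorem mono_closure : AddSubgroup.closure (Set.range (mono : List (I × Bool) → Lam I)) = ⊤ := by
  rw [eq_top_iff]
  intro x hxt
  clear hxt
  induction x using CliffordAlgebra.left_induction with
  | algebraMap r =>
    rw [Algebra.algebraMap_eq_smul_one]
    have h1 : (1 : Lam I) ∈ AddSubgroup.closure (Set.range (mono : List (I × Bool) → Lam I)) :=
      AddSubgroup.subset_closure (Set.mem_range_self [])
    exact AddSubgroup.zsmul_mem _ h1 r
  | add x y hx hy => exact add_mem hx hy
  | ι_mul x m hx =>
    induction m using Finsupp.induction_linear with
    | zero => simp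
    | add f g hf hg => rw [map_add, add_mul]; exact add_mem hf hg
    | single a r =>
      have : CliffordAlgebra.ι (0 : QuadraticForm ℤ ((I × Bool) →₀ ℤ)) (Finsupp.single a r) = r • vv a := by
        unfold vv ExteriorAlgebra.ι
        rw [← map_zsmul]; simp
      rw [this, smul_mul_assoc]
      apply AddSubgroup.zsmul_mem
      induction hx using AddSubgroup.closure_induction with
      | mem y hy => obtain ⟨l, rfl⟩ := hy; exact AddSubgroup.subset_closure ⟨a :: l, by simp⟩
      | zero => simp
      | add y z _ _ hy hz => rw [mul_add]; exact add_mem hy hz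
      | neg y _ hy => rw [mul_neg]; exact neg_mem hy

theorem hom_ext {A : Type*} [AddCommGroup A] (f g : Lam I →+ A) (h : ∀ l, f (mono l) = g (mono l))
    (x : Lam I) : f x = g x := by
  have : x ∈ AddSubgroup.closure (Set.range (mono : List (I × Bool) → Lam I)) := by
    rw [mono_closure]; trivial
  induction this using AddSubgroup.closure_induction with
  | mem y hy => obtain ⟨l, rfl⟩ := hy; exact h l
  | zero => simp
  | add y z _ _ hy hz => simp [hy, hz]
  | neg y _ hy => simp [hy]

def con (φ : I × Bool → ℤ) : Lam I →ₗ[ℤ] Lam I :=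
  CliffordAlgebra.contractLeft (Finsupp.linearCombination ℤ φ)

@[simp] theorem con_one (φ : I × Bool → ℤ) : con φ 1 = 0 := CliffordAlgebra.contractLeft_one _ _

theorem con_v_mul (φ : I × Bool → ℤ) (a) (x : Lam I) :
    con φ (vv a * x) = φ a • x - vv a * con φ x := by
  unfold con vv ExteriorAlgebra.ι
  rw [CliffordAlgebra.contractLeft_ι_mul]
  simp

theorem con_con (φ : I × Bool → ℤ) (x : Lam I) : con φ (con φ x) = 0 :=
  CliffordAlgebra.contractLeft_contractLeft _ _

theorem con_comm (φ ψ : I × Bool → ℤ) (x : Lam I) : con φ (con ψ x) = - con ψ (con φ x) :=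
  CliffordAlgebra.contractLeft_comm _ _ _

def mp (g : I × Bool → I × Bool) : Lam I →ₐ[ℤ] Lam I :=
  ExteriorAlgebra.map (Finsupp.lmapDomain ℤ ℤ g)

@[simp] theorem mp_v (g : I × Bool → I × Bool) (a) : mp g (vv a) = vv (g a) := by
  simp [mp, vv]

theorem mp_mono (g : I × Bool → I × Bool) (l) : mp g (mono l) = mono (l.map g) := by
  induction l with
  | nil => simp
  | cons a l ih => simp [ih]

theorem con_mp (φ : I × Bool → ℤ) (g : I × Bool → I × Bool) (x : Lam I) :
    con φ (mp g x) = mp g (con (φ ∘ g) x) := by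
  refine hom_ext ((con φ).toAddMonoidHom.comp (mp g : Lam I →+ Lam I))
    ((mp g : Lam I →+ Lam I).comp (con (φ ∘ g)).toAddMonoidHom) (fun l => ?_) x
  simp only [AddMonoidHom.comp_apply, LinearMap.toAddMonoidHom_coe, AddMonoidHom.coe_coe]
  induction l with
  | nil => simp
  | cons a l ih => simp [con_v_mul, ih]

theorem mp_mp (g h : I × Bool → I × Bool) (x : Lam I) : mp g (mp h x) = mp (g ∘ h) x := by
  refine hom_ext ((mp g : Lam I →+ Lam I).comp (mp h : Lam I →+ Lam I))
    (mp (g ∘ h) : Lam I →+ Lam I) (fun l => ?_) x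
  simp [mp_mono]

theorem mp_id (x : Lam I) : mp id x = x := by
  refine hom_ext (mp (id : I × Bool → I × Bool) : Lam I →+ Lam I) (AddMonoidHom.id _) (fun l => ?_) x
  simp [mp_mono]

/-- the boundary operator -/
def bo : Lam I →ₗ[ℤ] Lam I := con (fun _ => 1)

theorem bo_v (a) (x : Lam I) : bo (vv a * x) = x - vv a * bo x := by
  simp [bo, con_v_mul]

@[simp] theorem bo_one : bo (1 : Lam I) = 0 := con_one _

theorem bo_bo (x : Lam I) : bo (bo x) = 0 := con_con _ _

theorem bo_mp (g : I × Bool → I × Bool) (x : Lam I) : bo (mp g x) = mp g (bo x) := con_mp _ _ _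

theorem v_sq (a : I × Bool) : vv a * vv a = 0 := ExteriorAlgebra.ι_sq_zero _
theorem v_anti (a b : I × Bool) : vv a * vv b = - (vv b * vv a) := by
  rw [eq_neg_iff_add_eq_zero]
  exact ExteriorAlgebra.ι_add_mul_swap _ _

theorem v_mono_mem (a : I × Bool) (l) (h : a ∈ l) : vv a * mono l = 0 := by
  induction l with
  | nil => simp at h
  | cons b l ih =>
    rw [mono_cons, ← mul_assoc]
    rcases List.mem_cons.1 h with rfl | h
    · rw [v_sq, zero_mul]
    · rw [v_anti, neg_mul, mul_assoc, ih h, mul_zero, neg_zero]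

theorem mono_dup (l : List (I × Bool)) (h : ¬ l.Nodup) : mono l = 0 := by
  induction l with
  | nil => simp at h
  | cons b l ih =>
    rw [mono_cons]
    by_cases hb : b ∈ l
    · exact v_mono_mem _ _ hb
    · rw [ih, mul_zero]
      intro hl
      exact h (List.nodup_cons.2 ⟨hb, hl⟩)

def Good (J : Finset I) (l : List (I × Bool)) : Prop :=
  (∀ a ∈ l, a.1 ∈ J) ∧ ∀ a ∈ l, ∀ b ∈ l, a.1 = b.1 → a = b

def YY (J : Finset I) (k : ℕ) : AddSubgroup (Lam I) :=
  AddSubgroup.closure {x | ∃ l, l.length = k ∧ Good J l ∧ x = mono l}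

theorem mem_YY {J : Finset I} {l} (h : Good J l) : mono l ∈ YY J l.length :=
  AddSubgroup.subset_closure ⟨l, rfl, h, rfl⟩

theorem YY_map {J J' : Finset I} {k k' : ℕ} (f : Lam I →+ Lam I)
    (h : ∀ l, l.length = k → Good J l → f (mono l) ∈ YY J' k') {x : Lam I} (hx : x ∈ YY J k) :
    f x ∈ YY J' k' := by
  induction hx using AddSubgroup.closure_induction with
  | mem y hy => obtain ⟨l, h1, h2, rfl⟩ := hy; exact h l h1 h2
  | zero => simp
  | add y z _ _ hy hz => rw [map_add]; exact add_mem hy hz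
  | neg y _ hy => rw [map_neg]; exact neg_mem hy

theorem YY_eq {J : Finset I} {k : ℕ} {A : Type*} [AddCommGroup A] (f g : Lam I →+ A)
    (h : ∀ l, l.length = k → Good J l → f (mono l) = g (mono l)) {x : Lam I} (hx : x ∈ YY J k) :
    f x = g x := by
  induction hx using AddSubgroup.closure_induction with
  | mem y hy => obtain ⟨l, h1, h2, rfl⟩ := hy; exact h l h1 h2
  | zero => simp
  | add y z _ _ hy hz => simp [hy, hz]
  | neg y _ hy => simp [hy]

theorem YY_mono {J J' : Finset I} (h : J ⊆ J') {k : ℕ} : YY J k ≤ YY J' k := by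
  apply AddSubgroup.closure_mono
  rintro x ⟨l, h1, h2, rfl⟩
  exact ⟨l, h1, ⟨fun a ha => h (h2.1 a ha), h2.2⟩, rfl⟩

theorem YY_top {J : Finset I} {k : ℕ} (hk : J.card < k) {x : Lam I} (hx : x ∈ YY J k) : x = 0 := by
  refine YY_eq (AddMonoidHom.id _) 0 (fun l hl hg => ?_) hx
  simp only [AddMonoidHom.id_apply, AddMonoidHom.zero_apply]
  apply mono_dup
  intro hn
  have h1 : (l.map Prod.fst).Nodup := by
    apply List.Nodup.map_on _ hn
    intro a ha b hb hab
    exact hg.2 a ha b hb hab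
  have h2 : (l.map Prod.fst).toFinset ⊆ J := by
    intro i hi
    simp only [List.mem_toFinset, List.mem_map] at hi
    obtain ⟨a, ha, rfl⟩ := hi
    exact hg.1 a ha
  have h3 := Finset.card_le_card h2
  rw [List.toFinset_card_of_nodup h1, List.length_map] at h3
  omega

/-- functions on labels that come from ones compatible with indices -/
theorem mp_YY {J J' : Finset I} {k : ℕ} (g : I × Bool → I × Bool)
    (h1 : ∀ a, a.1 ∈ J → (g a).1 ∈ J')
    (h2 : ∀ a b, a.1 ∈ J → b.1 ∈ J → (g a).1 = (g b).1 → a.1 = b.1)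
    {x : Lam I} (hx : x ∈ YY J k) : mp g x ∈ YY J' k := by
  refine YY_map (mp g : Lam I →+ Lam I) (fun l hl hg => ?_) hx
  simp only [AddMonoidHom.coe_coe, mp_mono]
  rw [← hl, ← List.length_map g]
  apply mem_YY
  constructor
  · intro a ha
    obtain ⟨b, hb, rfl⟩ := List.mem_map.1 ha
    exact h1 _ (hg.1 b hb)
  · intro a ha b hb hab
    obtain ⟨a, ha', rfl⟩ := List.mem_map.1 ha
    obtain ⟨b, hb', rfl⟩ := List.mem_map.1 hb
    rw [hg.2 a ha' b hb' (h2 _ _ (hg.1 a ha') (hg.1 b hb') hab)]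

theorem cone_YY {J J' : Finset I} {k : ℕ} (a : I × Bool) (hJ : J ⊆ J') (ha : a.1 ∈ J')
    (ha' : a.1 ∉ J) {x : Lam I} (hx : x ∈ YY J k) : vv a * x ∈ YY J' (k+1) := by
  refine YY_map (AddMonoidHom.mulLeft (vv a)) (fun l hl hg => ?_) hx
  simp only [AddMonoidHom.coe_mulLeft, ← mono_cons]
  have : Good J' (a :: l) := by
    constructor
    · intro b hb
      rcases List.mem_cons.1 hb with rfl | hb
      · exact ha
      · exact hJ (hg.1 b hb)
    · intro b hb c hc hbc
      rcases List.mem_cons.1 hb with rfl | hb' <;> rcases List.mem_cons.1 hc with rfl | hc'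
      · rfl
      · exact absurd (hbc ▸ hg.1 c hc') ha'
      · exact absurd (hbc ▸ hg.1 b hb') ha'
      · exact hg.2 b hb' c hc' hbc
  have := mem_YY this
  simpa [hl] using this

/-! ### The contraction -/

def rf (i : I) (a : I × Bool) : I × Bool := if a.1 = i then (i, true) else a
def fl (i : I) (a : I × Bool) : I × Bool := if a.1 = i then (i, !a.2) else a

theorem rf_fst (i : I) (a : I × Bool) : (rf i a).1 = a.1 := by
  unfold rf; split_ifs with h <;> simp [h]

theorem fl_fst (i : I) (a : I × Bool) : (fl i a).1 = a.1 := by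
  unfold fl; split_ifs with h <;> simp [h]

theorem rf_comm (i j : I) : rf i ∘ rf j = rf j ∘ rf i := by
  funext ⟨a, b⟩
  by_cases h : a = i <;> by_cases h' : a = j <;> simp [rf, h, h'] <;> aesop

def Cc (i : I) : Lam I →+ Lam I :=
  (AddMonoidHom.mulLeft (vv (i, true))).comp (mp (rf i) : Lam I →+ Lam I)

theorem Cc_apply (i : I) (x : Lam I) : Cc i x = vv (i, true) * mp (rf i) x := rfl

theorem bo_Cc (i : I) (x : Lam I) : bo (Cc i x) = mp (rf i) x - Cc i (bo x) := by
  rw [Cc_apply, bo_v, bo_mp, Cc_apply]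

def HH : List I → Lam I →+ Lam I
  | [] => 0
  | i :: l => Cc i + HH l - (mp (rf i) : Lam I →+ Lam I).comp (HH l)

def PP : List I → Lam I →+ Lam I
  | [] => AddMonoidHom.id _
  | i :: l => PP l - (mp (rf i) : Lam I →+ Lam I).comp (PP l)

theorem bo_HH (l : List I) (x : Lam I) : bo (HH l x) + HH l (bo x) = x - PP l x := by
  induction l with
  | nil => simp [HH, PP]
  | cons i l ih =>
    have ih' : bo (HH l x) = x - PP l x - HH l (bo x) := by rw [← ih]; abel
    simp only [HH, PP, AddMonoidHom.sub_apply, AddMonoidHom.add_apply, AddMonoidHom.comp_apply,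
      AddMonoidHom.coe_coe, map_add, map_sub, bo_Cc, bo_mp, ih']
    abel

theorem PP_comm (l : List I) (i : I) (x : Lam I) : PP l (mp (rf i) x) = mp (rf i) (PP l x) := by
  induction l with
  | nil => simp [PP]
  | cons j l ih =>
    simp only [PP, AddMonoidHom.sub_apply, AddMonoidHom.comp_apply,
      AddMonoidHom.coe_coe, map_sub, ih, mp_mp, rf_comm i j]

theorem PP_zero (l : List I) (i : I) (hi : i ∈ l) (x : Lam I) (hx : mp (rf i) x = x) :
    PP l x = 0 := by
  induction l with
  | nil => simp at hi
  | cons j l ih =>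
    simp only [PP, AddMonoidHom.sub_apply, AddMonoidHom.comp_apply, AddMonoidHom.coe_coe]
    rcases List.mem_cons.1 hi with rfl | hi
    · rw [← PP_comm, hx, sub_self]
    · rw [ih hi]; simp

theorem PP_YY {J : Finset I} {k : ℕ} (hk : k < J.card) {x : Lam I} (hx : x ∈ YY J k) :
    PP J.toList x = 0 := by
  refine YY_eq (PP J.toList) 0 (fun l hl hg => ?_) hx
  have : ∃ i ∈ J, i ∉ l.map Prod.fst := by
    by_contra hcon
    push Not at hcon
    have h2 : J ⊆ (l.map Prod.fst).toFinset := fun i hi => List.mem_toFinset.2 (hcon i hi)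
    have h3 := Finset.card_le_card h2
    have h4 := List.toFinset_card_le (l.map Prod.fst)
    rw [List.length_map] at h4
    omega
  obtain ⟨i, hi, hil⟩ := this
  apply PP_zero _ i (Finset.mem_toList.2 hi)
  rw [mp_mono]
  congr 1
  conv_rhs => rw [← List.map_id l]
  apply List.map_congr_left
  intro a ha
  have : a.1 ≠ i := fun h => hil (List.mem_map.2 ⟨a, ha, h⟩)
  simp [rf, this]

theorem rf_YY {J : Finset I} {k : ℕ} (i : I) {x : Lam I} (hx : x ∈ YY J k) : mp (rf i) x ∈ YY J k :=
  mp_YY _ (by simp [rf_fst]) (by simp [rf_fst]) hx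

theorem fl_YY {J : Finset I} {k : ℕ} (i : I) {x : Lam I} (hx : x ∈ YY J k) : mp (fl i) x ∈ YY J k :=
  mp_YY _ (by simp [fl_fst]) (by simp [fl_fst]) hx

theorem Cc_YY {J : Finset I} {k : ℕ} (i : I) (hi : i ∈ J) {x : Lam I} (hx : x ∈ YY J k) :
    Cc i x ∈ YY J (k+1) := by
  refine YY_map (Cc i) (fun l hl hg => ?_) hx
  simp only [Cc_apply, mp_mono, ← mono_cons]
  have : Good J ((i, true) :: l.map (rf i)) := by
    constructor
    · intro b hb
      rcases List.mem_cons.1 hb with rfl | hb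
      · exact hi
      · obtain ⟨b, hb', rfl⟩ := List.mem_map.1 hb
        rw [rf_fst]; exact hg.1 b hb'
    · have key : ∀ a ∈ l, (rf i a).1 = i → rf i a = (i, true) := by
        intro a _ h
        rw [rf_fst] at h
        simp [rf, h]
      intro b hb c hc hbc
      rcases List.mem_cons.1 hb with rfl | hb1 <;> rcases List.mem_cons.1 hc with rfl | hc1
      · rfl
      · obtain ⟨c, hc2, rfl⟩ := List.mem_map.1 hc1
        rw [key c hc2 hbc.symm]
      · obtain ⟨b, hb2, rfl⟩ := List.mem_map.1 hb1
        rw [key b hb2 hbc]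
      · obtain ⟨c, hc2, rfl⟩ := List.mem_map.1 hc1
        obtain ⟨b, hb2, rfl⟩ := List.mem_map.1 hb1
        rw [rf_fst, rf_fst] at hbc
        rw [hg.2 b hb2 c hc2 hbc]
  have := mem_YY this
  simpa [hl] using this

theorem HH_YY {J : Finset I} {k : ℕ} (l : List I) (hl : ∀ i ∈ l, i ∈ J) {x : Lam I} (hx : x ∈ YY J k) :
    HH l x ∈ YY J (k+1) := by
  induction l with
  | nil => simp [HH]
  | cons i l ih =>
    simp only [HH, AddMonoidHom.sub_apply, AddMonoidHom.add_apply, AddMonoidHom.comp_apply,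
      AddMonoidHom.coe_coe]
    have h := ih fun j hj => hl j (List.mem_cons_of_mem _ hj)
    exact sub_mem (add_mem (Cc_YY i (hl i List.mem_cons_self) hx) h) (rf_YY i h)

def HJ (J : Finset I) : Lam I →+ Lam I := HH J.toList

theorem HJ_YY {J : Finset I} {k : ℕ} {x : Lam I} (hx : x ∈ YY J k) : HJ J x ∈ YY J (k+1) :=
  HH_YY _ (fun _ => Finset.mem_toList.1) hx

theorem bo_HJ {J : Finset I} {k : ℕ} (hk : k < J.card) {x : Lam I} (hx : x ∈ YY J k)
    (h0 : bo x = 0) : bo (HJ J x) = x := by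
  have := bo_HH J.toList x
  rw [h0, PP_YY hk hx] at this
  simpa [HJ] using this

/-! ### Top cycles -/

theorem top_fl {J : Finset I} {i : I} (hi : i ∈ J) {x : Lam I} (hx : x ∈ YY J J.card)
    (h0 : bo x = 0) : mp (fl i) x = - x := by
  have h1 : Cc i x = 0 := YY_top (Nat.lt_succ_self _) (Cc_YY i hi hx)
  have h2 : mp (rf i) x = 0 := by
    have := bo_Cc i x
    rw [h1, h0] at this
    simpa using this.symm
  have h3 : mp (fl i) x + x = mp (rf i) x + mp (fl i) (mp (rf i) x) := by
    refine YY_eq ((mp (fl i) : Lam I →+ Lam I) + AddMonoidHom.id _)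
      ((mp (rf i) : Lam I →+ Lam I) + (mp (fl i) : Lam I →+ Lam I).comp (mp (rf i) : Lam I →+ Lam I))
      (fun l hl hg => ?_) hx
    simp only [AddMonoidHom.add_apply, AddMonoidHom.comp_apply, AddMonoidHom.coe_coe,
      AddMonoidHom.id_apply, mp_mono, List.map_map]
    have main : (∀ a ∈ l, rf i a = a) ∨ (∀ a ∈ l, rf i a = fl i a ∧ fl i (rf i a) = a) := by
      by_cases h : ∃ a ∈ l, a = (i, false)
      · right
        obtain ⟨a, ha, rfl⟩ := h
        intro b hb
        by_cases hbi : b.1 = i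
        · have := hg.2 b hb _ ha hbi
          subst this
          simp [rf, fl]
        · simp [rf, fl, hbi]
      · left
        intro b hb
        by_cases hbi : b.1 = i
        · have : b.2 = true := by
            by_contra hb2
            apply h
            refine ⟨b, hb, ?_⟩
            ext <;> simp_all
          ext <;> simp [rf, hbi, this]
        · simp [rf, hbi]
    rcases main with h | h
    · have e1 : l.map (rf i) = l := by
        conv_rhs => rw [← List.map_id l]
        exact List.map_congr_left h
      have e2 : l.map (fl i ∘ rf i) = l.map (fl i) :=
        List.map_congr_left fun a ha => by simp [h a ha]
      rw [e1, e2, add_comm]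
    · have e1 : l.map (rf i) = l.map (fl i) := List.map_congr_left fun a ha => (h a ha).1
      have e2 : l.map (fl i ∘ rf i) = l := by
        conv_rhs => rw [← List.map_id l]
        exact List.map_congr_left fun a ha => (h a ha).2
      rw [e1, e2]
  rw [h2] at h3
  simp at h3
  exact eq_neg_of_add_eq_zero_left h3

def fls (S : Finset I) (a : I × Bool) : I × Bool := if a.1 ∈ S then (a.1, !a.2) else a

theorem top_fls {J : Finset I} (S : Finset I) (hS : S ⊆ J) {x : Lam I} (hx : x ∈ YY J J.card)
    (h0 : bo x = 0) : mp (fls S) x = (-1 : ℤ)^S.card • x := by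
  induction S using Finset.induction_on with
  | empty =>
    have : fls (∅ : Finset I) = id := by funext a; simp [fls]
    simp [this, mp_id]
  | insert i S hi ih =>
    have e : fls (insert i S) = fl i ∘ fls S := by
      funext ⟨a, b⟩
      by_cases h : a = i
      · subst h; simp [fls, fl, hi]
      · simp only [fls, fl, Finset.mem_insert, h, false_or, Function.comp_apply]
        split_ifs <;> simp_all
    rw [e, ← mp_mp, ih (fun j hj => hS (Finset.mem_insert_of_mem hj)), map_zsmul,
      top_fl (hS (Finset.mem_insert_self _ _)) hx h0, Finset.card_insert_of_notMem hi, pow_succ]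
    simp

end
end TRP


namespace TRP
set_option linter.unusedSimpArgs false
noncomputable section
open D4

inductive Idx
  | a (i : ℕ)
  | b (i : ℕ)
  | g (i : ℕ)

instance : DecidableEq Idx := Classical.decEq _

def f1 : Idx × Bool → Idx × Bool
  | (.a i, x) => (.a i, !x)
  | (.b i, x) => (.b i, x)
  | (.g i, x) => (.g i, !x)
def f2 : Idx × Bool → Idx × Bool
  | (.a i, x) => (.a i, x)
  | (.b i, x) => (.b i, !x)
  | (.g i, x) => (.g i, !x)
def fs : Idx × Bool → Idx × Bool
  | (.a i, x) => (.b i, x)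
  | (.b i, x) => (.a i, x)
  | (.g i, x) => (.g i, x)

theorem mp_comp_id (g h : Idx × Bool → Idx × Bool) (e : ∀ x, g (h x) = x) (x : Lam Idx) :
    mp g (mp h x) = x := by
  rw [mp_mp, show g ∘ h = id from funext e, mp_id]

theorem mp_comp_comm (g h g' h' : Idx × Bool → Idx × Bool) (e : ∀ x, g (h x) = g' (h' x))
    (x : Lam Idx) : mp g (mp h x) = mp g' (mp h' x) := by
  rw [mp_mp, mp_mp, show g ∘ h = g' ∘ h' from funext e]

def oL : D4 (Lam Idx) where
  t1 := (mp f1 : Lam Idx →+ Lam Idx)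
  t2 := (mp f2 : Lam Idx →+ Lam Idx)
  s := (mp fs : Lam Idx →+ Lam Idx)
  t1t1 := mp_comp_id _ _ (by rintro ⟨_ | _ | _, x⟩ <;> simp [f1])
  t2t2 := mp_comp_id _ _ (by rintro ⟨_ | _ | _, x⟩ <;> simp [f2])
  ss := mp_comp_id _ _ (by rintro ⟨_ | _ | _, x⟩ <;> simp [fs])
  t2t1 := mp_comp_comm _ _ _ _ (by rintro ⟨_ | _ | _, x⟩ <;> simp [f1, f2])
  st1 := mp_comp_comm _ _ _ _ (by rintro ⟨_ | _ | _, x⟩ <;> simp [f1, f2, fs])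
  st2 := mp_comp_comm _ _ _ _ (by rintro ⟨_ | _ | _, x⟩ <;> simp [f1, f2, fs])

theorem oL_t1 (x) : oL.t1 x = mp f1 x := rfl
theorem oL_t2 (x) : oL.t2 x = mp f2 x := rfl
theorem oL_s (x) : oL.s x = mp fs x := rfl

/-- boundary as additive hom -/
def boA : Lam Idx →+ Lam Idx := (bo : Lam Idx →ₗ[ℤ] Lam Idx).toAddMonoidHom
theorem boA_apply (x) : boA x = bo x := rfl

theorem bo_t1 (x) : boA (oL.t1 x) = oL.t1 (boA x) := bo_mp _ _
theorem bo_t2 (x) : boA (oL.t2 x) = oL.t2 (boA x) := bo_mp _ _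
theorem bo_s (x) : boA (oL.s x) = oL.s (boA x) := bo_mp _ _

theorem bo_BG (f : Gen → Lam Idx) (x) : boA (BG oL f x) = BG oL (fun y => boA (f y)) x :=
  BG_nat boA bo_t1 bo_t2 bo_s f x

def Jset (p q : ℕ) : Finset Idx :=
  (Finset.range p).image Idx.a ∪ ((Finset.range p).image Idx.b ∪ (Finset.range (2*q+1)).image Idx.g)

theorem Jset_card (p q : ℕ) : (Jset p q).card = 2*(p+q)+1 := by
  unfold Jset
  rw [Finset.card_union_of_disjoint, Finset.card_union_of_disjoint, Finset.card_image_of_injective,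
    Finset.card_image_of_injective, Finset.card_image_of_injective]
  · simp; ring
  · intro x y h; cases h; rfl
  · intro x y h; cases h; rfl
  · intro x y h; cases h; rfl
  · rw [Finset.disjoint_left]; simp
  · rw [Finset.disjoint_left]; simp only [Finset.mem_image, Finset.mem_union]
    rintro _ ⟨i, _, rfl⟩; simp

theorem mem_Ja {p q i} : Idx.a i ∈ Jset p q ↔ i < p := by simp [Jset]
theorem mem_Jb {p q i} : Idx.b i ∈ Jset p q ↔ i < p := by simp [Jset]
theorem mem_Jg {p q i} : Idx.g i ∈ Jset p q ↔ i < 2*q+1 := by simp [Jset]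

theorem f1_fst (a) : (f1 a).1 = a.1 := by rcases a with ⟨_ | _ | _, x⟩ <;> rfl
theorem f2_fst (a) : (f2 a).1 = a.1 := by rcases a with ⟨_ | _ | _, x⟩ <;> rfl

theorem t1_YY {J : Finset Idx} {k} : ∀ x ∈ YY J k, oL.t1 x ∈ YY J k := fun x hx =>
  mp_YY _ (by simp [f1_fst]) (by simp [f1_fst]) hx
theorem t2_YY {J : Finset Idx} {k} : ∀ x ∈ YY J k, oL.t2 x ∈ YY J k := fun x hx =>
  mp_YY _ (by simp [f2_fst]) (by simp [f2_fst]) hx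
theorem s_YY {p q k} : ∀ x ∈ YY (Jset p q) k, oL.s x ∈ YY (Jset p q) k := fun x hx =>
  mp_YY _ (by rintro ⟨_ | _ | _, x⟩ <;> simp [fs, mem_Ja, mem_Jb, mem_Jg])
    (by rintro ⟨_ | _ | _, x⟩ ⟨_ | _ | _, y⟩ <;> simp [fs]) hx

structure Sys (J : Finset Idx) (M : ℕ) (f : Gen → Lam Idx) : Prop where
  e0 : f (.e 0) = vv (Idx.g 0, true)
  es : ∀ i, f (.e (i+1)) = 0
  bd : ∀ x : Gen, x.ok M → 0 < x.dim → bo (f x) = BG oL f x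
  mem : ∀ x : Gen, x.ok M → f x ∈ YY J (x.dim + 1)

theorem Sys.hs {J M f} (h : Sys J M f) (i) : oL.s (f (.e i)) = f (.e i) := by
  rcases i with _ | i
  · rw [h.e0, oL_s, mp_v]; rfl
  · rw [h.es, map_zero]

theorem ok_dim0 {m} {x : Gen} (hx : x.ok m) (h : x.dim = 0) : x = .e 0 := by
  cases x <;> simp only [Gen.ok, Gen.dim] at * <;> first | omega | (subst h; rfl)

theorem cmp {p q N : ℕ} (hN : N = p + q) (hN0 : 0 < N) {φ ψ : Gen → Lam Idx}
    (hφ : Sys (Jset p q) N φ) (hψ : Sys (Jset p q) N ψ) :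
    ∃ w ∈ YY (Jset p q) (Jset p q).card, bo w = 0 ∧ ∃ C : ℕ → ℕ → Lam Idx,
      CC oL φ N N - CC oL ψ N N = (w + (-1 : ℤ)^N • oL.s w) + oL.bc C N N := by
  have hJ := Jset_card p q
  rw [← hN] at hJ
  set J := Jset p q with hJd
  let δ : Gen → Lam Idx := fun x => φ x - ψ x
  have hδe : ∀ i, δ (.e i) = 0 := by
    rintro (_ | i) <;> simp only [δ, hφ.e0, hψ.e0, hφ.es, hψ.es, sub_self]
  obtain ⟨h, hh⟩ := exists_fix (V := Lam Idx) Gen.dim (fun h x => HJ J (δ x - BG oL h x)) (by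
    intro f g x hfg
    rw [BG_congr f g x fun y _ hd => hfg y (by omega)])
  have hh' : ∀ x, h x = HJ J (δ x - BG oL h x) := fun x => congrFun hh x
  have he : ∀ i, h (.e i) = 0 := by
    intro i
    induction i with
    | zero => rw [hh', hδe]; simp [BG, be]
    | succ i ih => rw [hh', hδe]; simp [BG, be, ih]
  have hes : ∀ i, oL.s (h (.e i)) = h (.e i) := by intro i; rw [he, map_zero]
  have hδm : ∀ x : Gen, x.ok N → δ x ∈ YY J (x.dim + 1) := fun x hx =>
    sub_mem (hφ.mem x hx) (hψ.mem x hx)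
  have hδb : ∀ x : Gen, x.ok N → boA (δ x) = BG oL δ x := by
    intro x hx
    rcases Nat.eq_zero_or_pos x.dim with h0 | h0
    · rw [ok_dim0 hx h0, hδe]; simp [BG, be]
    · simp only [δ, BG_sub, map_sub, boA_apply]
      rw [hφ.bd x hx h0, hψ.bd x hx h0]
  have step : ∀ x : Gen, x.ok N → (∀ y : Gen, y.ok N → y.dim < x.dim →
      boA (h y) = δ y - BG oL h y ∧ h y ∈ YY J (y.dim + 2)) →
      boA (δ x - BG oL h x) = 0 ∧ δ x - BG oL h x ∈ YY J (x.dim + 1) := by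
    intro x hx hy
    constructor
    · rw [map_sub, bo_BG, hδb x hx]
      rw [BG_congr (fun y => boA (h y)) (fun y => δ y - BG oL h y) x
        fun y hyo hd => (hy y (Gen.ok_mono (Gen.ok_idx hx) hyo) (by omega)).1]
      rw [BG_sub δ (BG oL h), BG_BG h hes]; simp
    · refine sub_mem (hδm x hx) (BG_mem _ t1_YY t2_YY s_YY h x fun y hyo hd => ?_)
      rw [← hd]
      exact (hy y (Gen.ok_mono (Gen.ok_idx hx) hyo) (by omega)).2
  have main : ∀ n, ∀ x : Gen, x.dim = n → x.ok N → x.dim + 1 < J.card →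
      boA (h x) = δ x - BG oL h x ∧ h x ∈ YY J (x.dim + 2) := by
    intro n
    induction n using Nat.strong_induction_on with
    | _ n ih =>
      intro x hn hx hd
      obtain ⟨s1, s2⟩ := step x hx fun y hy hyd => ih y.dim (by omega) y rfl hy (by omega)
      rw [hh' x]
      refine ⟨?_, HJ_YY s2⟩
      rw [boA_apply, bo_HJ hd s2 s1]
  have hd : (Gen.d N (N-1)).dim = 2*N := by simp only [Gen.dim]; omega
  have hok : (Gen.d N (N-1)).ok N := ⟨by omega, le_refl _⟩
  obtain ⟨s1, s2⟩ := step (.d N (N-1)) hok fun y hy hyd => main _ y rfl hy (by omega)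
  refine ⟨_, by rw [hJ, ← hd]; exact s2, s1, CC oL h, ?_⟩
  rw [← CC_BG h hes, ← CC_sub]
  have : N ≠ 0 := by omega
  simp only [CC, lt_irrefl, if_false, this, δ]
  simp only [map_sub, smul_sub]
  abel

/-! ### Evaluation -/

def ind (a : Idx × Bool) : Idx × Bool → ℤ := fun b => if b = a then 1 else 0

def ev : Lam Idx →+ ℤ := (ExteriorAlgebra.algebraMapInv (R := ℤ) (M := (Idx × Bool) →₀ ℤ)).toLinearMap.toAddMonoidHom

theorem ev_one : ev 1 = 1 := map_one (ExteriorAlgebra.algebraMapInv (R := ℤ) (M := (Idx × Bool) →₀ ℤ))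
theorem ev_v (a) (x : Lam Idx) : ev (vv a * x) = 0 := by
  change ExteriorAlgebra.algebraMapInv (vv a * x) = 0
  rw [map_mul]
  unfold vv ExteriorAlgebra.algebraMapInv
  rw [ExteriorAlgebra.lift_ι_apply]; simp

theorem ev_mp (g) (x : Lam Idx) : ev (mp g x) = ev x := by
  refine hom_ext (ev.comp (mp g : Lam Idx →+ Lam Idx)) ev (fun l => ?_) x
  cases l with
  | nil => simp
  | cons a l => simp [ev_v]

def K0 : ℕ → Lam Idx → ℤ
  | 0, x => ev x
  | n+1, x => K0 n (con (ind (Idx.g n, true)) x)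

/-- evaluate on the top positive monomial -/
def KK (n : ℕ) : ℕ → Lam Idx → ℤ
  | 0, x => K0 n x
  | p+1, x => KK n p (con (ind (Idx.b p, true)) (con (ind (Idx.a p, true)) x))

theorem K0_add (n) (x y) : K0 n (x + y) = K0 n x + K0 n y := by
  induction n generalizing x y with
  | zero => simp [K0]
  | succ n ih => simp [K0, ih]
theorem KK_add (n p) (x y) : KK n p (x + y) = KK n p x + KK n p y := by
  induction p generalizing x y with
  | zero => simp [KK, K0_add]
  | succ n ih => simp [KK, ih]

def KA (n p : ℕ) : Lam Idx →+ ℤ := AddMonoidHom.mk' (KK n p) (KK_add n p)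

theorem KA_zero (n x) : KA n 0 x = K0 n x := rfl
theorem KA_succ (n p x) : KA n (p+1) x =
    KA n p (con (ind (Idx.b p, true)) (con (ind (Idx.a p, true)) x)) := rfl

theorem ind_a_s (i) : ind (Idx.a i, true) ∘ fs = ind (Idx.b i, true) := by
  funext ⟨j, x⟩; rcases j <;> simp [ind, fs]
theorem ind_b_s (i) : ind (Idx.b i, true) ∘ fs = ind (Idx.a i, true) := by
  funext ⟨j, x⟩; rcases j <;> simp [ind, fs]
theorem ind_g_s (i) : ind (Idx.g i, true) ∘ fs = ind (Idx.g i, true) := by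
  funext ⟨j, x⟩; rcases j <;> simp [ind, fs]

theorem K0_s (n x) : K0 n (mp fs x) = K0 n x := by
  induction n generalizing x with
  | zero => exact ev_mp _ _
  | succ n ih => rw [K0, con_mp, ind_g_s, ih]; rfl

theorem KA_s (n p x) : KA n p (oL.s x) = (-1)^p * KA n p x := by
  rw [oL_s]
  induction p generalizing x with
  | zero => simp [KA_zero, K0_s]
  | succ p ih =>
    rw [KA_succ, KA_succ, con_mp, ind_a_s, con_mp, ind_b_s, ih, con_comm, map_neg, pow_succ]
    ring

def zz (N : ℕ) (x : Lam Idx) : Lam Idx :=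
  x - (-1 : ℤ)^N • oL.t1 x - (-1 : ℤ)^N • oL.t2 x + oL.t1 (oL.t2 x)

theorem zz_add (N x y) : zz N (x + y) = zz N x + zz N y := by
  simp only [zz, map_add, smul_add]; abel
theorem zz_sub (N x y) : zz N (x - y) = zz N x - zz N y := by
  simp only [zz, map_sub, smul_sub]; abel

theorem zz_bc (N C) : zz N (oL.bc C N N) = 0 := by
  unfold zz bc
  split_ifs with h
  · simp
  · rcases neg_one_pow_eq_or ℤ N with h | h <;> simp [h, oL.t1t1, oL.t2t2, oL.t2t1] <;> abel

theorem top_t1 {p q w} (hw : w ∈ YY (Jset p q) (Jset p q).card) (h0 : bo w = 0) :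
    oL.t1 w = (-1 : ℤ)^(p+1) • w := by
  let S := (Finset.range p).image Idx.a ∪ (Finset.range (2*q+1)).image Idx.g
  have hS : S ⊆ Jset p q := by
    intro x hx
    simp only [S, Jset, Finset.mem_union] at *
    tauto
  have hc : S.card = p + (2*q+1) := by
    simp only [S]
    rw [Finset.card_union_of_disjoint, Finset.card_image_of_injective, Finset.card_image_of_injective]
    · simp
    · intro x y h; cases h; rfl
    · intro x y h; cases h; rfl
    · rw [Finset.disjoint_left]; simp
  have := top_fls S hS hw h0
  rw [hc] at this
  have e : (-1 : ℤ)^(p+(2*q+1)) = (-1)^(p+1) := by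
    rw [show p + (2*q+1) = p + 1 + 2*q by ring, pow_add _ (p+1), pow_mul]; simp
  rw [← e, ← this]
  refine YY_eq oL.t1 (mp (fls S) : Lam Idx →+ Lam Idx) (fun l hl hg => ?_) hw
  simp only [oL_t1, AddMonoidHom.coe_coe, mp_mono]
  congr 1
  apply List.map_congr_left
  intro x hx
  have := hg.1 x hx
  rcases x with ⟨i | i | i, x⟩
  · simp only [mem_Ja] at this; simp [f1, fls, S, this]
  · simp [f1, fls, S]
  · simp only [mem_Jg] at this; simp [f1, fls, S]; omega

theorem top_t2 {p q w} (hw : w ∈ YY (Jset p q) (Jset p q).card) (h0 : bo w = 0) :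
    oL.t2 w = (-1 : ℤ)^(p+1) • w := by
  have h := top_t1 (s_YY w hw) (by rw [oL_s, bo_mp, h0, map_zero])
  have := congrArg oL.s h
  rwa [oL.st1, oL.ss, map_zsmul, oL.ss] at this

theorem zero_of_sys {p q N : ℕ} (hN : N = p + q) {φ} (hφ : Sys (Jset p q) (N+1) φ) :
    zz N (CC oL φ N N) = 0 := by
  have hok : (Gen.c (N+1) N).ok (N+1) := ⟨by omega, le_refl _⟩
  have hb := hφ.bd (.c (N+1) N) hok (by simp only [Gen.dim]; omega)
  have hm := hφ.mem (.c (N+1) N) hok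
  rw [YY_top (by rw [Jset_card]; simp only [Gen.dim]; omega) hm, map_zero] at hb
  simp only [BG, Nat.lt_succ_self, if_true] at hb
  have hb2 := congrArg (fun x => x - (-1:ℤ)^N • oL.t2 x) hb.symm
  simp only [bc, map_zero, smul_zero, sub_zero] at hb2
  rw [← hb2]
  unfold zz
  rcases N with _ | N
  · simp [oL.t2t1]; abel
  · simp only [Nat.add_sub_cancel, Nat.succ_ne_zero, if_false, pow_succ]
    rcases neg_one_pow_eq_or ℤ N with h | h <;> simp [h, oL.t2t2, oL.t2t1] <;> abel

theorem even_dvd {p q N : ℕ} (hN : N = p + q) (hN0 : 0 < N) (hq : Even q) {φ ψ : Gen → Lam Idx}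
    (hφ : Sys (Jset p q) (N+1) φ) (hψ : Sys (Jset p q) N ψ) (n m : ℕ) (hm : m = p):
    (8 : ℤ) ∣ KA n m (zz N (CC oL ψ N N)) := by
  subst hm
  have hφ' : Sys (Jset m q) N φ := ⟨hφ.e0, hφ.es,
    fun x hx => hφ.bd x (Gen.ok_mono (by omega) hx), fun x hx => hφ.mem x (Gen.ok_mono (by omega) hx)⟩
  obtain ⟨w, hw, h0, C, hC⟩ := cmp hN hN0 hφ' hψ
  have e1 := congrArg (zz N) hC
  rw [zz_sub, zero_of_sys hN hφ, zz_add, zz_bc] at e1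
  have t1 := top_t1 hw h0
  have t2 := top_t2 hw h0
  have eN : (-1 : ℤ)^N = (-1)^m := by rw [hN, pow_add, hq.neg_one_pow, mul_one]
  have e2 : zz N (w + (-1 : ℤ)^N • oL.s w) = (w + (-1 : ℤ)^N • oL.s w) + (w + (-1 : ℤ)^N • oL.s w) +
      ((w + (-1 : ℤ)^N • oL.s w) + (w + (-1 : ℤ)^N • oL.s w)) := by
    unfold zz
    rw [eN]
    simp only [map_add, map_zsmul, ← oL.st1, ← oL.st2, t1, t2]
    rcases neg_one_pow_eq_or ℤ m with h | h <;> simp [h, pow_succ, ← oL.st1, ← oL.st2, t1, t2] <;> abel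
  rw [e2] at e1
  have e3 := congrArg (KA n m) e1
  simp only [map_sub, map_add, map_zsmul, map_zero, KA_s, eN, smul_eq_mul] at e3
  refine ⟨- KA n m w, ?_⟩
  have : (-1 : ℤ)^m * ((-1)^m * KA n m w) = KA n m w := by
    rcases neg_one_pow_eq_or ℤ m with h | h <;> simp [h]
  rw [this] at e3
  linarith

end
end TRP


namespace TRP
noncomputable section
open D4
set_option linter.unusedSimpArgs false

/-! ### The base reference family -/

def eps : ℕ → Lam Idx
  | 0 => vv (Idx.g 0, true)
  | k+1 => vv (Idx.g (k+1), true) * (eps k + (-1 : ℤ)^(k+1) • oL.t1 (eps k))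

theorem t1_vmul (a) (x : Lam Idx) : oL.t1 (vv a * x) = vv (f1 a) * oL.t1 x := by simp [oL_t1]
theorem t2_vmul (a) (x : Lam Idx) : oL.t2 (vv a * x) = vv (f2 a) * oL.t2 x := by simp [oL_t2]
theorem s_vmul (a) (x : Lam Idx) : oL.s (vv a * x) = vv (fs a) * oL.s x := by simp [oL_s]

theorem eps_t2 (k) : oL.t2 (eps k) = oL.t1 (eps k) := by
  induction k with
  | zero => simp [eps, oL_t1, oL_t2, f1, f2]
  | succ k ih =>
    simp only [eps, t1_vmul, t2_vmul, f1, f2, map_add, map_zsmul, oL.t2t1, ih]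

theorem eps_s (k) : oL.s (eps k) = eps k := by
  induction k with
  | zero => simp [eps, oL_s, fs]
  | succ k ih =>
    simp only [eps, s_vmul, fs, map_add, map_zsmul, oL.st1, ih, eps_t2]

theorem eps_bo (k) : boA (eps (k+1)) = eps k + (-1 : ℤ)^(k+1) • oL.t1 (eps k) := by
  have aux : ∀ k, boA (eps k + (-1 : ℤ)^(k+1) • oL.t1 (eps k)) = 0 →
     boA (eps (k+1)) = eps k + (-1 : ℤ)^(k+1) • oL.t1 (eps k) := by
    intro k hk
    rw [eps, boA_apply, bo_v, ← boA_apply, hk]; simp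
  induction k with
  | zero =>
    apply aux
    have := bo_v (I := Idx) (Idx.g 0, true) 1
    have h := bo_v (I := Idx) (Idx.g 0, false) 1
    simp only [mul_one, bo_one, mul_zero, sub_zero] at this h
    simp [eps, boA_apply, this, oL_t1, f1, h]
  | succ k ih =>
    apply aux
    rw [map_add, map_zsmul, bo_t1, ih]
    rcases neg_one_pow_eq_or ℤ k with h | h <;> simp [h, pow_succ, oL.t1t1]

def gset (k : ℕ) : Finset Idx := (Finset.range (k+1)).image Idx.g
theorem mem_gset {k i} : Idx.g i ∈ gset k ↔ i < k+1 := by simp [gset]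

theorem eps_YY (k) : eps k ∈ YY (gset k) (k+1) := by
  induction k with
  | zero =>
    have : Good (gset 0) [(Idx.g 0, true)] := ⟨by simp [gset], by simp⟩
    simpa [eps] using mem_YY this
  | succ k ih =>
    refine cone_YY (J := gset k) _ ?_ ?_ ?_ ?_
    · intro x; simp [gset]; intro i hi h; exact ⟨i, by omega, h⟩
    · simp [gset]
    · simp [gset]
    · exact add_mem ih (AddSubgroup.zsmul_mem _ (t1_YY _ ih) _)

theorem con_YY {J : Finset Idx} {k} {a : Idx × Bool} (ha : a.1 ∉ J) {x} (hx : x ∈ YY J k) :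
    con (ind a) x = 0 := by
  refine YY_eq (con (ind a)).toAddMonoidHom 0 (fun l hl hg => ?_) hx
  clear hl
  simp only [LinearMap.toAddMonoidHom_coe, AddMonoidHom.zero_apply]
  induction l with
  | nil => simp
  | cons b l ih =>
    have h1 : ind a b = 0 := by
      unfold ind; rw [if_neg]; rintro rfl; exact ha (hg.1 b (by simp))
    rw [mono_cons, con_v_mul, h1, ih ⟨fun c hc => hg.1 c (by simp [hc]),
      fun c hc d hd => hg.2 c (by simp [hc]) d (by simp [hd])⟩]
    simp

def BB (i j : ℕ) : ℤ := if i % 2 = 1 ∧ j % 2 = 1 then 0 else ((i/2 + j/2).choose (i/2) : ℕ)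

def ch (a b : ℕ) : ℤ := ((a+b).choose a : ℕ)
theorem ch_0 (b) : ch 0 b = 1 := by simp [ch]
theorem ch_0' (b) : ch b 0 = 1 := by simp [ch]
theorem ch_symm (a b) : ch a b = ch b a := by
  unfold ch; rw [Nat.choose_symm_add (a := a), add_comm]

theorem BB_ee (a b) : BB (2*a) (2*b) = ch a b := by
  unfold BB ch; rw [if_neg (by omega)]; congr 2 <;> omega
theorem BB_eo (a b) : BB (2*a) (2*b+1) = ch a b := by
  unfold BB ch; rw [if_neg (by omega)]; congr 2 <;> omega
theorem BB_oe (a b) : BB (2*a+1) (2*b) = ch a b := by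
  unfold BB ch; rw [if_neg (by omega)]; congr 2 <;> omega
theorem BB_oo (a b) : BB (2*a+1) (2*b+1) = 0 := by
  unfold BB; rw [if_pos (by omega)]

def Cref (i j : ℕ) : Lam Idx := BB i j • eps (i+j)

theorem par (i : ℕ) : (∃ a, i = 2*a) ∨ ∃ a, i = 2*a+1 := by
  rcases Nat.even_or_odd' i with ⟨a, h | h⟩
  · exact Or.inl ⟨a, h⟩
  · exact Or.inr ⟨a, h⟩

theorem Pas (a b : ℕ) : ch (a+1) (b+1) = ch a (b+1) + ch (a+1) b := by
  unfold ch
  rw [show a+1+(b+1) = (a+(b+1))+1 by ring, Nat.choose_succ_succ, show a+(b+1) = a+1+b by ring]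
  push_cast; rfl

theorem bc_ref (i j : ℕ) (h : 0 < i + j) : boA (Cref i j) = oL.bc Cref i j := by
  obtain ⟨k, hk⟩ : ∃ k, i + j = k + 1 := ⟨i+j-1, by omega⟩
  have e1 : i ≠ 0 → Cref (i-1) j = BB (i-1) j • eps k := by
    intro h; unfold Cref; rw [show i-1+j = k by omega]
  have e2 : j ≠ 0 → Cref i (j-1) = BB i (j-1) • eps k := by
    intro h; unfold Cref; rw [show i+(j-1) = k by omega]
  rw [bc_congr Cref (fun i j => BB i j • eps k) i j e1 e2]
  unfold Cref bc
  beta_reduce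
  rw [hk, map_zsmul, eps_bo, ← hk]
  rcases par i with ⟨a, rfl⟩ | ⟨a, rfl⟩ <;> rcases par j with ⟨b, rfl⟩ | ⟨b, rfl⟩
  · rcases a with _ | a <;> rcases b with _ | b
    · omega
    · rw [show 2*(b+1)-1 = 2*b+1 by omega]
      have := BB_ee 0 (b+1); have := BB_eo 0 b
      simp_all [-zsmul_eq_mul, ch_0, ch_0', eps_t2, pow_mul]
    · rw [show 2*(a+1)-1 = 2*a+1 by omega]
      have := BB_ee (a+1) 0; have := BB_oe a 0
      simp_all [-zsmul_eq_mul, ch_0, ch_0', eps_t2, pow_mul]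
    · rw [show 2*(a+1)-1 = 2*a+1 by omega, show 2*(b+1)-1 = 2*b+1 by omega, BB_ee, BB_eo, BB_oe, Pas]
      simp [-zsmul_eq_mul, ch_0, ch_0', eps_t2, pow_mul, pow_add, add_smul, smul_add]
      abel
  · rw [show 2*b+1-1 = 2*b by omega, BB_eo, BB_ee]
    rcases a with _ | a
    · simp [-zsmul_eq_mul, ch_0, ch_0', eps_t2, pow_add, pow_mul]
    · rw [show 2*(a+1)-1 = 2*a+1 by omega, BB_oo]
      simp [-zsmul_eq_mul, ch_0, ch_0', eps_t2, pow_add, pow_mul]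
  · rw [show 2*a+1-1 = 2*a by omega, BB_oe, BB_ee]
    rcases b with _ | b
    · simp [-zsmul_eq_mul, ch_0, ch_0', eps_t2, pow_add, pow_mul]
    · rw [show 2*(b+1)-1 = 2*b+1 by omega, BB_oo]
      simp [-zsmul_eq_mul, ch_0, ch_0', eps_t2, pow_add, pow_mul]
  · rw [show 2*b+1-1 = 2*b by omega, show 2*a+1-1 = 2*a by omega, BB_oo, BB_oe, BB_eo]
    simp [-zsmul_eq_mul, ch_0, ch_0', eps_t2, pow_add, pow_mul]
    abel

def cs (i k : ℕ) : ℤ := if i % 2 = 0 ∧ k % 2 = 0 then -1 else 1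

def base : Gen → Lam Idx
  | .c i j => BB i j • eps (i+j)
  | .d i k => (cs i k * BB i k) • eps (i+k+1)
  | .e 0 => eps 0
  | .e (_+1) => 0

theorem BB_symm (i j) : BB i j = BB j i := by
  unfold BB
  simp only [and_comm (a := i % 2 = 1)]
  split_ifs
  · rfl
  · rw [add_comm, Nat.choose_symm_add]

theorem BB_sign (i j) : (-1 : ℤ)^(i*j) * BB i j = BB i j := by
  unfold BB
  split_ifs with h
  · simp
  · have : Even (i * j) := by
      rw [Nat.even_mul, Nat.even_iff, Nat.even_iff]; omega
    rw [this.neg_one_pow, one_mul]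

theorem base_CC (i j) : CC oL base i j = Cref i j := by
  unfold CC Cref
  split_ifs with h1 h2 h3
  · rfl
  · simp only [base, map_zsmul, eps_s, smul_smul]
    rw [mul_comm i j, BB_sign, BB_symm, add_comm]
  · have : j = 0 := by omega
    subst h3 this
    have := BB_ee 0 0
    simp_all [ch_0, -zsmul_eq_mul, ch_0, ch_0', base]
  · have : j = i := by omega
    subst this
    simp only [base, map_zsmul, eps_s]
    rw [show j + (j-1) + 1 = j + j by omega]
    rcases par j with ⟨a, rfl⟩ | ⟨a, rfl⟩
    · obtain ⟨b, rfl⟩ : ∃ b, a = b+1 := ⟨a-1, by omega⟩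
      rw [show 2*(b+1)-1 = 2*b+1 by omega, BB_eo, BB_ee, Pas, cs, if_neg (by omega)]
      rw [ch_symm b (b+1)]
      simp [-zsmul_eq_mul, pow_mul, add_smul]
    · simp [-zsmul_eq_mul, ch_0, ch_0', BB_oo, pow_add, pow_mul]

theorem base_bd (i k) (hk : k < i) : boA (base (.d i k)) = BG oL base (.d i k) := by
  have hCC : CC oL base = Cref := by funext i j; exact base_CC i j
  have hi0 : i ≠ 0 := by omega
  simp only [BG, hk, if_true, bd, hCC]
  have hD1 : k ≠ 0 → DD base i (k-1) = (cs i (k-1) * BB i (k-1)) • eps (i+k) := by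
    intro h; rw [DD, if_pos (by omega)]; simp only [base]; rw [show i + (k-1) + 1 = i + k by omega]
  have hE : base (.e i) = 0 := by
    obtain ⟨b, rfl⟩ : ∃ b, i = b+1 := ⟨i-1, by omega⟩
    rfl
  have hC : Cref k i = BB i k • eps (i+k) := by rw [Cref, BB_symm, add_comm]
  have hD2 : k < i - 1 → DD base (i-1) k = (cs (i-1) k * BB (i-1) k) • eps (i+k) := by
    intro h; rw [DD, if_pos h]; simp only [base]; rw [show i -1 + k + 1 = i + k by omega]
  have hD3 : ¬ k < i - 1 → DD base (i-1) k = 0 := by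
    intro h; rw [DD, if_neg h]
  rw [hE, hC, Cref]
  have hL : boA (base (.d i k)) = (cs i k * BB i k) • (eps (i+k) + (-1 : ℤ)^(i+k+1) • oL.t1 (eps (i+k))) := by
    simp only [base, map_zsmul, eps_bo]
  rw [hL]
  rcases par i with ⟨a, rfl⟩ | ⟨a, rfl⟩ <;> rcases par k with ⟨b, rfl⟩ | ⟨b, rfl⟩
  · obtain ⟨a, rfl⟩ : ∃ a', a = a'+1 := ⟨a-1, by omega⟩
    rw [hD2 (by omega)]
    rcases b with _ | b
    · have := BB_oe a 0; have := BB_ee (a+1) 0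
      rw [show 2*(a+1)-1 = 2*a+1 by omega]
      simp_all [-zsmul_eq_mul, ch_0, ch_0', pow_add, pow_mul, cs, eps_s, eps_t2, oL.t1t1]
      abel
    · rw [hD1 (by omega)]
      rw [show 2*(a+1)-1 = 2*a+1 by omega, show 2*(b+1)-1 = 2*b+1 by omega, BB_ee, BB_oe, BB_eo, Pas]
      simp [-zsmul_eq_mul, ch_0, ch_0', pow_add, pow_mul, cs, eps_s, eps_t2, oL.t1t1, mul_add, Nat.add_mod]
      simp only [add_smul, neg_smul, neg_add_rev, smul_neg]
      abel
  · simp only [BB_eo]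
    have : DD base (2*a-1) (2*b+1) = 0 := by
      by_cases h : 2*b+1 < 2*a - 1
      · rw [hD2 h]
        obtain ⟨a, rfl⟩ : ∃ a', a = a'+1 := ⟨a-1, by omega⟩
        rw [show 2*(a+1)-1 = 2*a+1 by omega, BB_oo]; simp
      · exact hD3 h
    rw [this, hD1 (by omega)]
    simp [-zsmul_eq_mul, ch_0, ch_0', pow_add, pow_mul, cs, eps_s, eps_t2, oL.t1t1, Nat.add_mod, mul_add]
  · simp only [BB_oe]
    have : (if 2 * b = 0 then 0
      else DD base (2 * a + 1) (2 * b - 1) + (-1 : ℤ) ^ (2 * b) • oL.s (DD base (2 * a + 1) (2 * b - 1))) = 0 := by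
      split_ifs with h
      · rfl
      · rw [hD1 h]
        obtain ⟨b, rfl⟩ : ∃ a', b = a'+1 := ⟨b-1, by omega⟩
        rw [show 2*(b+1)-1 = 2*b+1 by omega, BB_oo]; simp
    rw [this]
    by_cases h : 2*b < 2*a + 1 - 1
    · rw [hD2 h]
      simp [-zsmul_eq_mul, ch_0, ch_0', pow_add, pow_mul, cs, eps_s, eps_t2, oL.t1t1, Nat.add_mod, mul_add]
    · rw [hD3 h]
      simp [-zsmul_eq_mul, ch_0, ch_0', pow_add, pow_mul, cs, eps_s, eps_t2, oL.t1t1, Nat.add_mod, mul_add]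
  · rw [BB_oo, hD1 (by omega)]
    have : 2*b+1 < 2*a+1-1 := by omega
    rw [hD2 this]
    simp [-zsmul_eq_mul, ch_0, ch_0', pow_add, pow_mul, cs, eps_s, eps_t2, oL.t1t1, Nat.add_mod, mul_add]

theorem base_sys (q : ℕ) : Sys (Jset 0 q) q base where
  e0 := rfl
  es i := rfl
  bd x hx hd := by
    cases x with
    | c i j =>
      have : j < i := hx.1
      have hCC : CC oL base = Cref := by funext i j; exact base_CC i j
      simp only [BG, this, if_true, hCC]
      exact bc_ref i j hd
    | d i k => exact base_bd i k hx.1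
    | e i =>
      rcases i with _ | _ | i
      · simp [Gen.dim] at hd
      · simp [base, BG, be, eps_t2, oL.t1t1]
      · simp [base, BG, be]
  mem x hx := by
    have key : ∀ k, k ≤ 2*q → eps k ∈ YY (Jset 0 q) (k+1) := by
      intro k hk
      refine YY_mono ?_ (eps_YY k)
      intro x hx
      simp only [gset, Finset.mem_image, Finset.mem_range] at hx
      obtain ⟨i, hi, rfl⟩ := hx
      rw [mem_Jg]; omega
    cases x with
    | c i j =>
      have : j < i ∧ i ≤ q := hx
      exact AddSubgroup.zsmul_mem _ (key _ (by simp only [Gen.dim]; omega)) _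
    | d i k =>
      have : k < i ∧ i ≤ q := hx
      exact AddSubgroup.zsmul_mem _ (key _ (by simp only [Gen.dim]; omega)) _
    | e i =>
      rcases i with _ | i
      · exact key 0 (by omega)
      · exact zero_mem _

def wps (k : ℕ) : Lam Idx := eps k - (-1 : ℤ)^k • oL.t1 (eps k)

theorem K0_wps (k) : K0 (k+1) (wps k) = 1 := by
  induction k with
  | zero =>
    simp only [K0, wps, eps, oL_t1, mp_v, f1]
    have h1 := con_v_mul (ind (Idx.g 0, true)) (Idx.g 0, true) 1
    have h2 := con_v_mul (ind (Idx.g 0, true)) (Idx.g 0, false) 1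
    simp only [mul_one, con_one, mul_zero] at h1 h2
    simp [h1, h2, ind, ev_one]
  | succ k ih =>
    have : con (ind (Idx.g (k+1), true)) (wps (k+1)) = wps k := by
      have hw : con (ind (Idx.g (k+1), true)) (eps k) = 0 := con_YY (by simp [gset]) (eps_YY k)
      have hw' : con (ind (Idx.g (k+1), true)) (oL.t1 (eps k)) = 0 :=
        con_YY (by simp [gset]) (t1_YY _ (eps_YY k))
      simp only [wps, eps, t1_vmul, f1, map_sub, map_zsmul, map_add, con_v_mul, hw, hw', oL.t1t1]
      simp [ind, pow_succ, sub_eq_add_neg]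
    rw [K0, this, ih]

theorem base_K (q : ℕ) (hq : Even q) : KA (2*q+1) 0 (zz q (CC oL base q q)) = 2 * BB q q := by
  have : zz q (CC oL base q q) = (2 * BB q q) • wps (2*q) := by
    rw [base_CC, Cref, ← two_mul, zz, wps, hq.neg_one_pow, pow_mul]
    simp only [map_zsmul, eps_t2, oL.t1t1]
    simp only [neg_one_sq, one_pow, one_smul, mul_smul, smul_sub]
    rw [two_smul, two_smul]
    abel
  rw [this, map_zsmul, KA_zero, K0_wps]; simp

end
end TRP


namespace TRP
noncomputable section
open D4
set_option linter.unusedSimpArgs false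

/-! ### Chains avoiding labels -/

def YA (J : Finset Idx) (A : Set (Idx × Bool)) (k : ℕ) : AddSubgroup (Lam Idx) :=
  AddSubgroup.closure {x | ∃ l, l.length = k ∧ Good J l ∧ (∀ a ∈ l, a ∉ A) ∧ x = mono l}

theorem YA_le {J A k} : YA J A k ≤ YY J k := by
  apply AddSubgroup.closure_mono
  rintro x ⟨l, h1, h2, _, rfl⟩
  exact ⟨l, h1, h2, rfl⟩

theorem YA_anti {J A A' k} (h : A' ⊆ A) : YA J A k ≤ YA J A' k := by
  apply AddSubgroup.closure_mono
  rintro x ⟨l, h1, h2, h3, rfl⟩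
  exact ⟨l, h1, h2, fun a ha h' => h3 a ha (h h'), rfl⟩

theorem YY_le_YA {J J' : Finset Idx} {A k} (h : J ⊆ J') (hA : ∀ a ∈ A, a.1 ∉ J) : YY J k ≤ YA J' A k := by
  apply AddSubgroup.closure_mono
  rintro x ⟨l, h1, h2, rfl⟩
  exact ⟨l, h1, ⟨fun a ha => h (h2.1 a ha), h2.2⟩, fun a ha h' => hA a h' (h2.1 a ha), rfl⟩

theorem YA_map {J A k J' A' k'} (f : Lam Idx →+ Lam Idx)
    (h : ∀ l, l.length = k → Good J l → (∀ a ∈ l, a ∉ A) → f (mono l) ∈ YA J' A' k') {x : Lam Idx}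
    (hx : x ∈ YA J A k) : f x ∈ YA J' A' k' := by
  induction hx using AddSubgroup.closure_induction with
  | mem y hy => obtain ⟨l, h1, h2, h3, rfl⟩ := hy; exact h l h1 h2 h3
  | zero => simp
  | add y z _ _ hy hz => rw [map_add]; exact add_mem hy hz
  | neg y _ hy => rw [map_neg]; exact neg_mem hy

theorem YA_cone {J A k} (i : Idx) (hi : i ∈ J) (hA : (i, false) ∈ A) (hA' : (i, true) ∉ A) {x}
    (hx : x ∈ YA J A k) : vv (i, true) * x ∈ YA J A (k+1) := by
  refine YA_map (AddMonoidHom.mulLeft (vv (i, true))) (fun l hl hg hl' => ?_) hx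
  refine AddSubgroup.subset_closure ⟨(i, true) :: l, by simp [hl], ⟨?_, ?_⟩, ?_, by simp⟩
  · intro a ha
    rcases List.mem_cons.1 ha with rfl | ha
    · exact hi
    · exact hg.1 a ha
  · have key : ∀ a ∈ l, a.1 = i → a = (i, true) := by
      rintro ⟨j, x⟩ ha h
      simp only at h; subst h
      cases x
      · exact absurd hA (hl' _ ha)
      · rfl
    intro a ha b hb h
    rcases List.mem_cons.1 ha with rfl | ha <;> rcases List.mem_cons.1 hb with rfl | hb
    · rfl
    · exact (key b hb h.symm).symm
    · exact key a ha h
    · exact hg.2 a ha b hb h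
  · intro a ha
    rcases List.mem_cons.1 ha with rfl | ha
    · exact hA'
    · exact hl' a ha

theorem YA_mp {J A k} (g : Idx × Bool → Idx × Bool) (A')
    (h1 : ∀ a, a.1 ∈ J → (g a).1 ∈ J)
    (h2 : ∀ a b, a.1 ∈ J → b.1 ∈ J → (g a).1 = (g b).1 → a.1 = b.1) (h3 : ∀ a, g a ∈ A' → a ∈ A)
    {x} (hx : x ∈ YA J A k) : mp g x ∈ YA J A' k := by
  refine YA_map (mp g : Lam Idx →+ Lam Idx) (fun l hl hg hl' => ?_) hx
  refine AddSubgroup.subset_closure ⟨l.map g, by simp [hl], ⟨?_, ?_⟩, ?_, by simp [mp_mono]⟩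
  · intro a ha
    obtain ⟨b, hb, rfl⟩ := List.mem_map.1 ha
    exact h1 b (hg.1 b hb)
  · intro a ha b hb h
    obtain ⟨a', ha', rfl⟩ := List.mem_map.1 ha
    obtain ⟨b', hb', rfl⟩ := List.mem_map.1 hb
    rw [hg.2 a' ha' b' hb' (h2 _ _ (hg.1 _ ha') (hg.1 _ hb') h)]
  · intro a ha h
    obtain ⟨b, hb, rfl⟩ := List.mem_map.1 ha
    exact hl' b hb (h3 b h)

/-! ### Suspension -/

def Ac (p : ℕ) : Set (Idx × Bool) := {(Idx.a p, false), (Idx.b p, false), (Idx.b p, true)}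
def Ad (p : ℕ) : Set (Idx × Bool) := {(Idx.a p, false), (Idx.b p, false)}

theorem Jset_succ (p q) : Jset p q ⊆ Jset (p+1) q := by
  rintro (i | i | i) <;> simp only [mem_Ja, mem_Jb, mem_Jg] <;> omega

theorem susp {p q N : ℕ} (hN : 2 ≤ N) {f : Gen → Lam Idx} (hf : Sys (Jset p q) (N-1) f) :
    ∃ f', Sys (Jset (p+1) q) N f' ∧ ∀ n,
      KA n (p+1) (zz N (CC oL f' N N)) = - (-1)^N * KA n p (zz (N-1) (CC oL f (N-1) (N-1))) := by
  classical
  set α : Idx × Bool := (Idx.a p, true) with hα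
  set β : Idx × Bool := (Idx.b p, true) with hβ
  obtain ⟨f', hf'⟩ := exists_fix (V := Lam Idx) Gen.dim
    (fun f' x => if x.idx ≤ N-1 then f x else vv α * BG oL f' x) (by
    intro f g x hfg
    rw [BG_congr f g x fun y _ hd => hfg y (by omega)])
  have hlow : ∀ x : Gen, x.idx ≤ N-1 → f' x = f x := by
    intro x hx; rw [hf']; simp only [hx, if_true]
  have hhigh : ∀ x : Gen, ¬ x.idx ≤ N-1 → f' x = vv α * BG oL f' x := by
    intro x hx; conv_lhs => rw [hf']
    simp only [hx, if_false]
  have hN' : ∀ x : Gen, x.ok N → ¬ x.ok (N-1) → ¬ x.idx ≤ N-1 ∧ N ≤ x.dim := by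
    intro x; cases x <;> simp only [Gen.ok, Gen.idx, Gen.dim] <;> omega
  have hes : ∀ i, f' (.e (i+1)) = 0 := by
    intro i
    induction i with
    | zero => rw [hlow _ (by simp only [Gen.idx]; omega), hf.es]
    | succ i ih =>
      by_cases h : i + 2 ≤ N-1
      · rw [hlow _ (by simp only [Gen.idx]; omega), hf.es]
      · rw [hhigh _ (by simp only [Gen.idx]; omega)]
        simp [BG, be, ih]
  have he0 : f' (.e 0) = vv (Idx.g 0, true) := by
    rw [hlow _ (by simp only [Gen.idx]; omega), hf.e0]
  have hs : ∀ i, oL.s (f' (.e i)) = f' (.e i) := by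
    rintro (_ | i)
    · rw [he0, oL_s, mp_v]; rfl
    · rw [hes, map_zero]
  have hbd : ∀ n, ∀ x : Gen, x.dim = n → x.ok N → 0 < x.dim → boA (f' x) = BG oL f' x := by
    intro n
    induction n using Nat.strong_induction_on with
    | _ n ih =>
      intro x hn hx hd
      by_cases hx' : x.ok (N-1)
      · rw [hlow x (Gen.ok_idx hx'), boA_apply, hf.bd x hx' hd]
        apply BG_congr
        intro y hy _
        rw [hlow y ((Gen.ok_idx hy).trans (Gen.ok_idx hx'))]
      · obtain ⟨h1, h2⟩ := hN' x hx hx'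
        rw [hhigh x h1, boA_apply, bo_v, ← boA_apply, bo_BG]
        rw [BG_congr (fun y => boA (f' y)) (BG oL f') x
          fun y hyo hd => ih y.dim (by omega) y rfl (Gen.ok_mono (Gen.ok_idx hx) hyo) (by omega)]
        rw [BG_BG f' hs]; simp
  have hlowm : ∀ x : Gen, x.ok (N-1) → f' x ∈ YY (Jset p q) (x.dim+1) := by
    intro x hx
    rw [hlow x (Gen.ok_idx hx)]
    exact hf.mem x hx
  have hCC : ∀ i j, i ≤ N-1 → j ≤ N-1 → CC oL f' i j ∈ YY (Jset p q) (i+j+1) := by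
    intro i j hi hj
    apply CC_mem _ s_YY f' i j (N-1) hi hj
    intro y hy hd
    rw [← hd]; exact hlowm y hy
  have hDD : ∀ i j, i ≤ N-1 → DD f' i j ∈ YY (Jset p q) (i+j+2) := by
    intro i j hi
    apply DD_mem _ f' i j (N-1) hi
    intro y hy hd
    have := hlowm y hy
    rw [hd] at this; exact this
  have hAc : ∀ k, YY (Jset p q) k ≤ YA (Jset (p+1) q) (Ac p) k := fun k =>
    YY_le_YA (Jset_succ p q) (by
      rintro a (rfl | rfl | rfl) <;> simp [mem_Ja, mem_Jb])
  have hAcd : ∀ k, YA (Jset (p+1) q) (Ac p) k ≤ YA (Jset (p+1) q) (Ad p) k := fun k =>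
    YA_anti (by rintro a (rfl | rfl) <;> simp [Ac])
  have hcA : ∀ k x, x ∈ YA (Jset (p+1) q) (Ac p) k → vv α * x ∈ YA (Jset (p+1) q) (Ac p) (k+1) :=
    fun k x hx => YA_cone _ (by simp [mem_Ja]) (by simp [Ac]) (by simp [Ac]) hx
  have hcD : ∀ k x, x ∈ YA (Jset (p+1) q) (Ad p) k → vv α * x ∈ YA (Jset (p+1) q) (Ad p) (k+1) :=
    fun k x hx => YA_cone _ (by simp [mem_Ja]) (by simp [Ad]) (by simp [Ad]) hx
  have ht2 : ∀ k x, x ∈ YA (Jset (p+1) q) (Ac p) k → oL.t2 x ∈ YA (Jset (p+1) q) (Ac p) k :=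
    fun k x hx => YA_mp f2 _ (by simp [f2_fst]) (by simp [f2_fst])
      (by rintro ⟨i | i | i, _ | _⟩ <;> simp [f2, Ac]) hx
  have hsD : ∀ k x, x ∈ YA (Jset (p+1) q) (Ad p) k → oL.s x ∈ YA (Jset (p+1) q) (Ad p) k :=
    fun k x hx => YA_mp fs _ (by rintro ⟨_ | _ | _, x⟩ <;> simp [fs, mem_Ja, mem_Jb, mem_Jg])
      (by rintro ⟨_ | _ | _, x⟩ ⟨_ | _ | _, y⟩ <;> simp [fs])
      (by rintro ⟨i | i | i, _ | _⟩ <;> simp [fs, Ad]) hx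
  have hmc : ∀ j, j < N → f' (.c N j) ∈ YA (Jset (p+1) q) (Ac p) (N+j+1) := by
    intro j
    induction j with
    | zero =>
      intro hj
      rw [hhigh _ (by simp only [Gen.idx]; omega)]
      apply hcA
      simp only [BG, hj, if_true]
      have hN0 : N ≠ 0 := by omega
      simp only [bc, if_true, hN0, if_false, smul_zero, add_zero]
      have h1 := hCC (N-1) 0 le_rfl (by omega)
      rw [show N-1+0+1 = N by omega] at h1
      exact hAc _ (add_mem h1 (AddSubgroup.zsmul_mem _ (t1_YY _ h1) _))
    | succ j ih =>
      intro hj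
      rw [hhigh _ (by simp only [Gen.idx]; omega)]
      apply hcA
      simp only [BG, hj, if_true]
      have hN0 : N ≠ 0 := by omega
      simp only [bc, Nat.succ_ne_zero, if_false, hN0, Nat.add_sub_cancel]
      have h1 := hCC (N-1) (j+1) le_rfl (by omega)
      rw [show N-1+(j+1)+1 = N+(j+1) by omega] at h1
      have h2 := ih (by omega)
      have h3 : CC oL f' N j = f' (.c N j) := by rw [CC, if_pos (by omega)]
      rw [h3]
      refine add_mem (hAc _ (add_mem h1 (AddSubgroup.zsmul_mem _ (t1_YY _ h1) _)))
        (AddSubgroup.zsmul_mem _ (add_mem h2 (AddSubgroup.zsmul_mem _ (ht2 _ _ h2) _)) _)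
  have hmd : ∀ k, k < N → f' (.d N k) ∈ YA (Jset (p+1) q) (Ad p) (N+k+2) := by
    intro k
    induction k with
    | zero =>
      intro hk
      rw [hhigh _ (by simp only [Gen.idx]; omega)]
      apply hcD
      simp only [BG, hk, if_true, bd]
      have h1 := hmc 0 hk
      have h2 := hDD (N-1) 0 le_rfl
      rw [show N-1+0+2 = N+0+1 by omega] at h2
      have h3 : CC oL f' N 0 = f' (.c N 0) := by rw [CC, if_pos (by omega)]
      have h4 : CC oL f' 0 N = (-1 : ℤ)^(0*N) • oL.s (f' (.c N 0)) := by
        rw [CC, if_neg (by omega), if_pos (by omega)]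
      have h5 : f' (.e N) = 0 := by
        obtain ⟨M, rfl⟩ : ∃ M, N = M+1 := ⟨N-1, by omega⟩
        exact hes M
      rw [h3, h4, h5]
      exact sub_mem (sub_mem (add_mem (AddSubgroup.zsmul_mem _ (hsD _ _ (hAcd _ h1)) _)
        (AddSubgroup.zsmul_mem _ (hAcd _ (ht2 _ _ h1)) _)) (zero_mem _))
        (AddSubgroup.zsmul_mem _ (hAcd _ (hAc _ (add_mem h2 (AddSubgroup.zsmul_mem _
          (t1_YY _ (t2_YY _ (s_YY _ h2))) _)))) _)
    | succ k ih =>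
      intro hk
      rw [hhigh _ (by simp only [Gen.idx]; omega)]
      apply hcD
      simp only [BG, hk, if_true, bd, Nat.succ_ne_zero, if_false, Nat.add_sub_cancel]
      have h1 := hmc (k+1) hk
      have h2 := hDD (N-1) (k+1) le_rfl
      rw [show N-1+(k+1)+2 = N+(k+1)+1 by omega] at h2
      have h3 : CC oL f' N (k+1) = f' (.c N (k+1)) := by rw [CC, if_pos (by omega)]
      have h4 : CC oL f' (k+1) N = (-1 : ℤ)^((k+1)*N) • oL.s (f' (.c N (k+1))) := by
        rw [CC, if_neg (by omega), if_pos (by omega)]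
      have h5 : DD f' N k = f' (.d N k) := by rw [DD, if_pos (by omega)]
      have h6 := ih (by omega)
      rw [h3, h4, h5]
      exact sub_mem (sub_mem (add_mem (AddSubgroup.zsmul_mem _ (hsD _ _ (hAcd _ h1)) _)
        (AddSubgroup.zsmul_mem _ (hAcd _ (ht2 _ _ h1)) _)) (add_mem h6
          (AddSubgroup.zsmul_mem _ (hsD _ _ h6) _)))
        (AddSubgroup.zsmul_mem _ (hAcd _ (hAc _ (add_mem h2 (AddSubgroup.zsmul_mem _
          (t1_YY _ (t2_YY _ (s_YY _ h2))) _)))) _)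
  refine ⟨f', ⟨he0, hes, fun x hx hd => hbd _ x rfl hx hd, ?_⟩, ?_⟩
  · intro x hx
    by_cases hx' : x.ok (N-1)
    · exact YY_mono (Jset_succ p q) (hlowm x hx')
    · cases x with
      | c i j =>
        have : i = N ∧ j < N := by simp only [Gen.ok] at hx hx'; omega
        rw [this.1]; exact YA_le (hmc j this.2)
      | d i k =>
        have : i = N ∧ k < N := by simp only [Gen.ok] at hx hx'; omega
        rw [this.1]; exact YA_le (hmd k this.2)
      | e i =>
        rcases i with _ | i
        · simp only [Gen.ok] at hx'; omega
        · rw [hes]; exact zero_mem _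
  · intro n
    obtain ⟨M, rfl⟩ : ∃ M, N = M + 2 := ⟨N-2, by omega⟩
    simp only [show M + 2 - 1 = M + 1 by omega] at *
    have ka : ∀ y, vv α * (vv α * y) = 0 := fun y => by rw [← mul_assoc, v_sq, zero_mul]
    have kb : ∀ y, vv β * (vv β * y) = 0 := fun y => by rw [← mul_assoc, v_sq, zero_mul]
    have kab : ∀ y, vv β * (vv α * y) = - (vv α * (vv β * y)) := fun y => by
      rw [← mul_assoc, v_anti, ← mul_assoc, neg_mul]
    have sa : ∀ y, oL.s (vv α * y) = vv β * oL.s y := fun y => by rw [s_vmul]; rfl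
    have sb : ∀ y, oL.s (vv β * y) = vv α * oL.s y := fun y => by rw [s_vmul]; rfl
    have t2a : ∀ y, oL.t2 (vv α * y) = vv α * oL.t2 y := fun y => by rw [t2_vmul]; rfl
    have R := rel_gen (o := oL) f' hs
    set C0 := CC oL f' (M+1) (M+1) with hC0
    set D0 := f' (.d (M+1) M) with hD0
    set e : ℤ := (-1)^M with he
    have he' : e = 1 ∨ e = -1 := neg_one_pow_eq_or ℤ M
    have hCD : C0 = D0 - e • oL.s D0 := by
      have := R.T M
      rw [DD, if_pos (by omega), pow_succ] at this
      rw [hC0, this, ← he]; simp [sub_eq_add_neg, hD0]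
    have hCf : CC oL f (M+1) (M+1) = C0 := by
      rw [hCD, CC, if_neg (by omega), if_neg (by omega), if_neg (by omega),
        Nat.add_sub_cancel, ← hlow _ (by simp only [Gen.idx]; omega), pow_succ]
      simp [sub_eq_add_neg, he, hD0]
    have hcM : ∃ Y, CC oL f' (M+2) M = vv α * Y := by
      exact ⟨_, (show CC oL f' (M+2) M = f' (.c (M+2) M) by rw [CC, if_pos (by omega)]).trans
        (hhigh _ (by simp only [Gen.idx]; omega))⟩
    obtain ⟨Y, hY⟩ := hcM
    have H1 : f' (.c (M+2) (M+1)) = vv α * (C0 + e • oL.t1 C0) := by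
      rw [hhigh _ (by simp only [Gen.idx]; omega), BG, if_pos (by omega), bc]
      simp only [Nat.succ_ne_zero, if_false, Nat.add_sub_cancel, show M + 2 - 1 = M + 1 by omega, hY]
      simp [-zsmul_eq_mul, mul_add, mul_smul_comm, t2a, ka, pow_succ, he, hC0]
    have H2 : CC oL f' (M+1) (M+2) = vv β * (-e • C0 - oL.t2 C0) := by
      have hsC := R.S (M+1) (M+1)
      have e1 : (-1 : ℤ)^((M+1)*(M+2)) = 1 := (Nat.even_mul_succ_self (M+1)).neg_one_pow
      have e2 : (-1 : ℤ)^((M+1)*(M+1)) = - e := by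
        rcases Nat.even_or_odd M with h | h
        · rw [he, h.neg_one_pow, Odd.neg_one_pow (h.add_one.mul h.add_one)]
        · rw [he, h.neg_one_pow, Even.neg_one_pow (h.add_one.mul_right _)]; norm_num
      rw [CC, if_neg (by omega), if_pos (by omega), H1, e1, one_smul, sa, map_add, map_zsmul,
        oL.st1, hC0, hsC, e2]
      rcases he' with h | h <;> simp [-zsmul_eq_mul, h, sub_eq_add_neg]
    have H2' : CC oL f' (M+2) (M+1) = vv α * (C0 + e • oL.t1 C0) := by
      rw [CC, if_pos (by omega), H1]
    have hE : f' (.e (M+2)) = 0 := hes (M+1)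
    obtain ⟨X, hX, hX'⟩ : ∃ X, f' (.d (M+2) M) = vv α * X ∧
        vv α * (vv β * oL.s X) = vv α * (vv β * (-e • oL.s D0 - oL.t1 (oL.t2 D0))) := by
      refine ⟨_, hhigh _ (by simp only [Gen.idx]; omega), ?_⟩
      rw [BG, if_pos (by omega), bd, hE, hY]
      have c1 : CC oL f' M (M+2) = (-1 : ℤ)^(M*(M+2)) • (vv β * oL.s Y) := by
        rw [CC, if_neg (by omega), if_pos (by omega), ← sa, ← hY, CC, if_pos (by omega)]
      obtain ⟨Z, hZ⟩ : ∃ Z, DD f' (M+2) (M-1) = vv α * Z := by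
        exact ⟨_, (show DD f' (M+2) (M-1) = f' (.d (M+2) (M-1)) by rw [DD, if_pos (by omega)]).trans
          (hhigh _ (by simp only [Gen.idx]; omega))⟩
      have c2 : DD f' (M+1) M = D0 := by rw [DD, if_pos (by omega)]
      simp only [show M + 2 - 1 = M + 1 by omega, hZ, c1, c2]
      have c3 : ∃ U V, (if M = 0 then 0 else vv α * Z + (-1 : ℤ)^M • oL.s (vv α * Z))
          = vv α * U + vv β * V := by
        split_ifs
        · exact ⟨0, 0, by simp⟩
        · exact ⟨Z, (-1 : ℤ)^M • oL.s Z, by rw [sa, mul_smul_comm]⟩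
      obtain ⟨U, V, hUV⟩ := c3
      rw [hUV]
      simp only [map_add, map_sub, map_zsmul, sa, sb, t2a, oL.ss, oL.st1, oL.st2, mul_add, mul_sub,
        mul_smul_comm, ka, kb, kab, mul_neg, mul_zero, smul_zero, neg_zero]
      rcases he' with h | h <;> simp [-zsmul_eq_mul, pow_succ, ← he, h, oL.t2t1, sub_eq_add_neg] <;> abel
    have H3 : f' (.d (M+2) (M+1)) = vv α * (vv β *
        (-e • C0 - oL.t2 C0 - oL.s D0 - e • oL.t1 (oL.t2 D0))) := by
      rw [hhigh _ (by simp only [Gen.idx]; omega), BG, if_pos (by omega), bd, H2, H2', if_neg (by omega)]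
      have c2 : DD f' (M+1) (M+1) = 0 := R.G _
      have c3 : DD f' (M+2) M = vv α * X := by rw [DD, if_pos (by omega), hX]
      simp only [show M + 2 - 1 = M + 1 by omega, Nat.add_sub_cancel, c2, c3]
      simp only [map_zero, smul_zero, add_zero, sub_zero, sa, map_add, map_zsmul, t2a, mul_add, mul_sub, mul_smul_comm,
        ka, hX', zero_add, zero_sub]
      rcases he' with h | h <;> simp [-zsmul_eq_mul, pow_succ, ← he, h, sub_eq_add_neg] <;> abel
    set v := -e • zz (M+1) C0 with hv
    have H4 : CC oL f' (M+2) (M+2) = vv α * (vv β * v) := by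
      have := R.T (M+1)
      rw [DD, if_pos (by omega), H3] at this
      rw [this, hv, zz, hCD]
      simp only [map_add, map_sub, map_zsmul, map_neg, sa, sb, oL.ss, oL.st1, oL.st2, mul_add, mul_sub,
        mul_smul_comm, kab, mul_neg, smul_add, smul_sub, oL.t2t1, neg_smul]
      rcases he' with h | h <;> simp [-zsmul_eq_mul, pow_succ, ← he, h, sub_eq_add_neg] <;> abel
    have hC0m : C0 ∈ YY (Jset p q) (M+1+(M+1)+1) := hCC _ _ le_rfl le_rfl
    have hvm : v ∈ YY (Jset p q) (M+1+(M+1)+1) := by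
      refine AddSubgroup.zsmul_mem _ (add_mem (sub_mem (sub_mem hC0m
        (AddSubgroup.zsmul_mem _ (t1_YY _ hC0m) _)) (AddSubgroup.zsmul_mem _ (t2_YY _ hC0m) _))
        (t1_YY _ (t2_YY _ hC0m))) _
    have tv1 : oL.t1 v = e • v := by
      rw [hv, zz]
      rcases he' with h | h <;> simp [-zsmul_eq_mul, pow_succ, ← he, h, oL.t1t1, oL.t2t1, sub_eq_add_neg] <;> abel
    have tv2 : oL.t2 v = e • v := by
      rw [hv, zz]
      rcases he' with h | h <;> simp [-zsmul_eq_mul, pow_succ, ← he, h, oL.t2t2, oL.t2t1, sub_eq_add_neg] <;> abel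
    have hca : con (ind α) v = 0 := con_YY (by simp [hα, mem_Ja]) hvm
    have hcb : con (ind β) v = 0 := con_YY (by simp [hβ, mem_Jb]) hvm
    have H5 : con (ind β) (con (ind α) (zz (M+2) (vv α * (vv β * v)))) = v := by
      rw [zz]
      simp only [t1_vmul, t2_vmul, tv1, tv2, map_zsmul, mul_smul_comm, map_add, map_sub, con_v_mul, hca, hcb]
      rcases he' with h | h <;>
        simp [-zsmul_eq_mul, pow_succ, ← he, h, f1, f2, hα, hβ, ind, con_v_mul, mul_smul_comm, hca, hcb]
    rw [KA_succ, H4]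
    have : con (ind β) (con (ind α) (zz (M+2) (vv α * (vv β * v)))) = v := H5
    rw [hβ, hα] at this
    rw [this, hv, map_zsmul, hCf, pow_add, ← he]
    simp

end
end TRP

namespace TRP
noncomputable section
open D4
set_option linter.unusedSimpArgs false

/-! ### No system, even case -/

theorem dig (k : ℕ) : (Nat.digits 2 (2^k)).sum = 1 := by
  have := Nat.digits_base_pow_mul (b := 2) (k := k) (m := 1) (by norm_num) (by norm_num)
  rw [mul_one] at this
  rw [this]; simp

theorem central_val (k : ℕ) : ¬ 4 ∣ (2^k+2^k).choose (2^k) := by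
  intro h
  have h1 := sub_one_mul_padicValNat_choose_eq_sub_sum_digits (p := 2) (k := 2^k) (n := 2^k+2^k)
    (Nat.le_add_left _ _)
  have e : 2^k+2^k = 2^(k+1) := by ring
  rw [Nat.add_sub_cancel] at h1
  simp only [e, dig] at h1
  have h2 : (2^(k+1)).choose (2^k) ≠ 0 := (Nat.choose_pos (Nat.pow_le_pow_right (by norm_num) (by omega))).ne'
  rw [e, show 4 = 2^2 by norm_num, padicValNat_dvd_iff_le h2] at h
  omega

theorem ex_even (q : ℕ) (hq : Even q) (hq2 : 2 ≤ q) (p : ℕ) : ∃ ψ, Sys (Jset p q) (p+q) ψ ∧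
    (KA (2*q+1) p (zz (p+q) (CC oL ψ (p+q) (p+q))) = 2 * BB q q ∨
      KA (2*q+1) p (zz (p+q) (CC oL ψ (p+q) (p+q))) = - (2 * BB q q)) := by
  induction p with
  | zero => exact ⟨base, by simpa using base_sys q, Or.inl (by simpa using base_K q hq)⟩
  | succ p ih =>
    obtain ⟨ψ, h1, h2⟩ := ih
    have e : p + 1 + q - 1 = p + q := by omega
    obtain ⟨f, hf, hK⟩ := susp (p := p) (q := q) (N := p+1+q) (by omega) (f := ψ) (by rw [e]; exact h1)
    refine ⟨f, hf, ?_⟩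
    rw [hK, e]
    rcases neg_one_pow_eq_or ℤ (p+1+q) with h | h <;> rcases h2 with h2 | h2 <;> simp [h, h2]

theorem no_sys_even {r p : ℕ} (hr : 1 ≤ r) {φ} : ¬ Sys (Jset p (2^r)) (p + 2^r + 1) φ := by
  intro hφ
  obtain ⟨k, rfl⟩ : ∃ k, r = k + 1 := ⟨r-1, by omega⟩
  have hq : Even (2^(k+1)) := ⟨2^k, by ring⟩
  have hp := Nat.one_le_two_pow (n := k)
  have hq2 : 2 ≤ 2^(k+1) := by rw [pow_succ]; omega
  obtain ⟨ψ, h1, h2⟩ := ex_even _ hq hq2 p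
  have h3 := even_dvd rfl (by omega) hq hφ h1 (2*2^(k+1)+1) p rfl
  have h4 : BB (2^(k+1)) (2^(k+1)) = ((2^k+2^k).choose (2^k) : ℕ) := by
    have e : 2^(k+1) / 2 = 2^k := by rw [pow_succ]; omega
    rw [BB, e, if_neg]
    rw [pow_succ]; omega
  have h5 : (8:ℤ) ∣ 2 * ((2^k+2^k).choose (2^k) : ℕ) := by
    rcases h2 with h2 | h2 <;> rw [h2, h4] at h3
    · exact h3
    · exact (dvd_neg.1 h3)
  apply central_val k
  omega
/-! ### The case of three symmetric labels -/

structure CSys (J : Finset Idx) (C : ℕ → ℕ → Lam Idx) (a b : ℕ) : Prop where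
  e0 : C 0 0 = vv (Idx.g 0, true)
  mem : ∀ i j, i ≤ a → j ≤ b → i + j < a + b → C i j ∈ YY J (i+j+1)
  bd : ∀ i j, i ≤ a → j ≤ b → i + j < a + b → 0 < i + j → boA (C i j) = oL.bc C i j

theorem boA_bc (C : ℕ → ℕ → Lam Idx) (i j) : boA (oL.bc C i j) = oL.bc (fun i j => boA (C i j)) i j :=
  bc_nat boA bo_t1 bo_t2 C i j

theorem cmp_C {p q a b : ℕ} {C C' : ℕ → ℕ → Lam Idx} (hab : a + b = (Jset p q).card)
    (h : CSys (Jset p q) C a b) (h' : CSys (Jset p q) C' a b) (K : Lam Idx →+ ℤ) :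
    Even (K (oL.bc C a b) - K (oL.bc C' a b)) := by
  have hpos : 0 < a + b := by rw [hab, Jset_card]; omega
  set E : ℕ → ℕ → Lam Idx := fun i j => C i j - C' i j with hE
  have E0 : E 0 0 = 0 := by simp [hE, h.e0, h'.e0]
  have Em : ∀ i j, i ≤ a → j ≤ b → i + j < a + b → E i j ∈ YY (Jset p q) (i+j+1) :=
    fun i j h1 h2 h3 => sub_mem (h.mem i j h1 h2 h3) (h'.mem i j h1 h2 h3)
  have Eb : ∀ i j, i ≤ a → j ≤ b → i + j < a + b → boA (E i j) = oL.bc E i j := by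
    intro i j h1 h2 h3
    rcases Nat.eq_zero_or_pos (i+j) with h0 | h0
    · obtain rfl : i = 0 := by omega
      obtain rfl : j = 0 := by omega
      rw [E0]; simp [bc]
    · rw [hE, bc_sub, map_sub, h.bd i j h1 h2 h3 h0, h'.bd i j h1 h2 h3 h0]
  obtain ⟨H0, hH0⟩ := exists_fix (V := Lam Idx) (fun x : ℕ × ℕ => x.1 + x.2)
    (fun H x => HJ (Jset p q) (E x.1 x.2 - oL.bc (fun i j => H (i, j)) x.1 x.2)) (by
      intro f g x hfg
      congr 2
      apply bc_congr
      · intro h; exact hfg _ (by dsimp only; omega)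
      · intro h; exact hfg _ (by dsimp only; omega))
  set H : ℕ → ℕ → Lam Idx := fun i j => H0 (i, j) with hHd
  set W : ℕ → ℕ → Lam Idx := fun i j => E i j - oL.bc H i j with hW
  have hH : ∀ i j, H i j = HJ (Jset p q) (W i j) := by
    intro i j
    rw [hHd]; dsimp only; rw [hH0]
  have hBW : ∀ i j, oL.bc W i j = oL.bc E i j := by
    intro i j
    have := bc_sub (o := oL) E (oL.bc H) i j
    rw [bc_bc, sub_zero] at this
    exact this
  have main : ∀ n i j, i + j = n → i ≤ a → j ≤ b → i + j < a + b →
      W i j ∈ YY (Jset p q) (i+j+1) ∧ boA (W i j) = 0 ∧ (i + j + 1 < a + b → boA (H i j) = W i j) := by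
    intro n
    induction n using Nat.strong_induction_on with
    | _ n ih =>
      intro i j hn hi hj hij
      have h1 : i ≠ 0 → W (i-1) j ∈ YY (Jset p q) (i+j) ∧ boA (H (i-1) j) = W (i-1) j := by
        intro h0
        obtain ⟨u, -, w⟩ := ih (i-1+j) (by omega) (i-1) j rfl (by omega) hj (by omega)
        rw [show i-1+j+1 = i+j by omega] at u
        exact ⟨u, w (by omega)⟩
      have h2 : j ≠ 0 → W i (j-1) ∈ YY (Jset p q) (i+j) ∧ boA (H i (j-1)) = W i (j-1) := by
        intro h0
        obtain ⟨u, -, w⟩ := ih (i+(j-1)) (by omega) i (j-1) rfl hi (by omega) (by omega)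
        rw [show i+(j-1)+1 = i+j by omega] at u
        exact ⟨u, w (by omega)⟩
      have hm : W i j ∈ YY (Jset p q) (i+j+1) := by
        refine sub_mem (Em i j hi hj hij) (bc_mem _ (fun x => t1_YY x) (fun x => t2_YY x) _ _ _ ?_ ?_)
        · intro h0; rw [hH]; exact HJ_YY (h1 h0).1
        · intro h0; rw [hH]; exact HJ_YY (h2 h0).1
      have hz : boA (W i j) = 0 := by
        have hWij : W i j = E i j - oL.bc H i j := rfl
        rw [hWij, map_sub, Eb i j hi hj hij, boA_bc,
          bc_congr (fun i j => boA (H i j)) W i j (fun h0 => (h1 h0).2) (fun h0 => (h2 h0).2), hBW,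
          sub_self]
      refine ⟨hm, hz, fun hlt => ?_⟩
      rw [hH, boA_apply, bo_HJ (by omega) hm (by rw [← boA_apply, hz])]
  have e1 : oL.bc C a b - oL.bc C' a b = oL.bc W a b := by
    rw [← bc_sub, hBW]
  have par : ∀ (w t : Lam Idx) (e e' : ℤ), (e = 1 ∨ e = -1) → (e' = 1 ∨ e' = -1) → t = e' • w →
      Even (K (w + e • t)) := by
    rintro w t e e' (rfl | rfl) (rfl | rfl) rfl <;> simp
  rw [← map_sub, e1, bc, map_add, map_zsmul]
  apply Even.add
  · split_ifs with h0
    · simp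
    · obtain ⟨u, v, -⟩ := main _ (a-1) b rfl (by omega) le_rfl (by omega)
      rw [show a-1+b+1 = a + b by omega, hab] at u
      exact par _ _ _ _ (neg_one_pow_eq_or ℤ a) (neg_one_pow_eq_or ℤ (p+1)) (top_t1 u v)
  · refine Even.mul_left (?_ : Even (K _)) _
    split_ifs with h0
    · simp
    · obtain ⟨u, v, -⟩ := main _ a (b-1) rfl le_rfl (by omega) (by omega)
      rw [show a+(b-1)+1 = a + b by omega, hab] at u
      exact par _ _ _ _ (neg_one_pow_eq_or ℤ b) (neg_one_pow_eq_or ℤ (p+1)) (top_t2 u v)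

theorem con_YA {J : Finset Idx} {A k} {a : Idx × Bool} (ha : a ∈ A) {x} (hx : x ∈ YA J A k) :
    con (ind a) x = 0 := by
  induction hx using AddSubgroup.closure_induction with
  | mem y hy =>
    obtain ⟨l, -, -, h3, rfl⟩ := hy
    induction l with
    | nil => simp
    | cons b l ih =>
      have : ind a b = 0 := by
        rw [ind, if_neg]; rintro rfl; exact h3 b (by simp) ha
      rw [mono_cons, con_v_mul, this, ih fun c hc => h3 c (by simp [hc])]
      simp
  | zero => simp
  | add y z _ _ hy hz => rw [map_add, hy, hz, add_zero]
  | neg y _ hy => rw [map_neg, hy, neg_zero]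

def PC1 (J : Finset Idx) (a b : ℕ) : Prop :=
  ∃ C, ∃ K : Lam Idx →+ ℤ, CSys J C a b ∧ Odd (K (oL.bc C a b))

theorem PC1_step {J : Finset Idx} {a b p : ℕ} (hp : Idx.a p ∉ J) (ha : 1 ≤ a) (hb : 1 ≤ b)
    (h : PC1 J a b) : PC1 (insert (Idx.a p) J) (a+1) b := by
  classical
  obtain ⟨C, K, hC, hK⟩ := h
  set α : Idx × Bool := (Idx.a p, true) with hα
  obtain ⟨C0, hC0⟩ := exists_fix (V := Lam Idx) (fun x : ℕ × ℕ => x.1 + x.2)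
    (fun H x => if x.1 ≤ a ∧ x.1 + x.2 < a + b then C x.1 x.2 else
      vv α * oL.bc (fun i j => H (i, j)) x.1 x.2) (by
      intro f g x hfg
      congr 2
      apply bc_congr
      · intro h; exact hfg _ (by dsimp only; omega)
      · intro h; exact hfg _ (by dsimp only; omega))
  set C' : ℕ → ℕ → Lam Idx := fun i j => C0 (i, j) with hC'
  have hlow : ∀ i j, i ≤ a → i + j < a + b → C' i j = C i j := by
    intro i j h1 h2
    rw [hC']; dsimp only; rw [hC0]; dsimp only; rw [if_pos ⟨h1, h2⟩]
  have hhigh : ∀ i j, ¬ (i ≤ a ∧ i + j < a + b) → C' i j = vv α * oL.bc C' i j := by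
    intro i j h
    rw [hC']; dsimp only; conv_lhs => rw [hC0]
    dsimp only; rw [if_neg h]
  have hbd : ∀ n i j, i + j = n → i ≤ a + 1 → j ≤ b → i + j < a + 1 + b → 0 < i + j →
      boA (C' i j) = oL.bc C' i j := by
    intro n
    induction n using Nat.strong_induction_on with
    | _ n ih =>
      intro i j hn hi hj hij h0
      by_cases hx : i ≤ a ∧ i + j < a + b
      · rw [hlow i j hx.1 hx.2, hC.bd i j hx.1 hj hx.2 h0]
        apply bc_congr
        · intro h1; rw [hlow _ _ (by omega) (by omega)]
        · intro h1; rw [hlow _ _ (by omega) (by omega)]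
      · rw [hhigh i j hx, boA_apply, bo_v, ← boA_apply, boA_bc,
          bc_congr (fun i j => boA (C' i j)) (oL.bc C') i j, bc_bc]
        · simp
        · intro h1; exact ih (i-1+j) (by omega) _ _ rfl (by omega) hj (by omega) (by omega)
        · intro h1; exact ih (i+(j-1)) (by omega) _ _ rfl (by omega) (by omega) (by omega) (by omega)
  have hlm : ∀ i j, i ≤ a → j ≤ b → i + j < a + b → C' i j ∈ YY J (i+j+1) := by
    intro i j h1 h2 h3
    rw [hlow i j h1 h3]; exact hC.mem i j h1 h2 h3
  set A : Set (Idx × Bool) := {(Idx.a p, false)} with hA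
  have hJA : ∀ k, YY J k ≤ YA (insert (Idx.a p) J) A k := fun k =>
    YY_le_YA (by simp) (by rintro x rfl; exact hp)
  have hmA : ∀ j, j < b → C' (a+1) j ∈ YA (insert (Idx.a p) J) A (a+1+j+1) := by
    intro j
    induction j with
    | zero =>
      intro hj
      rw [hhigh _ _ (by omega), bc, if_pos rfl, if_neg (by omega), Nat.add_sub_cancel]
      apply YA_cone _ (by simp) (by simp [hA]) (by simp [hA])
      have h1 := hlm a 0 le_rfl (by omega) (by omega)
      simp only [smul_zero, add_zero]
      exact hJA _ (add_mem h1 (AddSubgroup.zsmul_mem _ (t1_YY _ h1) _))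
    | succ j ih =>
      intro hj
      rw [hhigh _ _ (by omega), bc, if_neg (by omega), if_neg (by omega), Nat.add_sub_cancel,
        Nat.add_sub_cancel]
      apply YA_cone _ (by simp) (by simp [hA]) (by simp [hA])
      have h1 := hlm a (j+1) le_rfl (by omega) (by omega)
      rw [show a+(j+1)+1 = a+1+(j+1) by omega] at h1
      have h2 := ih (by omega)
      refine add_mem (hJA _ (add_mem h1 (AddSubgroup.zsmul_mem _ (t1_YY _ h1) _)))
        (AddSubgroup.zsmul_mem _ (add_mem h2 (AddSubgroup.zsmul_mem _ ?_ _)) _)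
      exact YA_mp f2 _ (by simp [f2_fst]) (by simp [f2_fst])
        (by rintro ⟨i | i | i, _ | _⟩ <;> simp [f2, hA]) h2
  have hz : oL.bc C' a b = oL.bc C a b := by
    apply bc_congr
    · intro h1; rw [hlow _ _ (by omega) (by omega)]
    · intro h1; rw [hlow _ _ (by omega) (by omega)]
  have hzm : oL.bc C a b ∈ YY J (a+b) := by
    apply bc_mem _ (fun x => t1_YY x) (fun x => t2_YY x)
    · intro h1
      have := hC.mem (a-1) b (by omega) le_rfl (by omega)
      rwa [show a-1+b+1 = a+b by omega] at this
    · intro h1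
      have := hC.mem a (b-1) le_rfl (by omega) (by omega)
      rwa [show a+(b-1)+1 = a+b by omega] at this
  have hCab : C' a b = vv α * oL.bc C a b := by rw [hhigh a b (by omega), hz]
  refine ⟨C', K.comp (oL.t1.comp (con (ind (Idx.a p, false))).toAddMonoidHom), ⟨?_, ?_, ?_⟩, ?_⟩
  · rw [hlow 0 0 (by omega) (by omega), hC.e0]
  · intro i j hi hj hij
    by_cases hx : i ≤ a ∧ i + j < a + b
    · exact YY_mono (by simp) (hlm i j hx.1 hj hx.2)
    · by_cases hia : i ≤ a
      · obtain rfl : i = a := by omega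
        obtain rfl : j = b := by omega
        rw [hCab]
        exact cone_YY _ (by simp) (by simp [hα]) hp hzm
      · obtain rfl : i = a + 1 := by omega
        exact YA_le (hmA j (by omega))
  · intro i j hi hj hij h0
    exact hbd _ i j rfl hi hj hij h0
  · simp only [AddMonoidHom.comp_apply, LinearMap.toAddMonoidHom_coe]
    rw [bc, if_neg (by omega), if_neg (by omega), Nat.add_sub_cancel, hCab, t1_vmul]
    have h1 := hmA (b-1) (by omega)
    have h2 : oL.t2 (C' (a+1) (b-1)) ∈ YA (insert (Idx.a p) J) A (a+1+(b-1)+1) :=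
      YA_mp f2 _ (by simp [f2_fst]) (by simp [f2_fst])
        (by rintro ⟨i | i | i, _ | _⟩ <;> simp [f2, hA]) h1
    have h3 : con (ind (Idx.a p, false)) (oL.bc C a b) = 0 := con_YY hp hzm
    have h4 : con (ind (Idx.a p, false)) (oL.t1 (oL.bc C a b)) = 0 := con_YY hp (t1_YY _ hzm)
    simp only [map_add, map_zsmul, con_v_mul, h3, h4, con_YA (show (Idx.a p, false) ∈ A by simp [hA]) h1,
      con_YA (show (Idx.a p, false) ∈ A by simp [hA]) h2]
    rcases neg_one_pow_eq_or ℤ (a+1) with h | h <;>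
      simpa [-zsmul_eq_mul, ind, hα, f1, h, oL.t1t1] using hK

theorem PC1_swap {J J' : Finset Idx} {a b : ℕ}
    (hJ : ∀ x, x.1 ∈ J → (fs x).1 ∈ J') (h : PC1 J a b) : PC1 J' b a := by
  obtain ⟨C, K, hC, hK⟩ := h
  set C' : ℕ → ℕ → Lam Idx := fun i j => (-1 : ℤ)^(i*j) • oL.s (C j i) with hC'
  have hbc : ∀ i j, oL.bc C' i j = (-1 : ℤ)^(i*j) • oL.s (oL.bc C j i) := by
    intro i j
    unfold bc
    rw [hC']
    rcases i with _ | i <;> rcases j with _ | j <;>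
      simp [-zsmul_eq_mul, pow_succ, pow_add, add_mul, mul_add, pow_mul, oL.st1, oL.st2]
    rcases neg_one_pow_eq_or ℤ i with h | h <;> rcases neg_one_pow_eq_or ℤ j with h' | h' <;>
     simp [-zsmul_eq_mul, h, h'] <;> abel
  refine ⟨C', K.comp oL.s, ⟨?_, ?_, ?_⟩, ?_⟩
  · simp only [hC', hC.e0, oL_s]; simp [fs]
  · intro i j hi hj hij
    refine AddSubgroup.zsmul_mem _ ?_ _
    rw [add_comm i j]
    refine mp_YY fs hJ ?_ (hC.mem j i hj hi (by omega))
    rintro ⟨_ | _ | _, x⟩ ⟨_ | _ | _, y⟩ <;> simp [fs]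
  · intro i j hi hj hij h0
    rw [hbc, hC']; dsimp only
    rw [map_zsmul, bo_s, hC.bd j i hj hi (by omega) (by omega)]
  · rw [hbc, AddMonoidHom.comp_apply, map_zsmul, oL.ss, map_zsmul]
    rcases neg_one_pow_eq_or ℤ (b*a) with h | h <;> simpa [h] using hK

theorem PC1_base : PC1 (Jset 0 1) 2 1 := by
  have hm : ∀ i j, i ≤ 2 → j ≤ 1 → i + j < 2 + 1 → Cref i j ∈ YY (Jset 0 1) (i+j+1) := by
    intro i j hi hj hij
    refine AddSubgroup.zsmul_mem _ (YY_mono ?_ (eps_YY (i+j))) _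
    intro x hx
    simp only [gset, Finset.mem_image, Finset.mem_range] at hx
    obtain ⟨k, hk, rfl⟩ := hx
    rw [mem_Jg]; omega
  refine ⟨Cref, KA 3 0, ⟨?_, hm, fun i j _ _ _ h0 => bc_ref i j h0⟩, ?_⟩
  · simp [Cref, BB, eps]
  · have : oL.bc Cref 2 1 = wps 2 := by
      simp [-zsmul_eq_mul, bc, Cref, BB, wps, eps_t2, sub_eq_add_neg]
    rw [this, KA_zero, K0_wps]
    exact odd_one

def J2 (p p' : ℕ) : Finset Idx :=
  (Finset.range p).image Idx.a ∪ (Finset.range p').image Idx.b ∪ (Finset.range 3).image Idx.g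

theorem mem_J2a {p p' i} : Idx.a i ∈ J2 p p' ↔ i < p := by simp [J2]
theorem mem_J2b {p p' i} : Idx.b i ∈ J2 p p' ↔ i < p' := by simp [J2]
theorem mem_J2g {p p' i} : Idx.g i ∈ J2 p p' ↔ i < 3 := by simp [J2]

theorem J2_eq (p) : J2 p p = Jset p 1 := by
  ext x
  rcases x with i | i | i
  · rw [mem_J2a, mem_Ja]
  · rw [mem_J2b, mem_Jb]
  · rw [mem_J2g, mem_Jg]

theorem J2_succ (p p') : insert (Idx.a p) (J2 p p') = J2 (p+1) p' := by
  ext x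
  rcases x with i | i | i
  · rw [Finset.mem_insert, mem_J2a, mem_J2a, Idx.a.injEq]; omega
  · simp [mem_J2b]
  · simp [mem_J2g]

theorem PC1_iter {k b p' : ℕ} (hk : 1 ≤ k) (hb : 1 ≤ b) (h : PC1 (J2 0 p') k b) (p : ℕ) :
    PC1 (J2 p p') (p+k) b := by
  induction p with
  | zero => simpa using h
  | succ p ih =>
    have := PC1_step (p := p) (by simp [mem_J2a]) (by omega) hb ih
    rw [J2_succ] at this
    rwa [show p + 1 + k = p + k + 1 by omega]

theorem no_sys_one {p : ℕ} {φ} : ¬ Sys (Jset p 1) (p + 1 + 1) φ := by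
  intro hφ
  have h1 := PC1_iter (k := 2) (b := 1) (p' := 0) (by omega) (by omega)
    (by rw [J2_eq]; exact PC1_base) p
  have h2 : PC1 (J2 0 p) 1 (p+2) := PC1_swap (J := J2 p 0) (by
    rintro ⟨_ | _ | _, x⟩ <;> simp [fs, mem_J2a, mem_J2b, mem_J2g]) h1
  have h3 := PC1_iter (by omega) (by omega) h2 p
  rw [J2_eq] at h3
  obtain ⟨C, K, hC, hK⟩ := h3
  have hbd : ∀ i j, i ≤ p + 2 → j ≤ p + 2 → i + j < p + 2 + (p + 2) → 0 < i + j →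
      boA (CC oL φ i j) = oL.bc (CC oL φ) i j := by
    intro i j hi hj hij h0
    rw [CC_nat boA bo_s, ← CC_BG φ hφ.hs]
    apply CC_congr _ _ i j (p+2) hi hj
    intro y hy hd
    exact hφ.bd y hy (by omega)
  have hm : ∀ i j, i ≤ p + 2 → j ≤ p + 2 → CC oL φ i j ∈ YY (Jset p 1) (i+j+1) := by
    intro i j hi hj
    apply CC_mem _ s_YY φ i j (p+2) hi hj
    intro y hy hd
    rw [← hd]; exact hφ.mem y hy
  have hD : CSys (Jset p 1) (CC oL φ) (p+1) (p+2) := by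
    refine ⟨?_, fun i j hi hj hij => hm i j (by omega) (by omega),
      fun i j hi hj hij h0 => hbd i j (by omega) (by omega) (by omega) h0⟩
    simp [CC, hφ.e0]
  have h4 := cmp_C (by rw [Jset_card]; omega) hC hD K
  have h5 : oL.bc (CC oL φ) (p+1) (p+2) = 0 := by
    rw [← hbd _ _ (by omega) (by omega) (by omega) (by omega),
      YY_top (by rw [Jset_card]; omega) (hm (p+1) (p+2) (by omega) (by omega)), map_zero]
  rw [h5, map_zero, sub_zero] at h4
  exact (Int.not_even_iff_odd.2 hK) h4

theorem no_sys {r p : ℕ} {φ} : ¬ Sys (Jset p (2^r)) (p + 2^r + 1) φ := by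
  rcases r with _ | r
  · exact no_sys_one
  · exact no_sys_even (by omega)

end
end TRP


namespace TRP
noncomputable section
open D4
set_option linter.unusedSimpArgs false

/-! ### List chains -/

section chains
variable {P : Type*}

abbrev Ch (P : Type*) := FreeAbelianGroup (List P)

def ofL (l : List P) : Ch P := FreeAbelianGroup.of l

theorem Ch_ext {A : Type*} [AddCommGroup A] (f g : Ch P →+ A) (h : ∀ l, f (ofL l) = g (ofL l)) (x : Ch P) :
    f x = g x := by
  have : f = g := FreeAbelianGroup.lift_ext _ _ h
  rw [this]

def cone (b : P) : Ch P →+ Ch P := FreeAbelianGroup.map (List.cons b)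
@[simp] theorem cone_of (b : P) (l) : cone b (ofL l) = ofL (b :: l) := FreeAbelianGroup.map_of_apply _

def bdL : List P → Ch P
  | [] => 0
  | b :: l => ofL l - cone b (bdL l)

def bdC : Ch P →+ Ch P := FreeAbelianGroup.lift bdL
theorem bdC_of (l : List P) : bdC (ofL l) = bdL l := FreeAbelianGroup.lift_apply_of _ _
@[simp] theorem bdC_nil : bdC (ofL ([] : List P)) = 0 := bdC_of _
@[simp] theorem bdC_cons (b : P) (l) : bdC (ofL (b :: l)) = ofL l - cone b (bdC (ofL l)) := by
  rw [bdC_of, bdC_of, bdL]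

theorem bdC_cone (b : P) (x) : bdC (cone b x) = x - cone b (bdC x) :=
  Ch_ext (bdC.comp (cone b)) (AddMonoidHom.id _ - (cone b).comp bdC) (fun l => by simp) x

theorem bdC_bdC (x : Ch P) : bdC (bdC x) = 0 := by
  refine Ch_ext (bdC.comp bdC) 0 (fun l => ?_) x
  simp only [AddMonoidHom.comp_apply, AddMonoidHom.zero_apply]
  induction l with
  | nil => simp
  | cons b l ih => rw [bdC_cons, map_sub, bdC_cone, ih]; simp

def act (g : P → P) : Ch P →+ Ch P := FreeAbelianGroup.map (List.map g)
@[simp] theorem act_of (g : P → P) (l) : act g (ofL l) = ofL (l.map g) := FreeAbelianGroup.map_of_apply _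

theorem act_cone (g : P → P) (b x) : act g (cone b x) = cone (g b) (act g x) :=
  Ch_ext ((act g).comp (cone b)) ((cone (g b)).comp (act g)) (fun l => by simp) x

theorem act_act (g h : P → P) (x) : act g (act h x) = act (g ∘ h) x :=
  Ch_ext ((act g).comp (act h)) (act (g ∘ h)) (fun l => by simp) x
theorem act_id (x : Ch P) : act id x = x :=
  Ch_ext (act id) (AddMonoidHom.id _) (fun l => by simp) x

theorem bdC_act (g : P → P) (x) : bdC (act g x) = act g (bdC x) := by
  refine Ch_ext (bdC.comp (act g)) ((act g).comp bdC) (fun l => ?_) x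
  simp only [AddMonoidHom.comp_apply]
  induction l with
  | nil => simp
  | cons b l ih => rw [bdC_cons, act_of, List.map_cons, bdC_cons, map_sub, act_cone, ← ih]; simp

/-- chains supported on lists with a property -/
def Su (Q : List P → Prop) : AddSubgroup (Ch P) := AddSubgroup.closure {x | ∃ l, Q l ∧ x = ofL l}

theorem of_Su {Q : List P → Prop} {l} (h : Q l) : ofL l ∈ Su Q := AddSubgroup.subset_closure ⟨l, h, rfl⟩

theorem Su_map {Q : List P → Prop} {A : Type*} [AddCommGroup A] (S : AddSubgroup A) (f : Ch P →+ A)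
    (h : ∀ l, Q l → f (ofL l) ∈ S) {x} (hx : x ∈ Su Q) : f x ∈ S := by
  induction hx using AddSubgroup.closure_induction with
  | mem y hy => obtain ⟨l, h1, rfl⟩ := hy; exact h l h1
  | zero => simp
  | add y z _ _ hy hz => rw [map_add]; exact add_mem hy hz
  | neg y _ hy => rw [map_neg]; exact neg_mem hy

theorem Su_eq {Q : List P → Prop} {A : Type*} [AddCommGroup A] (f g : Ch P →+ A)
    (h : ∀ l, Q l → f (ofL l) = g (ofL l)) {x} (hx : x ∈ Su Q) : f x = g x := by
  have := Su_map ⊥ (f - g) (fun l hl => by simp [h l hl]) hx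
  simpa [sub_eq_zero] using this

theorem Su_mono {Q R : List P → Prop} (h : ∀ l, Q l → R l) {x} (hx : x ∈ Su Q) : x ∈ Su R :=
  Su_map (Su R) (AddMonoidHom.id _) (fun l hl => of_Su (h l hl)) hx

/-- boundary faces are sublists, one shorter -/
theorem bdC_Su (l : List P) : bdC (ofL l) ∈ Su (fun l' => l'.length + 1 = l.length ∧ l' ⊆ l) := by
  induction l with
  | nil => simp
  | cons b l ih =>
    rw [bdC_cons]
    refine sub_mem (of_Su ⟨rfl, List.subset_cons_self _ _⟩) ?_
    refine Su_map _ (cone b) (fun l' hl' => ?_) ih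
    rw [cone_of]
    exact of_Su ⟨by simp [hl'.1], List.cons_subset_cons _ hl'.2⟩

end chains

/-! ### Barycentric subdivision -/

section sd
variable {V : Type*} [NormedAddCommGroup V] [NormedSpace ℝ V]

def bary (l : List V) : V := (l.length : ℝ)⁻¹ • l.sum

theorem sd_exists : ∃ f : List V → Ch V, f = fun l => if l = [] then ofL [] else
    cone (bary l) (FreeAbelianGroup.lift f (bdC (ofL l))) := by
  classical
  refine exists_fix (V := Ch V) List.length _ ?_
  intro f g l h
  split_ifs
  · rfl
  · congr 1
    refine Su_eq _ _ (fun l' hl' => ?_) (bdC_Su l)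
    rw [ofL, FreeAbelianGroup.lift_apply_of, FreeAbelianGroup.lift_apply_of]
    exact h _ (by omega)

def sdL : List V → Ch V := sd_exists.choose
def Sd : Ch V →+ Ch V := FreeAbelianGroup.lift sdL

theorem Sd_of (l : List V) : Sd (ofL l) = sdL l := FreeAbelianGroup.lift_apply_of _ _
theorem sdL_eq (l : List V) : sdL l = if l = [] then ofL [] else cone (bary l) (Sd (bdC (ofL l))) :=
  congrFun sd_exists.choose_spec l
theorem Sd_nil : Sd (ofL ([] : List V)) = ofL [] := by rw [Sd_of, sdL_eq, if_pos rfl]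
theorem Sd_ne (l : List V) (h : l ≠ []) : Sd (ofL l) = cone (bary l) (Sd (bdC (ofL l))) := by
  rw [Sd_of, sdL_eq, if_neg h]

theorem bdC_Sd (x : Ch V) : bdC (Sd x) = Sd (bdC x) := by
  refine Ch_ext (bdC.comp Sd) (Sd.comp bdC) (fun l => ?_) x
  simp only [AddMonoidHom.comp_apply]
  induction hn : l.length using Nat.strong_induction_on generalizing l with
  | _ n ih =>
    rcases eq_or_ne l [] with rfl | hl
    · rw [Sd_nil]; simp
    · rw [Sd_ne l hl, bdC_cone]
      have : bdC (Sd (bdC (ofL l))) = Sd (bdC (bdC (ofL l))) :=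
        Su_eq (bdC.comp Sd) (Sd.comp bdC) (fun l' hl' => ih l'.length (by omega) l' rfl) (bdC_Su l)
      rw [this, bdC_bdC]; simp

theorem bary_map (g : V →ₗ[ℝ] V) (l : List V) : bary (l.map g) = g (bary l) := by
  simp [bary, map_list_sum]

theorem Sd_act (g : V →ₗ[ℝ] V) (x : Ch V) : Sd (act g x) = act g (Sd x) := by
  refine Ch_ext (Sd.comp (act g)) ((act g).comp Sd) (fun l => ?_) x
  simp only [AddMonoidHom.comp_apply]
  induction hn : l.length using Nat.strong_induction_on generalizing l with
  | _ n ih =>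
    rcases eq_or_ne l [] with rfl | hl
    · rw [act_of, List.map_nil, Sd_nil]; simp
    · rw [act_of, Sd_ne l hl, Sd_ne _ (by simpa using hl), bary_map, act_cone, ← act_of, bdC_act]
      congr 1
      exact Su_eq (Sd.comp (act g)) ((act g).comp Sd) (fun l' hl' => ih l'.length (by omega) l' rfl) (bdC_Su l)

theorem bary_mem {S : Set V} (hS : Convex ℝ S) (l : List V) (hl : l ≠ []) (h : ∀ v ∈ l, v ∈ S) :
    bary l ∈ S := by
  have hpos : (0:ℝ) < l.length := by
    exact_mod_cast List.length_pos_of_ne_nil hl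
  have : bary l = ∑ i : Fin l.length, (l.length : ℝ)⁻¹ • l.get i := by
    rw [bary, ← Finset.smul_sum]
    congr 1
    conv_lhs => rw [← List.ofFn_get l]
    rw [List.sum_ofFn]
  rw [this]
  refine hS.sum_mem (fun _ _ => by positivity) ?_ (fun i _ => h _ (List.get_mem _ _))
  simp; field_simp

theorem bary_dist {δ : ℝ} (l : List V) (h : ∀ u ∈ l, ∀ v ∈ l, dist u v ≤ δ) (v : V) (hv : v ∈ l) :
    dist v (bary l) ≤ (1 - 1 / (l.length : ℝ)) * δ := by
  classical
  have hpos : (0:ℝ) < l.length := by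
    exact_mod_cast List.length_pos_of_mem hv
  have h1 : v - bary l = (l.length : ℝ)⁻¹ • (((l.erase v).map (fun u => v - u)).sum) := by
    have e1 : ∀ l' : List V, (l'.map (fun u => v - u)).sum = (l'.length : ℝ) • v - l'.sum := by
      intro l'
      induction l' with
      | nil => simp
      | cons a l' ih => simp only [List.map_cons, List.sum_cons, ih, List.length_cons]; push_cast; module
    have e2 : (l.erase v).sum = l.sum - v := by
      have := (List.perm_cons_erase hv).sum_eq
      rw [this]; simp
    rw [e1, e2, List.length_erase_of_mem hv, bary, Nat.cast_sub (List.length_pos_of_mem hv)]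
    rw [smul_sub, smul_smul]
    have : (l.length : ℝ)⁻¹ * ((l.length : ℝ) - (1:ℕ)) = 1 - (l.length : ℝ)⁻¹ := by
      field_simp; simp
    rw [this]; module
  have h2 : ∀ l' : List V, l' ⊆ l → ‖(l'.map (fun u => v - u)).sum‖ ≤ l'.length * δ := by
    intro l'
    induction l' with
    | nil => simp
    | cons a l' ih =>
      intro hl'
      rw [List.map_cons, List.sum_cons, List.length_cons]
      have := norm_add_le (v - a) ((l'.map (fun u => v - u)).sum)
      have h3 := ih (fun x hx => hl' (by simp [hx]))
      have h4 := h v hv a (hl' (by simp))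
      rw [dist_eq_norm] at h4
      push_cast; linarith
  rw [dist_eq_norm, h1, norm_smul, norm_inv, Real.norm_natCast]
  have h3 := h2 (l.erase v) List.erase_subset
  rw [List.length_erase_of_mem hv, Nat.cast_sub (List.length_pos_of_mem hv)] at h3
  calc _ ≤ (l.length : ℝ)⁻¹ * ((l.length - (1:ℕ)) * δ) := by gcongr
    _ = _ := by field_simp; push_cast; ring

/-- lists of given length in a set, of bounded diameter -/
def Sm (n : ℕ) (S : Set V) (δ : ℝ) (l : List V) : Prop :=
  l.length = n ∧ (∀ v ∈ l, v ∈ S) ∧ ∀ u ∈ l, ∀ v ∈ l, dist u v ≤ δ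

theorem Sd_Sm {L : ℕ} {δ : ℝ} (hδ : 0 ≤ δ) (l : List V) :
    l.length ≤ L → 0 < L → ∀ S : Set V, Convex ℝ S → Sm l.length S δ l →
    Sd (ofL l) ∈ Su (Sm l.length S ((1 - 1 / (L : ℝ)) * δ)) := by
  induction hn : l.length using Nat.strong_induction_on generalizing l with
  | _ n ih =>
    intro hL hL0 S hS hl
    rcases eq_or_ne l [] with rfl | hne
    · rw [Sd_nil]; exact of_Su ⟨hn, by simp, by simp⟩
    · have hc : Convex ℝ (convexHull ℝ {v | v ∈ l}) := convex_convexHull _ _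
      rw [Sd_ne l hne]
      have hpos := List.length_pos_of_ne_nil hne
      have key : Sd (bdC (ofL l)) ∈ Su (Sm (n-1) (convexHull ℝ {v | v ∈ l}) ((1 - 1 / (L : ℝ)) * δ)) := by
        refine Su_map _ Sd (fun l' hl' => ?_) (bdC_Su l)
        have := ih l'.length (by omega) l' rfl (by omega) hL0 _ hc
          ⟨rfl, fun v hv => subset_convexHull _ _ (hl'.2 hv), fun u hu v hv => hl.2.2 u (hl'.2 hu) v (hl'.2 hv)⟩
        rwa [show l'.length = n - 1 by omega] at this
      have hsub : convexHull ℝ {v | v ∈ l} ⊆ S := convexHull_min hl.2.1 hS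
      have hbary : bary l ∈ S := bary_mem hS l hne hl.2.1
      have hball : convexHull ℝ {v | v ∈ l} ⊆ Metric.closedBall (bary l) ((1 - 1 / (L : ℝ)) * δ) := by
        refine convexHull_min (fun v hv => ?_) (convex_closedBall _ _)
        rw [Metric.mem_closedBall]
        refine (bary_dist l hl.2.2 v hv).trans ?_
        have : (1:ℝ) / L ≤ 1 / l.length := by
          apply one_div_le_one_div_of_le
          · exact_mod_cast hpos
          · exact_mod_cast (hn ▸ hL)
        gcongr
      have hLL : (0:ℝ) ≤ (1 - 1 / (L : ℝ)) * δ := by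
        have : (1:ℝ) / L ≤ 1 := by
          rw [div_le_one (by exact_mod_cast hL0)]; exact_mod_cast hL0
        apply mul_nonneg _ hδ; linarith
      refine Su_map _ (cone (bary l)) (fun l' hl' => ?_) key
      rw [cone_of]
      refine of_Su ⟨by rw [List.length_cons, hl'.1]; omega, ?_, ?_⟩
      · intro v hv
        rcases List.mem_cons.1 hv with rfl | hv
        · exact hbary
        · exact hsub (hl'.2.1 v hv)
      · intro u hu v hv
        rcases List.mem_cons.1 hu with rfl | hu <;> rcases List.mem_cons.1 hv with rfl | hv
        · simpa using hLL
        · rw [dist_comm]; exact hball (hl'.2.1 v hv)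
        · exact hball (hl'.2.1 u hu)
        · exact hl'.2.2 u hu v hv

def Sdi (M : ℕ) : Ch V →+ Ch V := match M with
  | 0 => AddMonoidHom.id _
  | M+1 => (Sdi M).comp Sd

theorem bdC_Sdi (M) (x : Ch V) : bdC (Sdi M x) = Sdi M (bdC x) := by
  induction M generalizing x with
  | zero => rfl
  | succ M ih => simp only [Sdi, AddMonoidHom.comp_apply]; rw [ih, bdC_Sd]

theorem Sdi_act (M) (g : V →ₗ[ℝ] V) (x : Ch V) : Sdi M (act g x) = act g (Sdi M x) := by
  induction M generalizing x with
  | zero => rfl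
  | succ M ih => simp only [Sdi, AddMonoidHom.comp_apply]; rw [Sd_act, ih]

theorem Sdi_Sm {L n : ℕ} (hL : n ≤ L) (hL0 : 0 < L) (S : Set V) (hS : Convex ℝ S) (M : ℕ) {δ : ℝ} (hδ : 0 ≤ δ)
    {x : Ch V} (hx : x ∈ Su (Sm n S δ)) : Sdi M x ∈ Su (Sm n S ((1 - 1 / (L : ℝ))^M * δ)) := by
  induction M generalizing x δ with
  | zero => simpa [Sdi] using hx
  | succ M ih =>
    simp only [Sdi, AddMonoidHom.comp_apply]
    have : (1:ℝ) / L ≤ 1 := by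
      rw [div_le_one (by exact_mod_cast hL0)]; exact_mod_cast hL0
    rw [pow_succ, mul_assoc]
    apply ih (mul_nonneg (by linarith) hδ)
    refine Su_map _ Sd (fun l hl => ?_) hx
    have h1 := hl.1
    subst h1
    exact Sd_Sm hδ l hL hL0 S hS hl

end sd

end
end TRP


namespace TRP
noncomputable section
open D4
set_option linter.unusedSimpArgs false

/-! ### The geometric resolution -/

section geo
variable {K : ℕ}

abbrev Ve (K : ℕ) := Fin K → ℝ
abbrev Pt (K : ℕ) := Ve K × Ve K

def G1 : Pt K →ₗ[ℝ] Pt K where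
  toFun P := (-P.1, P.2)
  map_add' P Q := by ext <;> simp [add_comm]
  map_smul' c P := by ext <;> simp
def G2 : Pt K →ₗ[ℝ] Pt K where
  toFun P := (P.1, -P.2)
  map_add' P Q := by ext <;> simp [add_comm]
  map_smul' c P := by ext <;> simp
def Gs : Pt K →ₗ[ℝ] Pt K where
  toFun P := (P.2, P.1)
  map_add' P Q := by ext <;> simp
  map_smul' c P := by ext <;> simp

theorem G1_apply (P : Pt K) : G1 P = (-P.1, P.2) := rfl
theorem G2_apply (P : Pt K) : G2 P = (P.1, -P.2) := rfl
theorem Gs_apply (P : Pt K) : Gs P = (P.2, P.1) := rfl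

theorem act_comp_eq {Q : Type*} (g h k m : Q → Q) (e : ∀ x, g (h x) = k (m x)) (x : Ch Q) :
    act g (act h x) = act k (act m x) := by
  rw [act_act, act_act]; congr 2; funext y; exact e y

theorem act_comp_id {Q : Type*} (g h : Q → Q) (e : ∀ x, g (h x) = x) (x : Ch Q) :
    act g (act h x) = x := by
  rw [act_act, show g ∘ h = id from funext e, act_id]

def oC : D4 (Ch (Pt K)) where
  t1 := act G1
  t2 := act G2
  s := act Gs
  t1t1 := act_comp_id _ _ (fun x => by simp [G1_apply])
  t2t2 := act_comp_id _ _ (fun x => by simp [G2_apply])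
  ss := act_comp_id _ _ (fun x => by simp [Gs_apply])
  t2t1 := act_comp_eq _ _ _ _ (fun x => by simp [G1_apply, G2_apply])
  st1 := act_comp_eq _ _ _ _ (fun x => by simp [G1_apply, G2_apply, Gs_apply])
  st2 := act_comp_eq _ _ _ _ (fun x => by simp [G1_apply, G2_apply, Gs_apply])

theorem oC_t1 (x : Ch (Pt K)) : oC.t1 x = act G1 x := rfl
theorem oC_t2 (x : Ch (Pt K)) : oC.t2 x = act G2 x := rfl
theorem oC_s (x : Ch (Pt K)) : oC.s x = act Gs x := rfl

def bas (i : ℕ) : Ve K := fun l => if l.val = i then 1 else 0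

def ptx : Gen → ℕ
  | .c i _ => i
  | .d i _ => i
  | .e i => i
def pty : Gen → ℕ
  | .c _ j => j
  | .d i _ => i
  | .e i => i

def ba (f : Gen → Ch (Pt K)) : Gen → Ch (Pt K)
  | .e 0 => ofL []
  | x => BG oC f x

theorem ba_e0 (f : Gen → Ch (Pt K)) : ba f (.e 0) = ofL [] := rfl
theorem ba_pos (f : Gen → Ch (Pt K)) (x : Gen) (h : 0 < x.dim) : ba f x = BG oC f x := by
  rcases x with _ | _ | (_ | i)
  · rfl
  · rfl
  · simp [Gen.dim] at h
  · rfl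

theorem th_exists (K : ℕ) : ∃ f : Gen → Ch (Pt K), f = fun x => cone (bas (ptx x), bas (pty x)) (ba f x) := by
  refine exists_fix (V := Ch (Pt K)) Gen.dim _ ?_
  intro f g x h
  have : ba f x = ba g x := by
    rcases Nat.eq_zero_or_pos x.dim with h0 | h0
    · rcases x with ⟨i, j⟩ | ⟨i, j⟩ | (_ | i)
      · simp only [Gen.dim] at h0
        simp only [ba, BG]; rw [if_neg (by omega), if_neg (by omega)]
      · simp [Gen.dim] at h0
      · rfl
      · simp [Gen.dim] at h0
    · rw [ba_pos f x h0, ba_pos g x h0]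
      exact BG_congr f g x fun y _ hd => h y (by omega)
  simp only [this]

def th (K : ℕ) : Gen → Ch (Pt K) := (th_exists K).choose
theorem th_eq (x : Gen) : th K x = cone (bas (ptx x), bas (pty x)) (ba (th K) x) :=
  congrFun (th_exists K).choose_spec x
theorem th_e0 : th K (.e 0) = ofL [(bas 0, bas 0)] := by rw [th_eq, ba_e0, cone_of]; rfl
theorem th_pos (x : Gen) (h : 0 < x.dim) : th K x = cone (bas (ptx x), bas (pty x)) (BG oC (th K) x) := by
  rw [th_eq, ba_pos _ _ h]
theorem th_es (i : ℕ) : th K (.e (i+1)) = cone (bas (i+1), bas (i+1))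
    (th K (.e i) + (-1 : ℤ)^(i+1) • oC.t1 (oC.t2 (th K (.e i)))) := by
  rw [th_pos _ (by simp [Gen.dim])]
  simp [BG, be, ptx, pty]

theorem th_s (i : ℕ) : oC.s (th K (.e i)) = th K (.e i) := by
  induction i with
  | zero => rw [th_e0, oC_s, act_of]; simp [Gs_apply]
  | succ i ih =>
    rw [th_es, oC_s, act_cone, ← oC_s, map_add, map_zsmul, oC.st1, oC.st2, ih, Gs_apply, oC.t2t1]

theorem bdC_BG (f : Gen → Ch (Pt K)) (x : Gen) : bdC (BG oC f x) = BG oC (fun y => bdC (f y)) x :=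
  BG_nat (o := oC) (o' := oC) bdC (fun x => by rw [oC_t1, oC_t1, bdC_act]) (fun x => by rw [oC_t2, oC_t2, bdC_act])
    (fun x => by rw [oC_s, oC_s, bdC_act]) f x

theorem bdC_th (x : Gen) (m : ℕ) (hx : x.ok m) (h : 0 < x.dim) : bdC (th K x) = BG oC (th K) x := by
  induction hn : x.dim using Nat.strong_induction_on generalizing x m with
  | _ n ih =>
    rw [th_pos x h, bdC_cone, bdC_BG]
    have : BG oC (fun y => bdC (th K y)) x = 0 := by
      rcases Nat.lt_or_ge 1 x.dim with h1 | h1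
      · rw [← BG_BG (o := oC) (th K) th_s x]
        exact BG_congr _ _ x fun y hy hd => ih y.dim (by omega) y _ hy (by omega) rfl
      · have h1 : x.dim = 1 := by omega
        have e0 : bdC (th K (.e 0)) = ofL [] := by rw [th_e0]; simp
        have e1 : oC.s (ofL ([] : List (Pt K))) = ofL [] := by rw [oC_s]; simp
        have e2 : oC.t1 (ofL ([] : List (Pt K))) = ofL [] := by rw [oC_t1]; simp
        have e3 : oC.t2 (ofL ([] : List (Pt K))) = ofL [] := by rw [oC_t2]; simp
        rcases x with ⟨i, j⟩ | ⟨i, j⟩ | i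
        · simp only [Gen.dim, Gen.ok] at h1 hx
          obtain rfl : i = 1 := by omega
          obtain rfl : j = 0 := by omega
          simp [BG, bc, CC, e0, e2]
        · simp only [Gen.dim, Gen.ok] at h1 hx
          omega
        · simp only [Gen.dim, Gen.ok] at h1 hx
          subst h1
          simp [BG, be, e0, e2, e3]
    rw [this]; simp

/-! ### supports -/

def Fc (σ : Ve K) : Set (Ve K) := {x | (∀ l, 0 ≤ σ l * x l) ∧ ∑ l, σ l * x l = 1}
def sgn (σ : Ve K) : Prop := ∀ l, σ l = 1 ∨ σ l = -1
def HS (i : ℕ) (x : Ve K) : Prop := (∀ l : Fin K, i < l.val → x l = 0) ∧ ∀ l : Fin K, l.val = i → 0 ≤ x l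
def HH1 (i : ℕ) (l : List (Ve K)) : Prop := ∃ σ, sgn σ ∧ ∀ x ∈ l, x ∈ Fc σ ∧ HS i x

theorem convex_Fc (σ : Ve K) : Convex ℝ (Fc σ) := by
  intro x hx y hy a b ha hb hab
  refine ⟨fun l => ?_, ?_⟩
  · have := hx.1 l; have := hy.1 l
    simp only [Pi.add_apply, Pi.smul_apply, smul_eq_mul]
    have h : σ l * (a * x l + b * y l) = a * (σ l * x l) + b * (σ l * y l) := by ring
    rw [h]; positivity
  · have : ∀ l, σ l * (a • x + b • y) l = a * (σ l * x l) + b * (σ l * y l) := fun l => by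
      simp only [Pi.add_apply, Pi.smul_apply, smul_eq_mul]; ring
    simp only [this, Finset.sum_add_distrib, ← Finset.mul_sum, hx.2, hy.2]
    linarith

theorem HS_mono {i i' : ℕ} (h : i ≤ i') {x : Ve K} (hx : HS i x) : HS i' x := by
  refine ⟨fun l hl => hx.1 l (by omega), fun l hl => ?_⟩
  rcases Nat.eq_or_lt_of_le h with rfl | h
  · exact hx.2 l hl
  · rw [hx.1 l (by omega)]

theorem HS_neg {i i' : ℕ} (h : i < i') {x : Ve K} (hx : HS i x) : HS i' (-x) := by
  refine ⟨fun l hl => ?_, fun l hl => ?_⟩ <;> simp [hx.1 l (by omega)]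

theorem HH1_mono {i i' : ℕ} (h : i ≤ i') {l : List (Ve K)} (hl : HH1 i l) : HH1 i' l := by
  obtain ⟨σ, hσ, h1⟩ := hl
  exact ⟨σ, hσ, fun x hx => ⟨(h1 x hx).1, HS_mono h (h1 x hx).2⟩⟩

theorem HH1_neg {i i' : ℕ} (h : i < i') {l : List (Ve K)} (hl : HH1 i l) : HH1 i' (l.map fun x => -x) := by
  obtain ⟨σ, hσ, h1⟩ := hl
  refine ⟨-σ, fun l => ?_, fun x hx => ?_⟩
  · rcases hσ l with h | h <;> simp [h]
  · simp only [List.mem_map] at hx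
    obtain ⟨y, hy, rfl⟩ := hx
    exact ⟨by simpa [Fc] using (h1 y hy).1, HS_neg h (h1 y hy).2⟩

theorem HH1_cons {i : ℕ} (hi : i < K) {l : List (Ve K)} (hl : HH1 i l) : HH1 i (bas i :: l) := by
  obtain ⟨σ, hσ, h1⟩ := hl
  refine ⟨fun k => if k.val = i then 1 else σ k, fun k => ?_, fun x hx => ?_⟩
  · by_cases hk : k.val = i
    · simp [hk]
    · simpa [hk] using hσ k
  · rcases List.mem_cons.1 hx with rfl | hx
    · refine ⟨⟨fun k => ?_, ?_⟩, fun k hk => ?_, fun k hk => ?_⟩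
      · simp only [bas]; split_ifs <;> simp
      · rw [Finset.sum_eq_single ⟨i, hi⟩]
        · simp [bas]
        · intro b _ hb
          have : b.val ≠ i := fun h => hb (Fin.ext h)
          simp [bas, this]
        · simp
      · simp [bas]; omega
      · simp [bas, hk]
    · have h2 := h1 x hx
      have e : ∀ k : Fin K, (if k.val = i then 1 else σ k) * x k = σ k * x k := by
        intro k
        split_ifs with hk
        · have a1 := h2.1.1 k
          have a2 := h2.2.2 k hk
          rcases hσ k with h | h
          · rw [h]
          · rw [h] at a1 ⊢; linarith
        · rfl
      refine ⟨⟨fun k => ?_, (Finset.sum_congr rfl fun k _ => e k).trans h2.1.2⟩, h2.2⟩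
      have := h2.1.1 k
      rw [← e k] at this; exact this

def SS (n i j : ℕ) (l : List (Pt K)) : Prop :=
  l.length = n ∧ HH1 i (l.map Prod.fst) ∧ HH1 j (l.map Prod.snd)

abbrev W (n i j : ℕ) : AddSubgroup (Ch (Pt K)) := Su (SS n i j)

theorem W_mono {n i j i' j' : ℕ} (hi : i ≤ i') (hj : j ≤ j') {x : Ch (Pt K)} (hx : x ∈ W n i j) : x ∈ W n i' j' :=
  Su_mono (fun _ hl => ⟨hl.1, HH1_mono hi hl.2.1, HH1_mono hj hl.2.2⟩) hx

theorem W_t1 {n i j i' j' : ℕ} (hi : i < i') (hj : j ≤ j') {x : Ch (Pt K)} (hx : x ∈ W n i j) : oC.t1 x ∈ W n i' j' := by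
  refine Su_map _ oC.t1 (fun l hl => ?_) hx
  rw [oC_t1, act_of]
  refine of_Su ⟨by simp [hl.1], ?_, ?_⟩
  · have := HH1_neg hi hl.2.1
    simpa [Function.comp_def, G1_apply] using this
  · have := HH1_mono hj hl.2.2
    simpa [Function.comp_def, G1_apply] using this

theorem W_t2 {n i j i' j' : ℕ} (hi : i ≤ i') (hj : j < j') {x : Ch (Pt K)} (hx : x ∈ W n i j) : oC.t2 x ∈ W n i' j' := by
  refine Su_map _ oC.t2 (fun l hl => ?_) hx
  rw [oC_t2, act_of]
  refine of_Su ⟨by simp [hl.1], ?_, ?_⟩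
  · have := HH1_mono hi hl.2.1
    simpa [Function.comp_def, G2_apply] using this
  · have := HH1_neg hj hl.2.2
    simpa [Function.comp_def, G2_apply] using this

theorem W_s {n i j : ℕ} {x : Ch (Pt K)} (hx : x ∈ W n i j) : oC.s x ∈ W n j i := by
  refine Su_map _ oC.s (fun l hl => ?_) hx
  rw [oC_s, act_of]
  refine of_Su ⟨by simp [hl.1], ?_, ?_⟩
  · simpa [Function.comp_def, Gs_apply] using hl.2.2
  · simpa [Function.comp_def, Gs_apply] using hl.2.1

theorem W_cone {n i j : ℕ} (hi : i < K) (hj : j < K) {x : Ch (Pt K)} (hx : x ∈ W n i j) :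
    cone (bas i, bas j) x ∈ W (n+1) i j := by
  refine Su_map _ (cone _) (fun l hl => ?_) hx
  rw [cone_of]
  refine of_Su ⟨by simp [hl.1], ?_, ?_⟩
  · simpa using HH1_cons hi hl.2.1
  · simpa using HH1_cons hj hl.2.2

theorem CC_W {m D : ℕ} (h : ∀ y : Gen, y.ok m → y.dim < D → th K y ∈ W (y.dim+1) (ptx y) (pty y))
    (i j : ℕ) (hi : i ≤ m) (hj : j ≤ m) (hd : i + j < D) : CC oC (th K) i j ∈ W (i+j+1) i j := by
  unfold CC
  split_ifs with h4 h5 h6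
  · exact h (.c i j) ⟨h4, hi⟩ hd
  · have := W_s (h (.c j i) ⟨h5, hj⟩ (by simp only [Gen.dim]; omega))
    simp only [Gen.dim, ptx, pty, add_comm j i] at this
    exact AddSubgroup.zsmul_mem _ this _
  · obtain rfl : j = 0 := by omega
    subst h6
    exact h (.e 0) (Nat.zero_le _) hd
  · obtain rfl : i = j := by omega
    have := h (.d i (i-1)) ⟨by omega, hi⟩ (by simp only [Gen.dim]; omega)
    simp only [Gen.dim, ptx, pty] at this
    rw [show i + (i-1) + 1 + 1 = i + i + 1 by omega] at this
    exact add_mem this (AddSubgroup.zsmul_mem _ (W_s this) _)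

theorem th_W {m : ℕ} (hm : m < K) (x : Gen) (hx : x.ok m) : th K x ∈ W (x.dim+1) (ptx x) (pty x) := by
  induction hn : x.dim using Nat.strong_induction_on generalizing x with
  | _ n ih =>
    have IH : ∀ y : Gen, y.ok m → y.dim < n → th K y ∈ W (y.dim+1) (ptx y) (pty y) :=
      fun y hy hd => ih y.dim hd y hy rfl
    have IC := CC_W IH
    have ID : ∀ i k, i ≤ m → i + k + 1 < n → DD (th K) i k ∈ W (K := K) (i+k+2) i i := by
      intro i k hi hd
      unfold DD
      split_ifs with h
      · exact IH (.d i k) ⟨h, hi⟩ hd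
      · exact zero_mem _
    rw [th_eq]
    rcases x with ⟨i, j⟩ | ⟨i, k⟩ | i
    · simp only [Gen.ok, Gen.dim] at hx hn
      refine W_cone (by simp only [ptx]; omega) (by simp only [pty]; omega) ?_
      simp only [ba, BG, ptx, pty, if_pos hx.1]
      unfold bc
      refine add_mem ?_ (AddSubgroup.zsmul_mem _ ?_ _)
      · split_ifs with h0
        · exact zero_mem _
        · have := IC (i-1) j (by omega) (by omega) (by omega)
          rw [show i - 1 + j + 1 = n by omega] at this
          exact add_mem (W_mono (by omega) le_rfl this) (AddSubgroup.zsmul_mem _ (W_t1 (by omega) le_rfl this) _)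
      · split_ifs with h0
        · exact zero_mem _
        · have := IC i (j-1) (by omega) (by omega) (by omega)
          rw [show i + (j - 1) + 1 = n by omega] at this
          exact add_mem (W_mono le_rfl (by omega) this) (AddSubgroup.zsmul_mem _ (W_t2 le_rfl (by omega) this) _)
    · simp only [Gen.ok, Gen.dim] at hx hn
      refine W_cone (by simp only [ptx]; omega) (by simp only [pty]; omega) ?_
      simp only [ba, BG, ptx, pty, if_pos hx.1]
      unfold bd
      refine sub_mem (sub_mem (add_mem ?_ (AddSubgroup.zsmul_mem _ ?_ _)) ?_) (AddSubgroup.zsmul_mem _ ?_ _)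
      · have := IC k i (by omega) (by omega) (by omega)
        rw [show k + i + 1 = n by omega] at this
        exact W_mono (by omega) le_rfl this
      · have := IC i k (by omega) (by omega) (by omega)
        rw [show i + k + 1 = n by omega] at this
        exact W_t2 le_rfl (by omega) this
      · split_ifs with h0
        · have := IH (.e i) hx.2 (by simp only [Gen.dim]; omega)
          simp only [Gen.dim, ptx, pty] at this
          rwa [show i + 1 = n by omega] at this
        · have := ID i (k-1) (by omega) (by omega)
          rw [show i + (k-1) + 2 = n by omega] at this
          exact add_mem this (AddSubgroup.zsmul_mem _ (W_s this) _)
      · have := ID (i-1) k (by omega) (by omega)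
        rw [show i - 1 + k + 2 = n by omega] at this
        refine add_mem (W_mono (by omega) (by omega) this) (AddSubgroup.zsmul_mem _ ?_ _)
        exact W_t1 (show i - 1 < i by omega) le_rfl (W_t2 le_rfl (show i - 1 < i by omega) (W_s this))
    · simp only [Gen.ok, Gen.dim] at hx hn
      refine W_cone (by simp only [ptx]; omega) (by simp only [pty]; omega) ?_
      subst hn
      simp only [ptx, pty]
      rcases i with _ | i
      · rw [ba_e0]
        exact of_Su ⟨rfl, ⟨fun _ => 1, fun _ => Or.inl rfl, by simp⟩, ⟨fun _ => 1, fun _ => Or.inl rfl, by simp⟩⟩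
      · simp only [ba, BG, be, Nat.add_sub_cancel, if_neg (Nat.succ_ne_zero i)]
        have := IH (.e i) (by simp only [Gen.ok]; omega) (by simp only [Gen.dim]; omega)
        simp only [Gen.dim, ptx, pty] at this
        refine add_mem (W_mono (by omega) (by omega) this) (AddSubgroup.zsmul_mem _ ?_ _)
        exact W_t1 (show i < i+1 by omega) le_rfl (W_t2 le_rfl (show i < i+1 by omega) this)

def Dg (n : ℕ) (l : List (Pt K)) : Prop := Sm n {P | P.1 = P.2} 2 l
def Dg' (n : ℕ) (l : List (Pt K)) : Prop := l.length = n ∧ ∀ P ∈ l, P.1 = P.2 ∧ ‖P.1‖ ≤ 1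

theorem bas_norm (i : ℕ) : ‖(bas i : Ve K)‖ ≤ 1 := by
  rw [pi_norm_le_iff_of_nonneg (by norm_num)]
  intro l; simp only [bas]; split_ifs <;> simp

theorem th_Dg (i : ℕ) : th K (.e i) ∈ Su (Dg' (i+1)) := by
  have hc : ∀ n i (x : Ch (Pt K)), x ∈ Su (Dg' n) → cone (bas i, bas i) x ∈ Su (Dg' (n+1)) := by
    intro n i x hx
    refine Su_map _ (cone _) (fun l hl => ?_) hx
    rw [cone_of]
    refine of_Su ⟨by simp [hl.1], fun P hP => ?_⟩
    rcases List.mem_cons.1 hP with rfl | hP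
    · exact ⟨rfl, bas_norm i⟩
    · exact hl.2 P hP
  induction i with
  | zero =>
    rw [th_eq, ba_e0]
    exact hc _ _ _ (of_Su ⟨rfl, by simp⟩)
  | succ i ih =>
    rw [th_es]
    refine hc _ _ _ (add_mem ih (AddSubgroup.zsmul_mem _ ?_ _))
    refine Su_map _ (oC.t1.comp oC.t2) (fun l hl => ?_) ih
    rw [AddMonoidHom.comp_apply, oC_t1, oC_t2, act_of, act_of]
    refine of_Su ⟨by simp [hl.1], fun P hP => ?_⟩
    simp only [List.map_map, List.mem_map, Function.comp_apply, G1_apply, G2_apply] at hP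
    obtain ⟨Q, hQ, rfl⟩ := hP
    have := hl.2 Q hQ
    simp [← this.1, this.2]

theorem Dg'_Dg {n : ℕ} {l : List (Pt K)} (h : Dg' n l) : Dg n l := by
  refine ⟨h.1, fun P hP => (h.2 P hP).1, fun P hP Q hQ => ?_⟩
  have h1 := h.2 P hP
  have h2 := h.2 Q hQ
  have h3 : ‖P.2‖ ≤ 1 := h1.1 ▸ h1.2
  have h4 : ‖Q.2‖ ≤ 1 := h2.1 ▸ h2.2
  rw [Prod.dist_eq, dist_eq_norm, dist_eq_norm]
  apply max_le
  · linarith [norm_sub_le P.1 Q.1]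
  · linarith [norm_sub_le P.2 Q.2]

theorem Sdi_Dg (M i : ℕ) : Sdi M (th K (.e i)) ∈ Su (fun l => l.length = i+1 ∧ ∀ P ∈ l, P.1 = P.2) := by
  have hS : Convex ℝ {P : Pt K | P.1 = P.2} := by
    intro P hP Q hQ a b _ _ _
    simp only [Set.mem_ofPred_eq] at *
    simp [hP, hQ]
  have := Sdi_Sm (L := i+1) le_rfl (by omega) _ hS M (by norm_num : (0:ℝ) ≤ 2)
    (Su_mono (fun l hl => Dg'_Dg hl) (th_Dg (K := K) i))
  exact Su_mono (fun l hl => ⟨hl.1, hl.2.1⟩) this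

end geo
end
end TRP


namespace TRP
noncomputable section
open D4
set_option linter.unusedSimpArgs false

section lab
variable {K : ℕ}

def XX : Set (Pt K) := {P | ∑ l, |P.1 l| = 1 ∧ ∑ l, |P.2 l| = 1}

theorem G1_XX {P : Pt K} : G1 P ∈ XX ↔ P ∈ XX := by simp [XX, G1_apply]
theorem G2_XX {P : Pt K} : G2 P ∈ XX ↔ P ∈ XX := by simp [XX, G2_apply]
theorem Gs_XX {P : Pt K} : Gs P ∈ XX ↔ P ∈ XX := by simp [XX, Gs_apply, and_comm]

theorem Fc_abs {σ x : Ve K} (hσ : sgn σ) (hx : x ∈ Fc σ) (l) : |x l| = σ l * x l := by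
  have := hx.1 l
  rcases hσ l with h | h
  · rw [h] at this ⊢; rw [one_mul] at *; exact abs_of_nonneg this
  · rw [h] at this ⊢; rw [abs_of_nonpos (by linarith)]; ring

theorem Fc_sum {σ x : Ve K} (hσ : sgn σ) (hx : x ∈ Fc σ) : ∑ l, |x l| = 1 := by
  rw [← hx.2]; exact Finset.sum_congr rfl fun l _ => Fc_abs hσ hx l

theorem norm_le_of_sum {x : Ve K} (h : ∑ l, |x l| = 1) : ‖x‖ ≤ 1 := by
  rw [pi_norm_le_iff_of_nonneg (by norm_num)]
  intro l
  rw [← h, Real.norm_eq_abs]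
  exact Finset.single_le_sum (f := fun l => |x l|) (fun _ _ => abs_nonneg _) (Finset.mem_univ l)

theorem XX_dist {P Q : Pt K} (h1 : P ∈ XX) (h2 : Q ∈ XX) : dist P Q ≤ 2 := by
  have a1 := norm_le_of_sum h1.1
  have a2 := norm_le_of_sum h1.2
  have a3 := norm_le_of_sum h2.1
  have a4 := norm_le_of_sum h2.2
  rw [Prod.dist_eq, dist_eq_norm, dist_eq_norm]
  apply max_le
  · linarith [norm_sub_le P.1 Q.1]
  · linarith [norm_sub_le P.2 Q.2]

theorem th_Sdi {m : ℕ} (hm : m < K) (x : Gen) (hx : x.ok m) (M : ℕ) {L : ℕ} (hL : x.dim + 1 ≤ L) :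
    Sdi M (th K x) ∈ Su (Sm (x.dim+1) XX ((1 - 1 / (L : ℝ))^M * 2)) := by
  refine Su_map _ (Sdi M) (fun l hl => ?_) (th_W hm x hx)
  obtain ⟨h1, ⟨σ, hσ, h2⟩, ⟨τ, hτ, h3⟩⟩ := hl
  have hS : Convex ℝ (Fc σ ×ˢ Fc τ) := (convex_Fc σ).prod (convex_Fc τ)
  have hX : Fc σ ×ˢ Fc τ ⊆ XX := fun P hP => ⟨Fc_sum hσ hP.1, Fc_sum hτ hP.2⟩
  have hl : ∀ P ∈ l, P ∈ Fc σ ×ˢ Fc τ := fun P hP =>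
    ⟨(h2 P.1 (List.mem_map_of_mem hP)).1, (h3 P.2 (List.mem_map_of_mem hP)).1⟩
  have := Sdi_Sm hL (by omega) _ hS M (by norm_num : (0:ℝ) ≤ 2)
    (of_Su (Q := Sm (x.dim+1) (Fc σ ×ˢ Fc τ) 2) ⟨h1, hl, fun P hP Q hQ => XX_dist (hX (hl P hP)) (hX (hl Q hQ))⟩)
  exact Su_mono (fun l hl => ⟨hl.1, fun P hP => hX (hl.2.1 P hP), hl.2.2⟩) this

structure Lab (p q : ℕ) (lam : Pt K → Idx × Bool) : Prop where
  mem : ∀ P ∈ XX, (lam P).1 ∈ Jset p q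
  g1 : ∀ P ∈ XX, lam (G1 P) = f1 (lam P)
  g2 : ∀ P ∈ XX, lam (G2 P) = f2 (lam P)
  gs : ∀ P ∈ XX, lam (Gs P) = fs (lam P)
  dg : ∀ P ∈ XX, P.1 = P.2 → lam P = (Idx.g 0, true)
  dl : ∃ δ > 0, ∀ P ∈ XX, ∀ Q ∈ XX, dist P Q ≤ δ → (lam P).1 = (lam Q).1 → lam P = lam Q

open Classical in
def lb (lam : Pt K → Idx × Bool) : Ch (Pt K) →+ Lam Idx :=
  FreeAbelianGroup.lift (fun l => if ∀ P ∈ l, P ∈ XX then mono (l.map lam) else 0)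

open Classical in
theorem lb_of (lam : Pt K → Idx × Bool) (l) :
    lb lam (ofL l) = if ∀ P ∈ l, P ∈ XX then mono (l.map lam) else 0 := FreeAbelianGroup.lift_apply_of _ _

theorem lb_act (lam : Pt K → Idx × Bool) (G : Pt K → Pt K) (φ : Idx × Bool → Idx × Bool)
    (hG : ∀ P, G P ∈ XX ↔ P ∈ XX) (h : ∀ P ∈ XX, lam (G P) = φ (lam P)) (x : Ch (Pt K)) :
    lb lam (act G x) = mp φ (lb lam x) := by
  refine Ch_ext ((lb lam).comp (act G)) (((mp φ : Lam Idx →ₐ[ℤ] Lam Idx) : Lam Idx →+ Lam Idx).comp (lb lam)) (fun l => ?_) x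
  simp only [AddMonoidHom.comp_apply, act_of, lb_of, AddMonoidHom.coe_coe]
  have hiff : (∀ P ∈ l.map G, P ∈ XX) ↔ ∀ P ∈ l, P ∈ XX := by
    rw [List.forall_mem_map]; simp only [hG]
  by_cases hl : ∀ P ∈ l, P ∈ XX
  · rw [if_pos hl, if_pos (hiff.2 hl), mp_mono]
    congr 1
    simpa using fun a b hab => h (a, b) (hl _ hab)
  · rw [if_neg hl, if_neg (fun h => hl (hiff.1 h)), map_zero]

theorem lb_cone (lam : Pt K → Idx × Bool) (P : Pt K) (hP : P ∈ XX) (x : Ch (Pt K)) :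
    lb lam (cone P x) = vv (lam P) * lb lam x := by
  refine Ch_ext ((lb lam).comp (cone P)) ((AddMonoidHom.mulLeft (vv (lam P))).comp (lb lam)) (fun l => ?_) x
  simp only [AddMonoidHom.comp_apply, cone_of, lb_of, AddMonoidHom.coe_mulLeft]
  by_cases hl : ∀ P ∈ l, P ∈ XX
  · rw [if_pos hl, if_pos (by simpa [hP] using hl)]; simp
  · rw [if_neg hl, if_neg (by simpa [hP] using hl), mul_zero]

theorem bo_lb (lam : Pt K → Idx × Bool) {x : Ch (Pt K)} (hx : x ∈ Su (fun l => ∀ P ∈ l, P ∈ XX)) :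
    bo (lb lam x) = lb lam (bdC x) := by
  refine Su_eq (boA.comp (lb lam)) ((lb lam).comp bdC) (fun l hl => ?_) hx
  simp only [AddMonoidHom.comp_apply, boA_apply]
  induction l with
  | nil => simp [lb_of]
  | cons P l ih =>
    have hP : P ∈ XX := hl P (by simp)
    have hl' : ∀ P ∈ l, P ∈ XX := fun Q hQ => hl Q (by simp [hQ])
    rw [← cone_of, lb_cone _ _ hP, bo_v, bdC_cone, map_sub, lb_cone _ _ hP, ih hl']

theorem no_lab {r p : ℕ} (hK : p + 2^r + 1 < K) (lam : Pt K → Idx × Bool) : ¬ Lab p (2^r) lam := by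
  intro h
  obtain ⟨δ, hδ, hd⟩ := h.dl
  set L : ℕ := 2 * (p + 2^r + 1) + 4 with hLdef
  have hL1 : (1:ℝ) < L := by rw [hLdef]; push_cast; have : (0:ℝ) ≤ (p:ℝ) := by positivity
                             have : (0:ℝ) ≤ (2:ℝ)^r := by positivity
                             linarith
  have hL2 : (1:ℝ) / L < 1 := by rw [div_lt_one (by linarith)]; exact hL1
  have hL3 : (0:ℝ) < 1 / L := by positivity
  obtain ⟨M, hM⟩ := exists_pow_lt_of_lt_one (show 0 < δ / 2 by linarith) (show (1 - 1 / (L:ℝ)) < 1 by linarith)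
  have hM' : (1 - 1 / (L:ℝ))^M * 2 ≤ δ := by linarith
  have hS : ∀ x : Gen, x.ok (p + 2^r + 1) → Sdi M (th K x) ∈ Su (Sm (x.dim+1) XX δ) := by
    intro x hx
    have hdim : x.dim + 1 ≤ L := by
      rcases x with ⟨i, j⟩ | ⟨i, j⟩ | i <;> simp only [Gen.ok, Gen.dim] at * <;> omega
    exact Su_mono (fun l hl => ⟨hl.1, hl.2.1, fun u hu v hv => (hl.2.2 u hu v hv).trans hM'⟩) (th_Sdi hK x hx M hdim)
  have e1 : ∀ x : Ch (Pt K), (lb lam).comp (Sdi M) (oC.t1 x) = oL.t1 ((lb lam).comp (Sdi M) x) := fun x => by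
    rw [AddMonoidHom.comp_apply, oC_t1, Sdi_act, lb_act lam G1 f1 (fun _ => G1_XX) h.g1, oL_t1]; rfl
  have e2 : ∀ x : Ch (Pt K), (lb lam).comp (Sdi M) (oC.t2 x) = oL.t2 ((lb lam).comp (Sdi M) x) := fun x => by
    rw [AddMonoidHom.comp_apply, oC_t2, Sdi_act, lb_act lam G2 f2 (fun _ => G2_XX) h.g2, oL_t2]; rfl
  have e3 : ∀ x : Ch (Pt K), (lb lam).comp (Sdi M) (oC.s x) = oL.s ((lb lam).comp (Sdi M) x) := fun x => by
    rw [AddMonoidHom.comp_apply, oC_s, Sdi_act, lb_act lam Gs fs (fun _ => Gs_XX) h.gs, oL_s]; rfl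
  refine no_sys (r := r) (p := p) (φ := fun x => (lb lam).comp (Sdi M) (th K x)) ⟨?_, ?_, ?_, ?_⟩
  · have hS0 : ∀ M, Sdi M (ofL [((bas 0 : Ve K), (bas 0 : Ve K))]) = ofL [(bas 0, bas 0)] := by
      intro M
      induction M with
      | zero => rfl
      | succ M ih =>
        rw [Sdi, AddMonoidHom.comp_apply, Sd_ne _ (by simp)]
        simp only [bdC_cons, bdC_nil, map_zero, sub_zero, Sd_nil, cone_of]
        rw [show bary [((bas 0 : Ve K), (bas 0 : Ve K))] = (bas 0, bas 0) by simp [bary]]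
        exact ih
    have hX : ((bas 0 : Ve K), (bas 0 : Ve K)) ∈ XX := by
      have : ∑ l, |(bas 0 : Ve K) l| = 1 := by
        rw [Finset.sum_eq_single ⟨0, by omega⟩]
        · simp [bas]
        · intro b _ hb
          have : b.val ≠ 0 := fun h => hb (Fin.ext h)
          simp [bas, this]
        · simp
      exact ⟨this, this⟩
    show (lb lam).comp (Sdi M) (th K (.e 0)) = _
    rw [AddMonoidHom.comp_apply, th_e0, hS0, lb_of, if_pos (by simpa using hX)]
    simp [h.dg _ hX rfl]
  · intro i
    have := Su_eq (lb lam) 0 (fun l hl => ?_) (Sdi_Dg (K := K) M (i+1))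
    · simpa using this
    · rw [lb_of]
      split_ifs with hX
      · obtain ⟨P, Q, l', rfl⟩ : ∃ P Q l', l = P :: Q :: l' := by
          rcases l with _ | ⟨P, _ | ⟨Q, l'⟩⟩
          · simp at hl
          · simp at hl
          · exact ⟨_, _, _, rfl⟩
        refine mono_dup _ ?_
        rw [List.map_cons, List.map_cons, h.dg P (hX P (by simp)) (hl.2 P (by simp)),
          h.dg Q (hX Q (by simp)) (hl.2 Q (by simp))]
        simp
      · rfl
  · intro x hx h0
    show bo (lb lam (Sdi M (th K x))) = _
    rw [bo_lb lam (Su_mono (fun l hl => hl.2.1) (hS x hx)), bdC_Sdi, bdC_th x _ hx h0]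
    exact BG_nat (o := oC) (o' := oL) ((lb lam).comp (Sdi M)) e1 e2 e3 (th K) x
  · intro x hx
    refine Su_map _ (lb lam) (fun l hl => ?_) (hS x hx)
    rw [lb_of, if_pos hl.2.1]
    have := mem_YY (J := Jset p (2^r)) (l := l.map lam) ⟨?_, ?_⟩
    · rwa [List.length_map, hl.1] at this
    · intro a ha
      obtain ⟨P, hP, rfl⟩ := List.mem_map.1 ha
      exact h.mem P (hl.2.1 P hP)
    · intro a ha b hb hab
      obtain ⟨P, hP, rfl⟩ := List.mem_map.1 ha
      obtain ⟨Q, hQ, rfl⟩ := List.mem_map.1 hb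
      exact hd P (hl.2.1 P hP) Q (hl.2.1 Q hQ) (hl.2.2 P hP Q hQ) hab

end lab
end
end TRP


namespace TRP
noncomputable section
open D4
set_option linter.unusedSimpArgs false

section core
variable {K : ℕ}

theorem XX_compact : IsCompact (XX : Set (Pt K)) := by
  refine Metric.isCompact_of_isClosed_isBounded ?_ ?_
  · refine IsClosed.inter ?_ ?_
    · exact isClosed_eq (by fun_prop) continuous_const
    · exact isClosed_eq (by fun_prop) continuous_const
  · refine (Metric.isBounded_closedBall (x := (0 : Pt K)) (r := 1)).subset fun P hP => ?_
    rw [mem_closedBall_zero_iff]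
    exact norm_prod_le_iff.2 ⟨norm_le_of_sum hP.1, norm_le_of_sum hP.2⟩

def vl (A G : ℕ → Pt K → ℝ) : Idx → Pt K → ℝ
  | .a l, P => A l P
  | .b l, P => A l (Gs P)
  | .g j, P => G j P

def tie (P : Pt K) : Prop := WellOrderingRel ({P.1, -P.1} : Set (Ve K)) ({P.2, -P.2} : Set (Ve K))

theorem tie_G1 (P : Pt K) : tie (G1 P) ↔ tie P := by simp [tie, G1_apply, Set.pair_comm]
theorem tie_G2 (P : Pt K) : tie (G2 P) ↔ tie P := by simp [tie, G2_apply, Set.pair_comm]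
theorem tie_Gs (P : Pt K) (h : P.1 ≠ P.2) (h' : -P.1 ≠ P.2) : tie (Gs P) ↔ ¬ tie P := by
  simp only [tie, Gs_apply]
  have hne : ({P.1, -P.1} : Set (Ve K)) ≠ ({P.2, -P.2} : Set (Ve K)) := by
    intro e
    have : P.1 ∈ ({P.2, -P.2} : Set (Ve K)) := by rw [← e]; simp
    rcases this with h1 | h1
    · exact h h1
    · exact h' (by rw [h1]; simp)
  constructor
  · intro h1 h2; exact asymm h1 h2
  · intro h1
    rcases trichotomous_of (WellOrderingRel) ({P.1, -P.1} : Set (Ve K)) ({P.2, -P.2} : Set (Ve K)) with h2 | h2 | h2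
    · exact absurd h2 h1
    · exact absurd h2 hne
    · exact h2

variable (A G : ℕ → Pt K → ℝ) (p q : ℕ) (ε : ℝ)

def JS (P : Pt K) : Set ℕ := {j | j < 2*q+1 ∧ ε ≤ |G j P|}
def LS (P : Pt K) : Set ℕ := {l | l < p ∧ (ε ≤ |A l P| ∨ ε ≤ |A l (Gs P)|)}
def cnd (P : Pt K) (l : ℕ) : Prop := ε ≤ |A l P| ∧ (¬ ε ≤ |A l (Gs P)| ∨ tie P)

open Classical in
def ix (P : Pt K) : Idx :=
  if (JS G q ε P).Nonempty then Idx.g (sInf (JS G q ε P)) else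
    if cnd A ε P (sInf (LS A p ε P)) then Idx.a (sInf (LS A p ε P)) else Idx.b (sInf (LS A p ε P))

def ps (v : ℝ) : Bool := decide (0 < v)

def lm (P : Pt K) : Idx × Bool := (ix A G p q ε P, ps (vl A G (ix A G p q ε P) P))

variable {A G p q ε}

theorem ix_spec (hε : ∀ P ∈ XX, ∃ i ∈ Jset p q, ε ≤ |vl A G i P|) (P : Pt K) (hP : P ∈ XX) :
    ix A G p q ε P ∈ Jset p q ∧ ε ≤ |vl A G (ix A G p q ε P) P| := by
  unfold ix
  split_ifs with h1 h2
  · have := Nat.sInf_mem h1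
    exact ⟨mem_Jg.2 this.1, this.2⟩
  all_goals
    have hL : (LS A p ε P).Nonempty := by
      obtain ⟨i, hi, h⟩ := hε P hP
      rcases i with l | l | j
      · exact ⟨l, mem_Ja.1 hi, Or.inl h⟩
      · exact ⟨l, mem_Jb.1 hi, Or.inr h⟩
      · exact absurd ⟨j, mem_Jg.1 hi, h⟩ h1
    have := Nat.sInf_mem hL
  · exact ⟨mem_Ja.2 this.1, h2.1⟩
  · refine ⟨mem_Jb.2 this.1, ?_⟩
    show ε ≤ |A _ (Gs P)|
    by_contra h3
    exact h2 ⟨this.2.resolve_right h3, Or.inl h3⟩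

theorem dec_neg {v ε : ℝ} (hε : 0 < ε) (h : ε ≤ |v|) : ps (-v) = !ps v := by
  unfold ps
  have : v ≠ 0 := by rintro rfl; simp at h; linarith
  rcases lt_or_gt_of_ne this with h1 | h1
  · simp [h1, h1.le]
  · simp [h1, h1.le]

theorem core {r : ℕ} (hK : p + 2^r + 1 < K) (A G : ℕ → Pt K → ℝ)
    (hA : ∀ l < p, ContinuousOn (A l) XX) (hG : ∀ j < 2*2^r+1, ContinuousOn (G j) XX)
    (A1 : ∀ l, ∀ P ∈ XX, A l (G1 P) = - A l P) (A2 : ∀ l, ∀ P ∈ XX, A l (G2 P) = A l P)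
    (g1 : ∀ j, ∀ P ∈ XX, G j (G1 P) = - G j P) (g2 : ∀ j, ∀ P ∈ XX, G j (G2 P) = - G j P)
    (gs : ∀ j, ∀ P ∈ XX, G j (Gs P) = G j P)
    (hd : ∀ P ∈ XX, P.1 = P.2 → 0 < G 0 P) :
    ∃ P ∈ XX, (∀ l < p, A l P = 0 ∧ A l (Gs P) = 0) ∧ ∀ j < 2*2^r+1, G j P = 0 := by
  by_contra hcon
  set q := 2^r with hq
  have hGs : ContinuousOn (fun P : Pt K => Gs P) XX := by
    have : Continuous (fun P : Pt K => (P.2, P.1)) := by fun_prop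
    exact this.continuousOn
  have hv : ∀ i ∈ Jset p q, ContinuousOn (vl A G i) XX := by
    rintro (l | l | j) hi
    · exact hA l (mem_Ja.1 hi)
    · exact (hA l (mem_Jb.1 hi)).comp hGs fun P hP => Gs_XX.2 hP
    · exact hG j (mem_Jg.1 hi)
  let Φ : Pt K → ({i // i ∈ Jset p q} → ℝ) := fun P i => vl A G i.1 P
  have hΦ : ContinuousOn Φ XX := continuousOn_pi.2 fun i => hv i.1 i.2
  obtain ⟨c, hc, hcX⟩ := XX_compact.exists_forall_le' (a := (0:ℝ)) hΦ.norm (fun P hP => by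
    rw [norm_pos_iff]
    intro h0
    have h0' : ∀ i ∈ Jset p q, vl A G i P = 0 := fun i hi => congrFun h0 ⟨i, hi⟩
    exact hcon ⟨P, hP, fun l hl => ⟨h0' (.a l) (mem_Ja.2 hl), h0' (.b l) (mem_Jb.2 hl)⟩,
      fun j hj => h0' (.g j) (mem_Jg.2 hj)⟩)
  have hdc : IsCompact (XX ∩ {P : Pt K | P.1 = P.2}) :=
    XX_compact.inter_right (isClosed_eq continuous_fst continuous_snd)
  obtain ⟨c', hc', hcX'⟩ := hdc.exists_forall_le' (a := (0:ℝ)) ((hG 0 (by omega)).mono Set.inter_subset_left)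
    (fun P hP => hd P hP.1 hP.2)
  obtain ⟨ε, h0, he1, he2⟩ : ∃ ε > 0, ε ≤ c ∧ ε ≤ c' := ⟨min c c', lt_min hc hc', min_le_left _ _, min_le_right _ _⟩
  have hε : ∀ P ∈ XX, ∃ i ∈ Jset p q, ε ≤ |vl A G i P| := by
    intro P hP
    by_contra hlt
    push Not at hlt
    have : ‖Φ P‖ < ε := (pi_norm_lt_iff h0).2 fun i => hlt i.1 i.2
    linarith [hcX P hP]
  have hdg : ∀ P ∈ XX, P.1 = P.2 → ε ≤ G 0 P := fun P hP h => he2.trans (hcX' P ⟨hP, h⟩)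
  have hspec := ix_spec hε
  have a1 : ∀ l, ∀ P ∈ XX, |A l (G1 P)| = |A l P| := fun l P hP => by rw [A1 l P hP, abs_neg]
  have a2 : ∀ l, ∀ P ∈ XX, |A l (G2 P)| = |A l P| := fun l P hP => by rw [A2 l P hP]
  have s1 : ∀ l, ∀ P ∈ XX, A l (Gs (G1 P)) = A l (Gs P) := fun l P hP => A2 l (Gs P) (Gs_XX.2 hP)
  have s2 : ∀ l, ∀ P ∈ XX, A l (Gs (G2 P)) = - A l (Gs P) := fun l P hP => A1 l (Gs P) (Gs_XX.2 hP)
  have ss : ∀ l, ∀ P : Pt K, A l (Gs (Gs P)) = A l P := fun l P => rfl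
  have i1 : ∀ P ∈ XX, ix A G p q ε (G1 P) = ix A G p q ε P := by
    intro P hP
    have hJ : JS G q ε (G1 P) = JS G q ε P := by simp only [JS, g1 _ P hP, abs_neg]
    have hL : LS A p ε (G1 P) = LS A p ε P := by
      simp only [LS, a1 _ P hP, s1 _ P hP, abs_neg]
    have hC : ∀ l, cnd A ε (G1 P) l = cnd A ε P l := fun l => by
      simp only [cnd, a1 _ P hP, s1 _ P hP, abs_neg, tie_G1]
    unfold ix
    rw [hJ, hL, hC]
  have i2 : ∀ P ∈ XX, ix A G p q ε (G2 P) = ix A G p q ε P := by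
    intro P hP
    have hJ : JS G q ε (G2 P) = JS G q ε P := by simp only [JS, g2 _ P hP, abs_neg]
    have hL : LS A p ε (G2 P) = LS A p ε P := by
      simp only [LS, a2 _ P hP, s2 _ P hP, abs_neg]
    have hC : ∀ l, cnd A ε (G2 P) l = cnd A ε P l := fun l => by
      simp only [cnd, a2 _ P hP, s2 _ P hP, abs_neg, tie_G2]
    unfold ix
    rw [hJ, hL, hC]
  have is : ∀ P ∈ XX, ix A G p q ε (Gs P) = (fs (ix A G p q ε P, true)).1 := by
    intro P hP
    have hJ : JS G q ε (Gs P) = JS G q ε P := by simp only [JS, gs _ P hP]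
    have hL : LS A p ε (Gs P) = LS A p ε P := by
      simp only [LS, ss]
      ext l; simp [or_comm]
    unfold ix
    rw [hJ, hL]
    by_cases h1 : (JS G q ε P).Nonempty
    · rw [if_pos h1, if_pos h1]; rfl
    · rw [if_neg h1, if_neg h1]
      have hne : P.1 ≠ P.2 := fun e => h1 ⟨0, by simp, (hdg P hP e).trans (le_abs_self _)⟩
      have hne' : -P.1 ≠ P.2 := fun e => h1 ⟨0, by simp, by
        have := (hdg (G1 P) (G1_XX.2 hP) e).trans (le_abs_self _)
        rwa [g1 0 P hP, abs_neg] at this⟩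
      have hLn : (LS A p ε P).Nonempty := by
        obtain ⟨i, hi, h⟩ := hε P hP
        rcases i with l | l | j
        · exact ⟨l, mem_Ja.1 hi, Or.inl h⟩
        · exact ⟨l, mem_Jb.1 hi, Or.inr h⟩
        · exact absurd ⟨j, mem_Jg.1 hi, h⟩ h1
      have hm := (Nat.sInf_mem hLn).2
      have hiff : cnd A ε (Gs P) (sInf (LS A p ε P)) ↔ ¬ cnd A ε P (sInf (LS A p ε P)) := by
        simp only [cnd, ss, tie_Gs P hne hne']
        tauto
      by_cases h2 : cnd A ε P (sInf (LS A p ε P))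
      · rw [if_pos h2, if_neg (by rw [hiff]; simpa using h2)]; rfl
      · rw [if_neg h2, if_pos (hiff.2 h2)]; rfl
  refine no_lab (r := r) (p := p) hK (lm A G p q ε) ⟨?_, ?_, ?_, ?_, ?_, ?_⟩
  · exact fun P hP => (hspec P hP).1
  · intro P hP
    have := (hspec P hP).2
    simp only [lm, i1 P hP]
    generalize ix A G p q ε P = i at this
    rcases i with l | l | j <;> simp only [vl, f1] at *
    · rw [A1 l P hP, dec_neg h0 this]
    · rw [s1 l P hP]
    · rw [g1 j P hP, dec_neg h0 this]
  · intro P hP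
    have := (hspec P hP).2
    simp only [lm, i2 P hP]
    generalize ix A G p q ε P = i at this
    rcases i with l | l | j <;> simp only [vl, f2] at *
    · rw [A2 l P hP]
    · rw [s2 l P hP, dec_neg h0 this]
    · rw [g2 j P hP, dec_neg h0 this]
  · intro P hP
    simp only [lm, is P hP]
    generalize ix A G p q ε P = i
    rcases i with l | l | j <;> simp only [vl, fs]
    · rw [ss]
    · rw [gs j P hP]
  · intro P hP e
    have h1 := hdg P hP e
    have hJ : 0 ∈ JS G q ε P := ⟨by omega, h1.trans (le_abs_self _)⟩
    have hJ0 : sInf (JS G q ε P) = 0 := Nat.le_zero.1 (Nat.sInf_le hJ)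
    have hi : ix A G p q ε P = Idx.g 0 := by
      simp only [ix]; rw [if_pos ⟨0, hJ⟩, hJ0]
    simp only [lm, hi, vl]
    rw [ps, decide_eq_true (lt_of_lt_of_le h0 h1)]
  · have hu := XX_compact.uniformContinuousOn_of_continuous hΦ
    rw [Metric.uniformContinuousOn_iff] at hu
    obtain ⟨δ, hδ, hu⟩ := hu ε h0
    refine ⟨δ/2, by linarith, fun P hP Q hQ hPQ hi => ?_⟩
    have h1 := hspec P hP
    have h2 := hspec Q hQ
    have h3 := hu P hP Q hQ (by linarith)
    simp only [lm] at hi ⊢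
    rw [← hi] at h2 ⊢
    have h4 := (dist_pi_lt_iff h0).1 h3 ⟨_, h1.1⟩
    simp only [Φ, Real.dist_eq] at h4
    generalize vl A G (ix A G p q ε P) P = u at *
    generalize vl A G (ix A G p q ε P) Q = w at *
    congr 1
    rw [ps, ps, decide_eq_decide]
    have h5 := abs_lt.1 h4
    constructor
    · intro hu
      by_contra hw
      rw [abs_of_nonpos (by linarith)] at h2
      linarith [h2.2]
    · intro hw
      by_contra hu
      rw [abs_of_nonpos (by linarith)] at h1
      linarith [h1.2]

end core
end
end TRP


namespace TRP
noncomputable section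
set_option linter.unusedSimpArgs false

section app
variable {K : ℕ}

def ww (S : Finset (Fin K)) (x y : Ve K) : ℝ := ∏ i ∈ S, (max (x i) 0 * max (y i) 0)
def aa (C : Finset (Finset (Fin K))) (x y : Ve K) : ℝ := ∑ S ∈ C, ww S x y

theorem ww_nonneg (S : Finset (Fin K)) (x y : Ve K) : 0 ≤ ww S x y :=
  Finset.prod_nonneg fun i _ => by positivity
theorem aa_nonneg (C : Finset (Finset (Fin K))) (x y : Ve K) : 0 ≤ aa C x y :=
  Finset.sum_nonneg fun S _ => ww_nonneg S x y
theorem aa_comm (C : Finset (Finset (Fin K))) (x y : Ve K) : aa C x y = aa C y x := by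
  simp only [aa, ww, mul_comm]
theorem aa_cont (C : Finset (Finset (Fin K))) : Continuous (fun P : Pt K => aa C P.1 P.2) := by
  unfold aa ww; fun_prop

def su (x : Ve K) : Finset (Fin K) := Finset.univ.filter fun i => 0 < x i

theorem ww_pos {S : Finset (Fin K)} {x y : Ve K} : 0 < ww S x y ↔ S ⊆ su x ∩ su y := by
  constructor
  · intro h i hi
    have h1 := (Finset.prod_ne_zero_iff.1 h.ne') i hi
    simp only [su, Finset.mem_inter, Finset.mem_filter, Finset.mem_univ, true_and]
    by_contra h2
    apply h1
    rcases not_and_or.1 h2 with h3 | h3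
    · rw [max_eq_right (not_lt.1 h3), zero_mul]
    · rw [max_eq_right (not_lt.1 h3), mul_zero]
  · intro h
    refine Finset.prod_pos fun i hi => ?_
    have := h hi
    simp only [su, Finset.mem_inter, Finset.mem_filter, Finset.mem_univ, true_and] at this
    exact mul_pos (lt_max_of_lt_left this.1) (lt_max_of_lt_left this.2)

theorem aa_zero {C : Finset (Finset (Fin K))} {x y : Ve K} (h : aa C x y = 0) :
    ∀ S ∈ C, ¬ S ⊆ su x ∩ su y := by
  intro S hS hsub
  have h1 := (Finset.sum_eq_zero_iff_of_nonneg fun S _ => ww_nonneg S x y).1 h S hS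
  exact (ww_pos.2 hsub).ne' h1

theorem aa_pos {C : Finset (Finset (Fin K))} {x y : Ve K} (h : aa C x y ≠ 0) :
    ∃ S ∈ C, S ⊆ su x ∩ su y := by
  obtain ⟨S, hS, h1⟩ := Finset.exists_ne_zero_of_sum_ne_zero h
  exact ⟨S, hS, ww_pos.1 (lt_of_le_of_ne (ww_nonneg S x y) (Ne.symm h1))⟩

theorem su_disj (x : Ve K) : Disjoint (su x) (su (-x)) := by
  rw [Finset.disjoint_left]
  intro i h1 h2
  simp [su] at h1 h2
  linarith

theorem aa_neg_self {C : Finset (Finset (Fin K))} (hC : ∀ S ∈ C, S.Nonempty) (x : Ve K) : aa C x (-x) = 0 := by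
  by_contra h
  obtain ⟨S, hS, h1⟩ := aa_pos h
  rw [Finset.disjoint_iff_inter_eq_empty.1 (su_disj x)] at h1
  exact (hC S hS).ne_empty (Finset.subset_empty.1 h1)

/-- four equal values must vanish -/
theorem four {C : Finset (Finset (Fin K))} (hC : ∀ S ∈ C, S.Nonempty)
    (hcard : ∀ D ⊆ C, (∀ A ∈ D, ∀ B ∈ D, A ≠ B → Disjoint A B) → D.card < 4) (x y : Ve K)
    (h1 : aa C x y + aa C x (-y) - aa C (-x) y - aa C (-x) (-y) = 0)
    (h2 : aa C y x + aa C y (-x) - aa C (-y) x - aa C (-y) (-x) = 0)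
    (h3 : aa C x y - aa C x (-y) - aa C (-x) y + aa C (-x) (-y) = 0) :
    aa C x y = 0 ∧ aa C x (-y) = 0 ∧ aa C (-x) y = 0 ∧ aa C (-x) (-y) = 0 := by
  rw [aa_comm C y x, aa_comm C y (-x), aa_comm C (-y) x, aa_comm C (-y) (-x)] at h2
  have e1 : aa C x (-y) = aa C x y := by linarith
  have e2 : aa C (-x) y = aa C x y := by linarith
  have e3 : aa C (-x) (-y) = aa C x y := by linarith
  suffices aa C x y = 0 by rw [e1, e2, e3]; simp [this]
  by_contra h0
  obtain ⟨S1, m1, t1⟩ := aa_pos h0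
  obtain ⟨S2, m2, t2⟩ := aa_pos (e1.trans_ne h0)
  obtain ⟨S3, m3, t3⟩ := aa_pos (e2.trans_ne h0)
  obtain ⟨S4, m4, t4⟩ := aa_pos (e3.trans_ne h0)
  have dx := su_disj x
  have dy := su_disj y
  rw [Finset.subset_inter_iff] at t1 t2 t3 t4
  have d12 : Disjoint S1 S2 := Disjoint.mono t1.2 t2.2 dy
  have d13 : Disjoint S1 S3 := Disjoint.mono t1.1 t3.1 dx
  have d14 : Disjoint S1 S4 := Disjoint.mono t1.1 t4.1 dx
  have d23 : Disjoint S2 S3 := Disjoint.mono t2.1 t3.1 dx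
  have d24 : Disjoint S2 S4 := Disjoint.mono t2.1 t4.1 dx
  have d34 : Disjoint S3 S4 := Disjoint.mono t3.2 t4.2 dy
  have ne : ∀ {S T : Finset (Fin K)}, S ∈ C → Disjoint S T → S ≠ T := by
    rintro S T hS hd rfl
    exact (hC S hS).ne_empty (disjoint_self.1 hd)
  have := hcard {S1, S2, S3, S4} (by
      intro S hS
      simp only [Finset.mem_insert, Finset.mem_singleton] at hS
      rcases hS with rfl | rfl | rfl | rfl <;> assumption)
    (by
      intro S hS T hT hST
      simp only [Finset.mem_insert, Finset.mem_singleton] at hS hT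
      rcases hS with rfl | rfl | rfl | rfl <;> rcases hT with rfl | rfl | rfl | rfl <;>
        first | exact absurd rfl hST | assumption | (apply Disjoint.symm; assumption))
  rw [Finset.card_insert_of_notMem, Finset.card_insert_of_notMem, Finset.card_insert_of_notMem,
    Finset.card_singleton] at this
  · omega
  · simpa using ne m3 d34
  · simpa using ⟨ne m2 d23, ne m2 d24⟩
  · simpa using ⟨ne m1 d12, ne m1 d13, ne m1 d14⟩

/-- twice the positive part -/
def pz (x : Ve K) : Ve K := fun i => 2 * max (x i) 0

theorem pz_cont : Continuous (pz : Ve K → Ve K) := by unfold pz; fun_prop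

theorem pz_simplex {x : Ve K} (h1 : ∑ i, |x i| = 1) (h0 : ∑ i, x i = 0) : pz x ∈ stdSimplex ℝ (Fin K) := by
  refine ⟨fun i => by simp only [pz]; positivity, ?_⟩
  have : ∀ i, pz x i = |x i| + x i := fun i => by
    simp only [pz]
    rcases le_total 0 (x i) with h | h
    · rw [max_eq_left h, abs_of_nonneg h]; ring
    · rw [max_eq_right h, abs_of_nonpos h]; ring
  simp only [this, Finset.sum_add_distrib, h1, h0, add_zero]

theorem pz_face {x : Ve K} (h1 : ∑ i, |x i| = 1) (h0 : ∑ i, x i = 0) : pz x ∈ simplexFace (su x) := by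
  refine ⟨pz_simplex h1 h0, fun i hi => ?_⟩
  simp only [su, Finset.mem_filter, Finset.mem_univ, true_and, not_lt] at hi
  simp [pz, max_eq_right hi]

theorem radon {d : ℕ} (f : Ve K → EuclideanSpace ℝ (Fin d)) {x : Ve K} (h1 : ∑ i, |x i| = 1) (h0 : ∑ i, x i = 0)
    (h : f (pz x) = f (pz (-x))) : IsRadonPair f (su x) (su (-x)) :=
  ⟨su_disj x, f (pz x), ⟨_, pz_face h1 h0, rfl⟩, ⟨pz (-x), pz_face (by simpa using h1) (by simpa using h0), h.symm⟩⟩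

/-- the odd test map -/
def gg {d : ℕ} (φ : Fin d → C(Ve K, ℝ)) (l : ℕ) (x : Ve K) : ℝ :=
  if l = 0 then ∑ i, x i else if h : l - 1 < d then φ ⟨l-1, h⟩ (pz x) - φ ⟨l-1, h⟩ (pz (-x)) else 0

theorem gg_cont {d : ℕ} (φ : Fin d → C(Ve K, ℝ)) (l : ℕ) : Continuous (gg φ l) := by
  unfold gg
  split_ifs with h1 h2
  · fun_prop
  · have := pz_cont (K := K)
    fun_prop
  · fun_prop

theorem gg_neg {d : ℕ} (φ : Fin d → C(Ve K, ℝ)) (l : ℕ) (x : Ve K) : gg φ l (-x) = - gg φ l x := by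
  unfold gg
  split_ifs <;> simp

theorem gg_zero {d : ℕ} {φ : Fin d → C(Ve K, ℝ)} {f : Ve K → EuclideanSpace ℝ (Fin d)}
    (hφ : ∀ k, ∀ x ∈ stdSimplex ℝ (Fin K), φ k x = f x k) {x : Ve K} (h1 : ∑ i, |x i| = 1)
    (h : ∀ l < d + 1, gg φ l x = 0) : IsRadonPair f (su x) (su (-x)) := by
  have h0 : ∑ i, x i = 0 := by simpa [gg] using h 0 (by omega)
  have hm := pz_simplex (x := -x) (by simpa using h1) (by simpa using h0)
  refine radon f h1 h0 ?_
  ext k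
  have := h (k.val + 1) (by omega)
  simp only [gg, Nat.succ_ne_zero, if_false, Nat.add_sub_cancel, k.2, dif_pos, sub_eq_zero] at this
  rw [← hφ k _ (pz_simplex h1 h0), ← hφ k _ hm]
  exact this

def al (C : ℕ → Finset (Finset (Fin K))) (j : ℕ) (P : Pt K) : ℝ :=
  aa (C j) P.1 P.2 + aa (C j) P.1 (-P.2) - aa (C j) (-P.1) P.2 - aa (C j) (-P.1) (-P.2)
def ga (C : ℕ → Finset (Finset (Fin K))) (j : ℕ) (P : Pt K) : ℝ :=
  aa (C j) P.1 P.2 - aa (C j) P.1 (-P.2) - aa (C j) (-P.1) P.2 + aa (C j) (-P.1) (-P.2)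

theorem aa_cont' (C : Finset (Finset (Fin K))) {u v : Pt K → Ve K} (hu : Continuous u) (hv : Continuous v) :
    Continuous (fun P => aa C (u P) (v P)) := (aa_cont C).comp (hu.prodMk hv)

theorem al_cont (C : ℕ → Finset (Finset (Fin K))) (j) : Continuous (al C j) := by
  unfold al
  exact (((aa_cont' _ continuous_fst continuous_snd).add (aa_cont' _ continuous_fst continuous_snd.neg)).sub
    (aa_cont' _ continuous_fst.neg continuous_snd)).sub (aa_cont' _ continuous_fst.neg continuous_snd.neg)
theorem ga_cont (C : ℕ → Finset (Finset (Fin K))) (j) : Continuous (ga C j) := by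
  unfold ga
  exact (((aa_cont' _ continuous_fst continuous_snd).sub (aa_cont' _ continuous_fst continuous_snd.neg)).sub
    (aa_cont' _ continuous_fst.neg continuous_snd)).add (aa_cont' _ continuous_fst.neg continuous_snd.neg)

theorem main {q d m : ℕ} (r : ℕ) (hq : q = 2^r) (hm : m = 2*q+1) (hK : d + 1 + m + q + 1 < K)
    (F : Finset (Finset (Fin K))) (hne : ∀ A ∈ F, A.Nonempty) (hχ : KneserChromaticLe F 4 m)
    (f : Ve K → EuclideanSpace ℝ (Fin d)) (hf : ContinuousOn f (stdSimplex ℝ (Fin K))) :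
    ∃ σp σm τp τm : Finset (Fin K),
      IsRadonPair f σp σm ∧ IsRadonPair f τp τm ∧
      (∀ A ∈ F, ¬A ⊆ σp ∩ τp) ∧ (∀ A ∈ F, ¬A ⊆ σp ∩ τm) ∧
      (∀ A ∈ F, ¬A ⊆ σm ∩ τp) ∧ (∀ A ∈ F, ¬A ⊆ σm ∩ τm) := by
  classical
  obtain ⟨c, hc⟩ := hχ
  have hex : ∀ k : Fin d, ∃ φ : C(Ve K, ℝ), ∀ x ∈ stdSimplex ℝ (Fin K), φ x = f x k := by
    intro k
    have hk : ContinuousOn (fun x => f x k) (stdSimplex ℝ (Fin K)) :=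
      (EuclideanSpace.proj (𝕜 := ℝ) k).continuous.comp_continuousOn hf
    obtain ⟨φ, hφ⟩ := ContinuousMap.exists_restrict_eq (isClosed_stdSimplex (𝕜 := ℝ) (Fin K))
      (⟨_, continuousOn_iff_continuous_restrict.1 hk⟩ : C(stdSimplex ℝ (Fin K), ℝ))
    exact ⟨φ, fun x hx => by simpa using DFunLike.congr_fun hφ ⟨x, hx⟩⟩
  choose φ hφ using hex
  let C : ℕ → Finset (Finset (Fin K)) := fun j => F.filter fun S => (c S).val = j
  have hCne : ∀ j, ∀ S ∈ C j, S.Nonempty := fun j S hS => hne S (Finset.mem_filter.1 hS).1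
  have hCcard : ∀ j, ∀ D ⊆ C j, (∀ A ∈ D, ∀ B ∈ D, A ≠ B → Disjoint A B) → D.card < 4 := by
    intro j D hD hdis
    refine hc D (hD.trans (Finset.filter_subset _ _)) hdis fun A hA B hB => Fin.ext ?_
    rw [(Finset.mem_filter.1 (hD hA)).2, (Finset.mem_filter.1 (hD hB)).2]
  by_contra hcon
  have fin : ∀ P : Pt K, P ∈ XX → (∀ l < d+1, gg φ l P.1 = 0) → (∀ l < d+1, gg φ l P.2 = 0) →
      (∀ j < m, aa (C j) P.1 P.2 = 0 ∧ aa (C j) P.1 (-P.2) = 0 ∧ aa (C j) (-P.1) P.2 = 0 ∧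
        aa (C j) (-P.1) (-P.2) = 0) → False := by
    intro P hP h1 h2 h3
    have hmem : ∀ A ∈ F, A ∈ C (c A).val := fun A hA => Finset.mem_filter.2 ⟨hA, rfl⟩
    exact hcon ⟨su P.1, su (-P.1), su P.2, su (-P.2), gg_zero hφ hP.1 h1, gg_zero hφ hP.2 h2,
      fun A hA => aa_zero (h3 _ (c A).2).1 A (hmem A hA),
      fun A hA => aa_zero (h3 _ (c A).2).2.1 A (hmem A hA),
      fun A hA => aa_zero (h3 _ (c A).2).2.2.1 A (hmem A hA),
      fun A hA => aa_zero (h3 _ (c A).2).2.2.2 A (hmem A hA)⟩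
  let A : ℕ → Pt K → ℝ := fun l P => if l < d + 1 then gg φ l P.1 else al C (l - (d+1)) P
  let G : ℕ → Pt K → ℝ := fun j P => if j = 0 then
    ∑ j ∈ Finset.range m, ga C j P + ∑ l ∈ Finset.range (d+1), gg φ l P.1 * gg φ l P.2 else ga C j P
  have al1 : ∀ j P, al C j (G1 P) = - al C j P := fun j P => by
    simp only [al, G1_apply, neg_neg]; ring
  have al2 : ∀ j P, al C j (G2 P) = al C j P := fun j P => by
    simp only [al, G2_apply, neg_neg]; ring
  have ga1 : ∀ j P, ga C j (G1 P) = - ga C j P := fun j P => by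
    simp only [ga, G1_apply, neg_neg]; ring
  have ga2 : ∀ j P, ga C j (G2 P) = - ga C j P := fun j P => by
    simp only [ga, G2_apply, neg_neg]; ring
  have gas : ∀ j P, ga C j (Gs P) = ga C j P := fun j P => by
    simp only [ga, Gs_apply, neg_neg, aa_comm _ P.2 P.1, aa_comm _ P.2 (-P.1), aa_comm _ (-P.2) P.1,
      aa_comm _ (-P.2) (-P.1)]; ring
  obtain ⟨P, hP, hA, hG⟩ := core (p := d + 1 + m) (r := r) (K := K) (by rw [← hq]; exact hK) A G
    (by
      intro l _
      refine Continuous.continuousOn ?_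
      simp only [A]
      split_ifs
      · exact (gg_cont φ l).comp continuous_fst
      · exact al_cont C _)
    (by
      intro j _
      refine Continuous.continuousOn ?_
      simp only [G]
      split_ifs
      · refine Continuous.add (continuous_finset_sum _ fun j _ => ga_cont C j)
          (continuous_finset_sum _ fun l _ => ?_)
        exact ((gg_cont φ l).comp continuous_fst).mul ((gg_cont φ l).comp continuous_snd)
      · exact ga_cont C _)
    (by
      intro l P _
      simp only [A, al1]
      split_ifs
      · rw [G1_apply]; exact gg_neg φ l P.1
      · rfl)
    (by
      intro l P _
      simp only [A, al2]
      split_ifs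
      · rfl
      · rfl)
    (by
      intro j P _
      simp only [G, ga1]
      split_ifs
      · simp only [G1_apply, gg_neg, Finset.sum_neg_distrib, neg_mul]; ring
      · rfl)
    (by
      intro j P _
      simp only [G, ga2]
      split_ifs
      · simp only [G2_apply, gg_neg, Finset.sum_neg_distrib, mul_neg]; ring
      · rfl)
    (by
      intro j P _
      simp only [G, gas]
      split_ifs
      · simp only [Gs_apply, mul_comm]
      · rfl)
    (by
      intro P hP hd
      simp only [G, if_true]
      have hga : ∀ j, ga C j P = aa (C j) P.1 P.1 + aa (C j) (-P.1) (-P.1) := by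
        intro j
        have e1 := aa_neg_self (hCne j) P.1
        have e2 := aa_neg_self (hCne j) (-P.1)
        rw [neg_neg] at e2
        simp only [ga, ← hd, e1, e2]; ring
      have n1 : ∀ j ∈ Finset.range m, 0 ≤ ga C j P := fun j _ => by
        rw [hga]; exact add_nonneg (aa_nonneg _ _ _) (aa_nonneg _ _ _)
      have n2 : ∀ l ∈ Finset.range (d+1), 0 ≤ gg φ l P.1 * gg φ l P.2 := fun l _ => by
        rw [← hd]; exact mul_self_nonneg _
      have s1 := Finset.sum_nonneg n1
      have s2 := Finset.sum_nonneg n2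
      rcases (add_nonneg s1 s2).lt_or_eq with h | h
      · exact h
      · exfalso
        have z1 : ∑ j ∈ Finset.range m, ga C j P = 0 := by linarith
        have z2 : ∑ l ∈ Finset.range (d+1), gg φ l P.1 * gg φ l P.2 = 0 := by linarith
        rw [Finset.sum_eq_zero_iff_of_nonneg n1] at z1
        rw [Finset.sum_eq_zero_iff_of_nonneg n2] at z2
        have z3 : ∀ l < d+1, gg φ l P.1 = 0 := fun l hl => by
          have := z2 l (Finset.mem_range.2 hl)
          rw [← hd] at this
          exact mul_self_eq_zero.1 this
        refine fin P hP z3 (hd ▸ z3) fun j hj => ?_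
        have := z1 j (Finset.mem_range.2 hj)
        rw [hga] at this
        have p1 := aa_nonneg (C j) P.1 P.1
        have p2 := aa_nonneg (C j) (-P.1) (-P.1)
        have e1 := aa_neg_self (hCne j) P.1
        have e2 := aa_neg_self (hCne j) (-P.1)
        rw [neg_neg] at e2
        rw [← hd]
        exact ⟨by linarith, e1, e2, by linarith⟩)
  have z1 : ∀ l < d+1, gg φ l P.1 = 0 := fun l hl => by
    have := (hA l (by omega)).1
    simpa only [A, if_pos hl] using this
  have z2 : ∀ l < d+1, gg φ l P.2 = 0 := fun l hl => by
    have := (hA l (by omega)).2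
    simp only [A, if_pos hl] at this
    exact this
  have z3 : ∀ j < m, al C j P = 0 ∧ al C j (Gs P) = 0 := fun j hj => by
    have := hA (d + 1 + j) (by omega)
    simpa only [A, if_neg (show ¬ d + 1 + j < d + 1 by omega), Nat.add_sub_cancel_left] using this
  have z4 : ∀ j < m, ga C j P = 0 := by
    have hp : ∀ j < m, j ≠ 0 → ga C j P = 0 := fun j hj h0 => by
      have := hG j (by rw [← hq]; omega)
      simpa only [G, if_neg h0] using this
    intro j hj
    rcases eq_or_ne j 0 with rfl | h0
    · have := hG 0 (by omega)
      simp only [G, if_true] at this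
      rw [Finset.sum_eq_zero (s := Finset.range (d+1)) (fun l hl => by
        rw [z1 l (Finset.mem_range.1 hl), zero_mul]), add_zero,
        Finset.sum_eq_single_of_mem 0 (Finset.mem_range.2 hj)
          (fun j hj h0 => hp j (Finset.mem_range.1 hj) h0)] at this
      exact this
    · exact hp j hj h0
  exact fin P hP z1 z2 fun j hj => four (hCne j) (hCcard j) P.1 P.2 (z3 j hj).1 (z3 j hj).2 (z4 j hj)

end app
end
end TRP


/-- **Two interacting Radon pairs, `m = 2^s + 1`.** Let `m = 2^s + 1` with `s ≥ 1`, `d ≥ 1`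
and `n ≥ d + ⌈3m/2⌉ + 1`. If `F` is a family of nonempty subsets of `[n+1]` with
`χ(KG⁴(F)) ≤ m`, then any continuous `f : Δ_n → ℝ^d` admits two Radon pairs such that none
of the four mutual intersections contains a member of `F`. -/
theorem two_radon_pairs_pow_two_plus_one (s m d n : ℕ) (hs : 1 ≤ s)
    (hm : m = 2 ^ s + 1) (hd : 1 ≤ d) (hn : d + (3 * m + 1) / 2 + 1 ≤ n)
    (F : Finset (Finset (Fin (n + 1)))) (hne : ∀ A ∈ F, A.Nonempty)
    (hχ : KneserChromaticLe F 4 m)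
    (f : (Fin (n + 1) → ℝ) → EuclideanSpace ℝ (Fin d))
    (hf : ContinuousOn f (stdSimplex ℝ (Fin (n + 1)))) :
    ∃ σp σm τp τm : Finset (Fin (n + 1)),
      IsRadonPair f σp σm ∧ IsRadonPair f τp τm ∧
      (∀ A ∈ F, ¬A ⊆ σp ∩ τp) ∧ (∀ A ∈ F, ¬A ⊆ σp ∩ τm) ∧
      (∀ A ∈ F, ¬A ⊆ σm ∩ τp) ∧ (∀ A ∈ F, ¬A ⊆ σm ∩ τm) := by
  obtain ⟨r, rfl⟩ : ∃ r, s = r + 1 := ⟨s - 1, by omega⟩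
  have hm2 : m = 2 * 2 ^ r + 1 := by rw [hm, pow_succ]; ring
  exact TRP.main (q := 2 ^ r) r rfl hm2 (by omega) F hne hχ f hf
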